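/- Let n ≥ 3 and let K ∈ C^1(B_1) be a positive function satisfying K(x) = K(0) + O(|x|) near the origin. Let v be a positive solution of (C) in ℝ_+ × S^{n−1} and let ξ be a positive periodic solution of (F) such that v(t,θ) → ξ(t) as t → ∞ uniformly in θ ∈ S^{n−1}. Then there is a constant C > 0 such that |v(t,θ) − ξ(t)| ≤ C t e^{−t} for all (t,θ) ∈ (1,∞) × S^{n−1}. -/

import Mathlib

open Real Set Metric Filter Function

noncomputable section

/-- The Euclidean Laplacian of `f` at `x`. -/
def lapE {n : ℕ} (f : EuclideanSpace ℝ (Fin n) → ℝ) (x : EuclideanSpace ℝ (Fin n)) : ℝ :=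
  ∑ i : Fin n, iteratedFDeriv ℝ 2 f x ![EuclideanSpace.single i 1, EuclideanSpace.single i 1]

/-- The Laplace–Beltrami operator `Δ_θ` on the unit sphere `S^{n-1}`, computed via the
degree-zero homogeneous extension: for `θ` with `‖θ‖ = 1`, `sphLap f θ = Δ_θ f (θ)`. -/
def sphLap {n : ℕ} (f : EuclideanSpace ℝ (Fin n) → ℝ) (θ : EuclideanSpace ℝ (Fin n)) : ℝ :=
  lapE (fun x => f (‖x‖⁻¹ • x)) θ

/-- Second derivative in the `t` variable. -/
def dtt (g : ℝ → ℝ) : ℝ → ℝ := deriv (deriv g)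

/-- Dimension of the space of spherical harmonics on `S^{n-1}` of degree at most `d`. -/
def cumHarm (n d : ℕ) : ℕ := Nat.choose (n - 1 + d) (n - 1) + Nat.choose (n - 2 + d) (n - 1)

/-- The degree of the `i`-th spherical harmonic, eigenfunctions being listed with multiplicity. -/
def sphDeg (n i : ℕ) : ℕ := sInf {d | i < cumHarm n d}

/-- The `i`-th eigenvalue `λ_i` of `-Δ_θ` on `S^{n-1}`, listed in increasing order and
repeated with multiplicity: `λ_i = d (n + d - 2)` where `d` is the degree of the `i`-th
spherical harmonic.  In particular `λ_0 = 0`, `λ_1 = ⋯ = λ_n = n - 1`, `λ_{n+1} = 2n`. -/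
def sphEval (n i : ℕ) : ℝ := (sphDeg n i : ℝ) * ((n : ℝ) + (sphDeg n i : ℝ) - 2)

/-- The linearized operator `L_i = -d²/dt² + λ + (n-2)²/4 - ((n+2)/(n-2)) K(0) ξ^{4/(n-2)}`. -/
def Lop (n : ℕ) (K0 : ℝ) (ξ : ℝ → ℝ) (lam : ℝ) (h : ℝ → ℝ) : ℝ → ℝ :=
  fun t => -dtt h t
    + (lam + ((n : ℝ) - 2) ^ 2 / 4
        - ((n : ℝ) + 2) / ((n : ℝ) - 2) * K0 * ξ t ^ ((4 : ℝ) / ((n : ℝ) - 2))) * h t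

/-- The linearized operator `𝓛_i = -d²/dt² + λ + (n-2a-2)²/4 - (p-1) ζ^{p-2}` for the
Caffarelli-Kohn-Nirenberg equation. -/
def LopCKN (n : ℕ) (a p : ℝ) (ζ : ℝ → ℝ) (lam : ℝ) (h : ℝ → ℝ) : ℝ → ℝ :=
  fun t => -dtt h t + (lam + ((n : ℝ) - 2 * a - 2) ^ 2 / 4 - (p - 1) * ζ t ^ (p - 2)) * h t

/-- `f, g` is a basis of the kernel of the second-order ODE operator `L` acting on `C²(ℝ)`. -/
def KerBasis (L : (ℝ → ℝ) → ℝ → ℝ) (f g : ℝ → ℝ) : Prop :=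
  ContDiff ℝ 2 f ∧ ContDiff ℝ 2 g ∧ (∀ t, L f t = 0) ∧ (∀ t, L g t = 0) ∧
    LinearIndependent ℝ ![f, g] ∧
    ∀ h : ℝ → ℝ, ContDiff ℝ 2 h → (∀ t, L h t = 0) →
      ∃ c₁ c₂ : ℝ, ∀ t, h t = c₁ * f t + c₂ * g t

/-- `ξ` is a positive `T`-periodic solution of the Fowler equation
`-ξ'' + ((n-2)²/4) ξ = K(0) ξ^{(n+2)/(n-2)}` on `ℝ`. -/
def FowlerXi (n : ℕ) (K0 : ℝ) (ξ : ℝ → ℝ) (T : ℝ) : Prop :=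
  ContDiff ℝ 2 ξ ∧ (∀ t, 0 < ξ t) ∧ 0 < T ∧ Function.Periodic ξ T ∧
    ∀ t, -dtt ξ t + ((n : ℝ) - 2) ^ 2 / 4 * ξ t = K0 * ξ t ^ (((n : ℝ) + 2) / ((n : ℝ) - 2))

/-- `ζ` is a positive `T`-periodic solution of `-ζ'' + ((n-2a-2)²/4) ζ = ζ^{p-1}` on `ℝ`. -/
def ZetaSol (n : ℕ) (a p : ℝ) (ζ : ℝ → ℝ) (T : ℝ) : Prop :=
  ContDiff ℝ 2 ζ ∧ (∀ t, 0 < ζ t) ∧ 0 < T ∧ Function.Periodic ζ T ∧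
    ∀ t, -dtt ζ t + ((n : ℝ) - 2 * a - 2) ^ 2 / 4 * ζ t = ζ t ^ (p - 1)

/-- `ρ` is the increasing, divergent sequence of positive exponents such that, for every
`i ≥ 1`, the kernel of the linearized operator `L_i` at the Fowler solution `ξ` has a basis
`e^{-ρ_i t} p_i⁺(t)`, `e^{ρ_i t} p_i⁻(t)` with `p_i^±` smooth and `T`-periodic. -/
def FowlerExponents (n : ℕ) (K0 : ℝ) (ξ : ℝ → ℝ) (T : ℝ) (ρ : ℕ → ℝ) : Prop :=
  (∀ i, 1 ≤ i → 0 < ρ i) ∧ (∀ i j, 1 ≤ i → i ≤ j → ρ i ≤ ρ j) ∧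
    Tendsto ρ atTop atTop ∧
    ∀ i, 1 ≤ i → ∃ p₁ p₂ : ℝ → ℝ, ContDiff ℝ (⊤ : ℕ∞) p₁ ∧ ContDiff ℝ (⊤ : ℕ∞) p₂ ∧
      Function.Periodic p₁ T ∧ Function.Periodic p₂ T ∧
      KerBasis (Lop n K0 ξ (sphEval n i))
        (fun t => Real.exp (-(ρ i) * t) * p₁ t) (fun t => Real.exp (ρ i * t) * p₂ t)

/-- Analogue of `FowlerExponents` for the CKN linearized operators `𝓛_i`. -/
def CKNExponents (n : ℕ) (a p : ℝ) (ζ : ℝ → ℝ) (T : ℝ) (σ : ℕ → ℝ) : Prop :=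
  (∀ i, 1 ≤ i → 0 < σ i) ∧ (∀ i j, 1 ≤ i → i ≤ j → σ i ≤ σ j) ∧
    Tendsto σ atTop atTop ∧
    ∀ i, 1 ≤ i → ∃ q₁ q₂ : ℝ → ℝ, ContDiff ℝ (⊤ : ℕ∞) q₁ ∧ ContDiff ℝ (⊤ : ℕ∞) q₂ ∧
      Function.Periodic q₁ T ∧ Function.Periodic q₂ T ∧
      KerBasis (LopCKN n a p ζ (sphEval n i))
        (fun t => Real.exp (-(σ i) * t) * q₁ t) (fun t => Real.exp (σ i * t) * q₂ t)

/-- The index set `{ Σ_{i≥1} nᵢ ρᵢ > 0 : nᵢ ∈ ℕ, finitely many nᵢ > 0 }`. -/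
def IndexSet (ρ : ℕ → ℝ) : Set ℝ :=
  {s | 0 < s ∧ ∃ f : ℕ →₀ ℕ, (∀ i ∈ f.support, 1 ≤ i) ∧
    s = ∑ i ∈ f.support, (f i : ℝ) * ρ i}

/-- `v` is a positive solution on `(t₀, ∞) × S^{n-1}` of the cylindrical conformal scalar
curvature equation `-v_tt - Δ_θ v + ((n-2)²/4) v = K(e^{-t}θ) v^{(n+2)/(n-2)}`. -/
def SolCyl (n : ℕ) (K : EuclideanSpace ℝ (Fin n) → ℝ)
    (v : ℝ → EuclideanSpace ℝ (Fin n) → ℝ) (t₀ : ℝ) : Prop :=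
  (∀ t θ, t₀ < t → ‖θ‖ = 1 → 0 < v t θ) ∧
    ∀ (t : ℝ) (θ : EuclideanSpace ℝ (Fin n)), t₀ < t → ‖θ‖ = 1 →
      -dtt (fun s => v s θ) t - sphLap (v t) θ + ((n : ℝ) - 2) ^ 2 / 4 * v t θ
        = K (Real.exp (-t) • θ) * v t θ ^ (((n : ℝ) + 2) / ((n : ℝ) - 2))

/-- `w` is a positive solution on `(t₀, ∞) × S^{n-1}` of the cylindrical CKN equation
`-w_tt - Δ_θ w + ((n-2a-2)²/4) w = w^{p-1}`. -/
def SolCylW (n : ℕ) (a p : ℝ) (w : ℝ → EuclideanSpace ℝ (Fin n) → ℝ) (t₀ : ℝ) : Prop :=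
  (∀ t θ, t₀ < t → ‖θ‖ = 1 → 0 < w t θ) ∧
    ∀ (t : ℝ) (θ : EuclideanSpace ℝ (Fin n)), t₀ < t → ‖θ‖ = 1 →
      -dtt (fun s => w s θ) t - sphLap (w t) θ + ((n : ℝ) - 2 * a - 2) ^ 2 / 4 * w t θ
        = w t θ ^ (p - 1)

/-- `v(t, θ) → ξ(t)` as `t → ∞`, uniformly for `θ ∈ S^{n-1}`. -/
def UnifConv {n : ℕ} (v : ℝ → EuclideanSpace ℝ (Fin n) → ℝ) (ξ : ℝ → ℝ) : Prop :=
  ∀ ε > 0, ∃ T : ℝ, ∀ t ≥ T, ∀ θ : EuclideanSpace ℝ (Fin n), ‖θ‖ = 1 → |v t θ - ξ t| < ε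

/-- The degree-zero homogeneous (in the sphere variable) representative of a function on the
cylinder `ℝ × S^{n-1}`. -/
def cylRep {n : ℕ} (F : ℝ → EuclideanSpace ℝ (Fin n) → ℝ) :
    ℝ × EuclideanSpace ℝ (Fin n) → ℝ :=
  fun pt => F pt.1 (‖pt.2‖⁻¹ • pt.2)

/-- The norm of the intrinsic gradient on the cylinder `ℝ × S^{n-1}` at `(t, θ)`. -/
def cylGrad {n : ℕ} (F : ℝ → EuclideanSpace ℝ (Fin n) → ℝ) (t : ℝ)
    (θ : EuclideanSpace ℝ (Fin n)) : ℝ :=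
  ‖fderiv ℝ (cylRep F) (t, θ)‖

/-- Membership in `C^{2,α}` of a region `s` of the cylinder. -/
def CylC2Holder {n : ℕ} (α : ℝ) (s : Set (ℝ × EuclideanSpace ℝ (Fin n)))
    (F : ℝ → EuclideanSpace ℝ (Fin n) → ℝ) : Prop :=
  ContDiffOn ℝ 2 (cylRep F) s ∧
    ∃ C : ℝ, ∀ p ∈ s, ∀ q ∈ s,
      ‖iteratedFDerivWithin ℝ 2 (cylRep F) s p - iteratedFDerivWithin ℝ 2 (cylRep F) s q‖
        ≤ C * ‖p - q‖ ^ α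

/-- A bounded smooth function on `(t₀, ∞) × S^{n-1}`. -/
def BddSmoothCyl {n : ℕ} (t₀ : ℝ) (c : ℝ → EuclideanSpace ℝ (Fin n) → ℝ) : Prop :=
  ContDiffOn ℝ (⊤ : ℕ∞) (cylRep c)
      ((Ioi t₀) ×ˢ {x : EuclideanSpace ℝ (Fin n) | x ≠ 0}) ∧
    ∃ M : ℝ, ∀ t θ, t₀ < t → ‖θ‖ = 1 → |c t θ| ≤ M

/-- The nonlinear operator `𝓜(f) = -f_tt - Δ_θ f + ((n-2)²/4) f - K f^{(n+2)/(n-2)}`. -/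
def Mop (n : ℕ) (K : EuclideanSpace ℝ (Fin n) → ℝ)
    (f : ℝ → EuclideanSpace ℝ (Fin n) → ℝ) (t : ℝ) (θ : EuclideanSpace ℝ (Fin n)) : ℝ :=
  -dtt (fun s => f s θ) t - sphLap (f t) θ + ((n : ℝ) - 2) ^ 2 / 4 * f t θ
    - K (Real.exp (-t) • θ) * f t θ ^ (((n : ℝ) + 2) / ((n : ℝ) - 2))

/-- The nonlinear operator `𝓝(f) = -f_tt - Δ_θ f + ((n-2a-2)²/4) f - f^{p-1}`. -/
def Nop (n : ℕ) (a p : ℝ)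
    (f : ℝ → EuclideanSpace ℝ (Fin n) → ℝ) (t : ℝ) (θ : EuclideanSpace ℝ (Fin n)) : ℝ :=
  -dtt (fun s => f s θ) t - sphLap (f t) θ + ((n : ℝ) - 2 * a - 2) ^ 2 / 4 * f t θ
    - f t θ ^ (p - 1)

/-- Analytic package for a positive periodic Fowler solution. -/
structure FD (c K0 p : ℝ) (ξ ξ' : ℝ → ℝ) (T : ℝ) : Prop where
  hc : 0 < c
  hK : 0 < K0
  hp : p * c = c + 2
  pos : ∀ t, 0 < ξ t
  hT : 0 < T
  per : Function.Periodic ξ T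
  d1 : ∀ t, HasDerivAt ξ (ξ' t) t
  d2 : ∀ t, HasDerivAt ξ' (c ^ 2 * ξ t - K0 * ξ t ^ p) t

namespace FD
variable {c K0 p : ℝ} {ξ ξ' : ℝ → ℝ} {T : ℝ}

theorem p_gt (h : FD c K0 p ξ ξ' T) : 1 < p := by
  have := h.hc
  have := h.hp
  by_contra hh
  push Not at hh
  nlinarith

theorem cont (h : FD c K0 p ξ ξ' T) : Continuous ξ :=
  continuous_iff_continuousAt.2 fun t => (h.d1 t).continuousAt

theorem cont' (h : FD c K0 p ξ ξ' T) : Continuous ξ' :=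
  continuous_iff_continuousAt.2 fun t => (h.d2 t).continuousAt

theorem per' (h : FD c K0 p ξ ξ' T) : Function.Periodic ξ' T := by
  intro t
  have h1 := h.d1 (t + T)
  have h2 : HasDerivAt (fun s => ξ (s + T)) (ξ' (t + T)) t := by
    simpa using h1.comp_add_const t T
  have h3 : (fun s => ξ (s + T)) = ξ := funext h.per
  rw [h3] at h2
  exact h2.unique (h.d1 t)

theorem exists_max_min (h : FD c K0 p ξ ξ' T) :
    (∃ a, ∀ t, ξ t ≤ ξ a) ∧ (∃ a, ∀ t, ξ a ≤ ξ t) := by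
  constructor
  · obtain ⟨a, -, ha⟩ := isCompact_Icc.exists_isMaxOn (nonempty_Icc.2 h.hT.le) h.cont.continuousOn
    refine ⟨a, fun t => ?_⟩
    obtain ⟨s, hs, hs'⟩ := h.per.exists_mem_Ico₀ h.hT t
    rw [hs']; exact ha ⟨hs.1, hs.2.le⟩
  · obtain ⟨a, -, ha⟩ := isCompact_Icc.exists_isMinOn (nonempty_Icc.2 h.hT.le) h.cont.continuousOn
    refine ⟨a, fun t => ?_⟩
    obtain ⟨s, hs, hs'⟩ := h.per.exists_mem_Ico₀ h.hT t
    rw [hs']; exact ha ⟨hs.1, hs.2.le⟩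

theorem bdd' (h : FD c K0 p ξ ξ' T) : ∃ M, 0 < M ∧ ∀ t, |ξ' t| ≤ M := by
  obtain ⟨C, hC⟩ := isCompact_Icc.exists_bound_of_continuousOn (s := Icc 0 T) h.cont'.continuousOn
  refine ⟨max C 1, by positivity, fun t => ?_⟩
  obtain ⟨s, hs, hs'⟩ := h.per'.exists_mem_Ico₀ h.hT t
  rw [hs']; exact (hC s ⟨hs.1, hs.2.le⟩).trans (le_max_left _ _)

/-- Hamiltonian. -/
def ham (c K0 p : ℝ) (x y : ℝ) : ℝ := y ^ 2 - c ^ 2 * x ^ 2 + 2 / (p + 1) * K0 * x ^ (p + 1)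

theorem ham_deriv {c K0 p : ℝ} (hp : 1 < p) {y y' : ℝ → ℝ} {a t : ℝ} (hy : 0 < y t)
    (h1 : HasDerivAt y (y' t) t) (h2 : HasDerivAt y' a t) :
    HasDerivAt (fun s => ham c K0 p (y s) (y' s)) (2 * y' t * (a - (c ^ 2 * y t - K0 * y t ^ p))) t := by
  unfold ham
  have h3 := h1.rpow_const (p := p + 1) (Or.inl hy.ne')
  have := ((h2.pow 2).sub ((h1.pow 2).const_mul (c ^ 2))).add (h3.const_mul (2 / (p + 1) * K0))
  refine this.congr_deriv ?_
  have : p + 1 ≠ 0 := by linarith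
  simp only [add_sub_cancel_right]
  field_simp
  push_cast
  ring

theorem ham_const (h : FD c K0 p ξ ξ' T) (s t : ℝ) :
    ham c K0 p (ξ s) (ξ' s) = ham c K0 p (ξ t) (ξ' t) := by
  have hd : ∀ t, HasDerivAt (fun s => ham c K0 p (ξ s) (ξ' s)) 0 t := by
    intro t
    refine (ham_deriv h.p_gt (h.pos t) (h.d1 t) (h.d2 t)).congr_deriv (by ring)
  exact is_const_of_deriv_eq_zero (fun t => (hd t).differentiableAt) (fun t => (hd t).deriv) s t

theorem crit_max (h : FD c K0 p ξ ξ' T) {a : ℝ} (ha : ∀ t, ξ t ≤ ξ a) : ξ' a = 0 :=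
  IsLocalMax.hasDerivAt_eq_zero (Filter.Eventually.of_forall ha) (h.d1 a)

theorem crit_min (h : FD c K0 p ξ ξ' T) {a : ℝ} (ha : ∀ t, ξ a ≤ ξ t) : ξ' a = 0 :=
  IsLocalMin.hasDerivAt_eq_zero (Filter.Eventually.of_forall ha) (h.d1 a)

end FD

/-- Second derivative test, necessary condition. -/
theorem second_deriv_nonpos {f f' : ℝ → ℝ} {a d : ℝ} (hf : ∀ᶠ s in nhds a, HasDerivAt f (f' s) s)
    (hd : HasDerivAt f' d a) (hmax : IsLocalMax f a) : d ≤ 0 := by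
  by_contra hcon
  push Not at hcon
  have he : deriv f =ᶠ[nhds a] f' := hf.mono fun s hs => hs.deriv
  have h2 : deriv (deriv f) a = d := by rw [he.deriv_eq, hd.deriv]
  have h1 : deriv f a = 0 := hmax.deriv_eq_zero
  have hmin := isLocalMin_of_deriv_deriv_pos (by rw [h2]; exact hcon) h1
    hf.self_of_nhds.continuousAt
  have hconst : f =ᶠ[nhds a] fun _ => f a := by
    filter_upwards [hmax, hmin] with s h1 h2 using le_antisymm h1 h2
  have h3 : deriv f =ᶠ[nhds a] fun _ => 0 := by
    have := hconst.deriv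
    simpa using this
  have h4 : deriv (deriv f) a = 0 := by rw [h3.deriv_eq]; simp
  linarith

namespace FD
variable {c K0 p : ℝ} {ξ ξ' : ℝ → ℝ} {T : ℝ}

theorem ham_neg (h : FD c K0 p ξ ξ' T) (t : ℝ) : ham c K0 p (ξ t) (ξ' t) < 0 := by
  obtain ⟨a, ha⟩ := h.exists_max_min.2
  rw [h.ham_const t a, h.crit_min ha]
  have hmax : IsLocalMax (fun s => - ξ s) a :=
    Filter.Eventually.of_forall fun t => neg_le_neg (ha t)
  have h2 := second_deriv_nonpos (Filter.Eventually.of_forall fun s => (h.d1 s).neg) (h.d2 a).neg hmax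
  have hx := h.pos a
  have hp := h.p_gt
  unfold ham
  rw [rpow_add_one hx.ne']
  have h3 : K0 * ξ a ^ p ≤ c ^ 2 * ξ a := by linarith
  have h4 : K0 * (ξ a ^ p * ξ a) ≤ c ^ 2 * ξ a ^ 2 := by nlinarith
  have h5 : 2 / (p + 1) < 1 := by rw [div_lt_one (by linarith)]; linarith
  have h6 : 0 < K0 * (ξ a ^ p * ξ a) := mul_pos h.hK (mul_pos (rpow_pos_of_pos hx _) hx)
  nlinarith

/-- uniform positivity of `c²ξ² - ξ'²`. -/
theorem D_pos (h : FD c K0 p ξ ξ' T) : ∃ d > 0, ∀ t, d ≤ c ^ 2 * ξ t ^ 2 - ξ' t ^ 2 := by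
  refine ⟨- ham c K0 p (ξ 0) (ξ' 0), by linarith [h.ham_neg 0], fun t => ?_⟩
  rw [h.ham_const 0 t]
  unfold ham
  have : 0 < 2 / (p + 1) * K0 * ξ t ^ (p + 1) :=
    mul_pos (mul_pos (by have := h.p_gt; positivity) h.hK) (rpow_pos_of_pos (h.pos t) _)
  linarith

theorem PQ_bounds (h : FD c K0 p ξ ξ' T) : ∃ m > 0, ∃ M > 0, ∀ t,
    m ≤ c * ξ t - ξ' t ∧ c * ξ t - ξ' t ≤ M ∧ m ≤ c * ξ t + ξ' t ∧ c * ξ t + ξ' t ≤ M := by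
  obtain ⟨d, hd, hD⟩ := h.D_pos
  obtain ⟨a, ha⟩ := h.exists_max_min.1
  have hc := h.hc
  have hM : 0 < 2 * c * ξ a := by have := h.pos a; positivity
  refine ⟨d / (2 * c * ξ a), by positivity, 2 * c * ξ a, hM, fun t => ?_⟩
  have h1 := hD t
  have h2 := h.pos t
  have h3 := ha t
  have habs : |ξ' t| < c * ξ t := by
    apply abs_lt_of_sq_lt_sq _ (by positivity)
    nlinarith
  obtain ⟨h4, h5⟩ := abs_lt.1 habs
  have h6 : c * ξ t ≤ c * ξ a := by gcongr
  have key : ∀ x y : ℝ, 0 < x → x ≤ 2 * c * ξ a → d ≤ y * x → d / (2 * c * ξ a) ≤ y := by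
    intro x y hx hx' hy
    rw [div_le_iff₀ hM]
    have : 0 < y := by by_contra hh; push Not at hh; nlinarith
    nlinarith
  refine ⟨key (c * ξ t + ξ' t) _ (by linarith) (by linarith) (by nlinarith), by linarith,
    key (c * ξ t - ξ' t) _ (by linarith) (by linarith) (by nlinarith), by linarith⟩

end FD

/-- Reduction-of-order computation behind all barriers. -/
theorem barrier_gen {V φ₁ φ₁' φ₂ φ₂' : ℝ → ℝ} {w : ℝ}
    (h1 : ∀ t, HasDerivAt φ₁ (φ₁' t) t) (h1' : ∀ t, HasDerivAt φ₁' (V t * φ₁ t) t)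
    (h2 : ∀ t, HasDerivAt φ₂ (φ₂' t) t)
    (p1 : ∀ t, 0 < φ₁ t) (p2 : ∀ t, 0 < φ₂ t)
    (hw : ∀ t, φ₁ t * φ₂' t - φ₂ t * φ₁' t = w)
    {g g1 g2 : ℝ → ℝ} (hg : ∀ x, HasDerivAt g (g1 x) x) (hg1 : ∀ x, HasDerivAt g1 (g2 x) x) :
    ∃ h' : ℝ → ℝ, ∀ t, HasDerivAt (fun s => φ₁ s * g (log (φ₂ s) - log (φ₁ s))) (h' t) t ∧
      HasDerivAt h' (V t * (φ₁ t * g (log (φ₂ t) - log (φ₁ t)))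
        + φ₁ t * (w / (φ₁ t * φ₂ t)) ^ 2 * (g2 (log (φ₂ t) - log (φ₁ t)) - g1 (log (φ₂ t) - log (φ₁ t)))) t := by
  have hl : ∀ t, HasDerivAt (fun s => log (φ₂ s) - log (φ₁ s)) (w / (φ₁ t * φ₂ t)) t := by
    intro t
    refine (((h2 t).log (p2 t).ne').sub ((h1 t).log (p1 t).ne')).congr_deriv ?_
    have := (p1 t).ne'
    have := (p2 t).ne'
    rw [← hw t]
    field_simp
  refine ⟨fun t => φ₁' t * g (log (φ₂ t) - log (φ₁ t))
      + φ₁ t * (g1 (log (φ₂ t) - log (φ₁ t)) * (w / (φ₁ t * φ₂ t))), fun t => ⟨?_, ?_⟩⟩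
  · exact (h1 t).mul ((hg _).comp t (hl t))
  · have hn1 := (p1 t).ne'
    have hn2 := (p2 t).ne'
    have hG : HasDerivAt (fun s => w / (φ₁ s * φ₂ s))
        (-(w * (φ₁' t * φ₂ t + φ₁ t * φ₂' t)) / (φ₁ t * φ₂ t) ^ 2) t := by
      refine ((hasDerivAt_const t w).div ((h1 t).mul (h2 t)) (mul_ne_zero hn1 hn2)).congr_deriv ?_
      simp
    refine (((h1' t).mul ((hg _).comp t (hl t))).add
      ((h1 t).mul (((hg1 _).comp t (hl t)).mul hG))).congr_deriv ?_
    simp only [Function.comp, Pi.mul_apply]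
    have := hw t
    set L := log (φ₂ t) - log (φ₁ t)
    rw [← this]
    field_simp
    ring

namespace FD
variable {c K0 p : ℝ} {ξ ξ' : ℝ → ℝ} {T : ℝ}

/-- The potential of the degree-one linearized operator. -/
def pot (c K0 p : ℝ) (ξ : ℝ → ℝ) (t : ℝ) : ℝ := 2 * c + 1 + c ^ 2 - p * K0 * ξ t ^ (p - 1)

theorem bar (h : FD c K0 p ξ ξ' T) : ∃ φ ℓ : ℝ → ℝ, ∃ κ > 0, ∃ m > 0, ∃ M > 0,
    (∀ t, m * exp (-t) ≤ φ t ∧ φ t ≤ M * exp (-t)) ∧ (∀ t, |ℓ t - 2 * t| ≤ M) ∧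
    ∀ g g1 g2 : ℝ → ℝ, (∀ x, HasDerivAt g (g1 x) x) → (∀ x, HasDerivAt g1 (g2 x) x) →
      (∀ x, g2 x ≤ g1 x) → ∃ h' : ℝ → ℝ, ∃ h'' : ℝ → ℝ, ∀ t,
        HasDerivAt (fun s => φ s * g (ℓ s)) (h' t) t ∧ HasDerivAt h' (h'' t) t ∧
        κ * (φ t * (g1 (ℓ t) - g2 (ℓ t))) ≤ - h'' t + pot c K0 p ξ t * (φ t * g (ℓ t)) := by
  obtain ⟨m, hm, M, hM, hb⟩ := h.PQ_bounds
  obtain ⟨d, hd, hD⟩ := h.D_pos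
  have hc := h.hc
  have hp := h.p_gt
  set P : ℝ → ℝ := fun t => c * ξ t - ξ' t with hP
  set Q : ℝ → ℝ := fun t => c * ξ t + ξ' t with hQ
  have hPpos : ∀ t, 0 < P t := fun t => hm.trans_le (hb t).1
  have hQpos : ∀ t, 0 < Q t := fun t => hm.trans_le (hb t).2.2.1
  set A : ℝ → ℝ := fun t => c ^ 2 * ξ t - K0 * ξ t ^ p with hA
  have hξp : ∀ t, HasDerivAt (fun s => ξ s ^ p) (p * ξ t ^ (p - 1) * ξ' t) t := by
    intro t
    refine ((h.d1 t).rpow_const (p := p) (Or.inl (h.pos t).ne')).congr_deriv (by ring)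
  have hAd : ∀ t, HasDerivAt A (c ^ 2 * ξ' t - K0 * (p * ξ t ^ (p - 1) * ξ' t)) t := fun t =>
    ((h.d1 t).const_mul (c ^ 2)).sub ((hξp t).const_mul K0)
  have hPd : ∀ t, HasDerivAt P (c * ξ' t - A t) t := fun t =>
    ((h.d1 t).const_mul c).sub (h.d2 t)
  have hQd : ∀ t, HasDerivAt Q (c * ξ' t + A t) t := fun t =>
    ((h.d1 t).const_mul c).add (h.d2 t)
  have hem : ∀ t, HasDerivAt (fun s => exp (-s)) (-exp (-t)) t := fun t => by
    simpa using (hasDerivAt_neg t).exp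
  have hep : ∀ t, HasDerivAt (fun s => exp s) (exp t) t := fun t => Real.hasDerivAt_exp t
  have hpow : ∀ t, ξ t ^ p = ξ t ^ (p - 1) * ξ t := fun t => by
    rw [← rpow_add_one (h.pos t).ne']; ring_nf
  set w := 2 * (1 + c) * (- ham c K0 p (ξ 0) (ξ' 0)) with hw
  have hwpos : 0 < w := by
    have := h.ham_neg 0
    have : 0 < - ham c K0 p (ξ 0) (ξ' 0) := by linarith
    positivity
  have hWr : ∀ t, (exp (-t) * P t) * (exp t * (Q t + (c * ξ' t + A t)))
      - (exp t * Q t) * (exp (-t) * (c * ξ' t - A t - P t)) = w := by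
    intro t
    have he : exp (-t) * exp t = 1 := by rw [← exp_add]; simp
    have h1 : (exp (-t) * P t) * (exp t * (Q t + (c * ξ' t + A t)))
      - (exp t * Q t) * (exp (-t) * (c * ξ' t - A t - P t))
      = (exp (-t) * exp t) * (P t * (Q t + (c * ξ' t + A t)) - Q t * (c * ξ' t - A t - P t)) := by ring
    rw [h1, he, hw, h.ham_const 0 t]
    simp only [hP, hQ, hA, ham]
    rw [rpow_add_one (h.pos t).ne']
    have hp1 : p + 1 ≠ 0 := by linarith
    have hpc : p = (c + 2) / c := by rw [eq_div_iff hc.ne']; exact h.hp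
    have h2 : 2 / (p + 1) = c / (c + 1) := by
      rw [hpc]; field_simp; ring
    rw [h2]
    have : c + 1 ≠ 0 := by positivity
    field_simp
    ring
  have hφ1 : ∀ t, HasDerivAt (fun s => exp (-s) * P s) (exp (-t) * (c * ξ' t - A t - P t)) t := fun t =>
    ((hem t).mul (hPd t)).congr_deriv (by ring)
  have hφ2 : ∀ t, HasDerivAt (fun s => exp s * Q s) (exp t * (Q t + (c * ξ' t + A t))) t := fun t =>
    ((hep t).mul (hQd t)).congr_deriv (by ring)
  have hφ1' : ∀ t, HasDerivAt (fun s => exp (-s) * (c * ξ' s - A s - P s))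
      (pot c K0 p ξ t * (exp (-t) * P t)) t := by
    intro t
    refine ((hem t).mul ((((h.d2 t).const_mul c).sub (hAd t)).sub (hPd t))).congr_deriv ?_
    simp only [Pi.sub_apply, hA, hP, pot, hpow]
    have h3 : p * c = c + 2 := h.hp
    linear_combination (exp (-t) * K0 * ξ t * ξ t ^ (p - 1)) * h3
  have hp1 : ∀ t, 0 < exp (-t) * P t := fun t => mul_pos (exp_pos _) (hPpos t)
  have hp2 : ∀ t, 0 < exp t * Q t := fun t => mul_pos (exp_pos _) (hQpos t)
  refine ⟨fun s => exp (-s) * P s, fun s => log (exp s * Q s) - log (exp (-s) * P s), (w / (M * M)) ^ 2,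
    by positivity, m, hm, M + 2 * (|log m| + |log M|), by positivity, ?_, ?_, ?_⟩
  · intro t
    obtain ⟨h1, h2, h3, h4⟩ := hb t
    have := exp_pos (-t)
    constructor
    · nlinarith
    · have : 0 ≤ 2 * (|log m| + |log M|) := by positivity
      have h5 : P t ≤ M + 2 * (|log m| + |log M|) := by linarith
      calc exp (-t) * P t ≤ exp (-t) * (M + 2 * (|log m| + |log M|)) := by gcongr
        _ = _ := by ring
  · intro t
    obtain ⟨h1, h2, h3, h4⟩ := hb t
    simp only
    rw [log_mul (exp_pos _).ne' (hQpos t).ne', log_mul (exp_pos _).ne' (hPpos t).ne', log_exp, log_exp]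
    have e1 : ∀ x, m ≤ x → x ≤ M → |log x| ≤ |log m| + |log M| := by
      intro x hx hx'
      have a1 := log_le_log hm hx
      have a2 := log_le_log (hm.trans_le hx) hx'
      rw [abs_le]
      constructor <;> linarith [neg_abs_le (log m), le_abs_self (log M), abs_nonneg (log m), abs_nonneg (log M)]
    have a1 := abs_le.1 (e1 _ h1 h2)
    have a2 := abs_le.1 (e1 _ h3 h4)
    rw [abs_le]
    constructor <;> linarith [a1.1, a1.2, a2.1, a2.2]
  · intro g g1 g2 hg hg1 hle
    obtain ⟨h', hh'⟩ := barrier_gen (V := pot c K0 p ξ) hφ1 hφ1' hφ2 hp1 hp2 hWr hg hg1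
    refine ⟨h', _, fun t => ⟨(hh' t).1, (hh' t).2, ?_⟩⟩
    obtain ⟨b1, b2, b3, b4⟩ := hb t
    have hDb : (exp (-t) * P t) * (exp t * Q t) ≤ M * M := by
      have he : exp (-t) * exp t = 1 := by rw [← exp_add]; simp
      calc (exp (-t) * P t) * (exp t * Q t) = (exp (-t) * exp t) * (P t * Q t) := by ring
        _ = P t * Q t := by rw [he, one_mul]
        _ ≤ M * M := by gcongr; exact (hQpos t).le
    have hq : (w / (M * M)) ^ 2 ≤ (w / ((exp (-t) * P t) * (exp t * Q t))) ^ 2 := by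
      have := mul_pos (hp1 t) (hp2 t)
      gcongr
    have h0 : 0 ≤ (exp (-t) * P t) * (g1 (log (exp t * Q t) - log (exp (-t) * P t))
        - g2 (log (exp t * Q t) - log (exp (-t) * P t))) :=
      mul_nonneg (hp1 t).le (sub_nonneg.2 (hle _))
    have := mul_le_mul_of_nonneg_right hq h0
    simp only
    linarith

/-- Barrier: bounded below, with a spectral gap. -/
theorem bar_one (h : FD c K0 p ξ ξ' T) : ∃ κ > 0, ∃ f f' f'' : ℝ → ℝ,
    (∀ t, HasDerivAt f (f' t) t ∧ HasDerivAt f' (f'' t) t) ∧ (∀ t, κ ≤ f t) ∧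
    ∀ t, κ * f t ≤ - f'' t + pot c K0 p ξ t * f t := by
  obtain ⟨φ, ℓ, κ, hκ, m, hm, M, hM, hφ, hℓ, H⟩ := h.bar
  have e1 : ∀ x, HasDerivAt (fun x : ℝ => exp (x / 2)) (exp (x / 2) / 2) x := fun x =>
    (((hasDerivAt_id x).div_const 2).exp).congr_deriv (by simp; ring)
  have e2 : ∀ x, HasDerivAt (fun x : ℝ => exp (x / 2) / 2) (exp (x / 2) / 4) x := fun x =>
    ((e1 x).div_const 2).congr_deriv (by ring)
  obtain ⟨f', f'', hf⟩ := H _ _ _ e1 e2 (fun x => by have := exp_pos (x / 2); linarith)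
  refine ⟨min (κ / 4) (m * exp (-M / 2)), by positivity, _, f', f'', fun t => ⟨(hf t).1, (hf t).2.1⟩,
    fun t => ?_, fun t => ?_⟩
  · refine (min_le_right _ _).trans ?_
    have h1 := (abs_le.1 (hℓ t)).1
    calc m * exp (-M / 2) ≤ m * exp (-t + ℓ t / 2) := by gcongr; linarith
      _ = m * exp (-t) * exp (ℓ t / 2) := by rw [exp_add]; ring
      _ ≤ φ t * exp (ℓ t / 2) := by gcongr; exact (hφ t).1
  · have h1 := (hf t).2.2
    have h2 : 0 < φ t * exp (ℓ t / 2) :=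
      mul_pos (lt_of_lt_of_le (by positivity) (hφ t).1) (exp_pos _)
    have h3 := mul_le_mul_of_nonneg_right (min_le_left (κ / 4) (m * exp (-M / 2))) h2.le
    linarith

/-- Barrier decaying like `e^{-t/2}`. -/
theorem bar_half (h : FD c K0 p ξ ξ' T) : ∃ κ > 0, ∃ C > 0, ∃ f f' f'' : ℝ → ℝ,
    (∀ t, HasDerivAt f (f' t) t ∧ HasDerivAt f' (f'' t) t) ∧
    (∀ t, κ * exp (-t / 2) ≤ f t ∧ f t ≤ C * exp (- t / 2)) ∧
    ∀ t, κ * f t ≤ - f'' t + pot c K0 p ξ t * f t := by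
  obtain ⟨φ, ℓ, κ, hκ, m, hm, M, hM, hφ, hℓ, H⟩ := h.bar
  have e1 : ∀ x, HasDerivAt (fun x : ℝ => exp (x / 4)) (exp (x / 4) / 4) x := fun x =>
    (((hasDerivAt_id x).div_const 4).exp).congr_deriv (by simp; ring)
  have e2 : ∀ x, HasDerivAt (fun x : ℝ => exp (x / 4) / 4) (exp (x / 4) / 16) x := fun x =>
    ((e1 x).div_const 4).congr_deriv (by ring)
  obtain ⟨f', f'', hf⟩ := H _ _ _ e1 e2 (fun x => by have := exp_pos (x / 4); linarith)
  refine ⟨min (κ / 8) (m * exp (-M / 4)), by positivity, M * exp (M / 4), by positivity,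
    _, f', f'', fun t => ⟨(hf t).1, (hf t).2.1⟩,
    fun t => ⟨?_, ?_⟩, fun t => ?_⟩
  · have h1 := (abs_le.1 (hℓ t)).1
    calc min (κ / 8) (m * exp (-M / 4)) * exp (-t / 2) ≤ m * exp (-M / 4) * exp (-t / 2) := by
          gcongr; exact min_le_right _ _
      _ = m * exp (-M / 4 + -t / 2) := by rw [exp_add]; ring
      _ ≤ m * exp (-t + ℓ t / 4) := by
          refine mul_le_mul_of_nonneg_left (exp_le_exp.2 ?_) hm.le; linarith
      _ = m * exp (-t) * exp (ℓ t / 4) := by rw [exp_add]; ring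
      _ ≤ φ t * exp (ℓ t / 4) := by gcongr; exact (hφ t).1
  · have h1 := (abs_le.1 (hℓ t)).2
    calc φ t * exp (ℓ t / 4) ≤ M * exp (-t) * exp (ℓ t / 4) := by gcongr; exact (hφ t).2
      _ = M * exp (-t + ℓ t / 4) := by rw [exp_add]; ring
      _ ≤ M * exp (M / 4 + -t / 2) := by
          refine mul_le_mul_of_nonneg_left (exp_le_exp.2 ?_) hM.le; linarith
      _ = M * exp (M / 4) * exp (-t / 2) := by rw [exp_add]; ring
  · have h1 := (hf t).2.2
    have h2 : 0 < φ t * exp (ℓ t / 4) :=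
      mul_pos (lt_of_lt_of_le (by positivity) (hφ t).1) (exp_pos _)
    have h3 := mul_le_mul_of_nonneg_right (min_le_left (κ / 8) (m * exp (-M / 4))) h2.le
    have h4 := mul_pos hκ h2
    nlinarith

/-- Barrier of size `t e^{-t}`. -/
theorem bar_log (h : FD c K0 p ξ ξ' T) : ∃ κ > 0, ∃ C > 0, ∃ t₁ : ℝ, 1 ≤ t₁ ∧ ∃ f f' f'' : ℝ → ℝ,
    (∀ t, HasDerivAt f (f' t) t ∧ HasDerivAt f' (f'' t) t) ∧
    (∀ t ≥ t₁, 0 < f t ∧ f t ≤ C * (t * exp (- t))) ∧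
    ∀ t, κ * exp (-t) ≤ - f'' t + pot c K0 p ξ t * f t := by
  obtain ⟨φ, ℓ, κ, hκ, m, hm, M, hM, hφ, hℓ, H⟩ := h.bar
  obtain ⟨f', f'', hf⟩ := H (fun x => x) (fun _ => 1) (fun _ => 0) (fun x => hasDerivAt_id x)
    (fun x => hasDerivAt_const x 1) (fun x => by norm_num)
  refine ⟨κ * m, by positivity, M * (2 + M), by positivity, M + 1, by linarith,
    _, f', f'', fun t => ⟨(hf t).1, (hf t).2.1⟩, fun t ht => ⟨?_, ?_⟩, fun t => ?_⟩
  · have h1 := (abs_le.1 (hℓ t)).1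
    refine mul_pos (lt_of_lt_of_le (by positivity) (hφ t).1) (by linarith)
  · have h1 := (abs_le.1 (hℓ t))
    calc φ t * ℓ t ≤ (M * exp (-t)) * ((2 + M) * t) := by
          have : 0 ≤ ℓ t := by linarith
          gcongr
          · exact (hφ t).2
          · nlinarith [h1.2]
      _ = _ := by ring
  · have h1 := (hf t).2.2
    have h2 := (hφ t).1
    simp only [sub_zero, mul_one] at h1
    have := mul_le_mul_of_nonneg_left h2 hκ.le
    linarith

end FD

/-- The rate function `t e^{-γ t}`. -/
def mf (γ t : ℝ) : ℝ := t * exp (-γ * t)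

theorem mf_deriv (γ t : ℝ) : HasDerivAt (mf γ) ((1 - γ * t) * exp (-γ * t)) t := by
  unfold mf
  have h1 : HasDerivAt (fun s : ℝ => exp (-γ * s)) (exp (-γ * t) * (-γ)) t := by
    simpa using ((hasDerivAt_id t).const_mul (-γ)).exp
  exact ((hasDerivAt_id t).mul h1).congr_deriv (by simp; ring)

theorem mf_nonneg {γ t : ℝ} (ht : 0 ≤ t) : 0 ≤ mf γ t := mul_nonneg ht (exp_pos _).le

theorem mf_deriv_le {γ t : ℝ} (hγ : 0 < γ) (ht : 2 / γ ≤ t) :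
    (1 - γ * t) * exp (-γ * t) ≤ - (γ / 2) * mf γ t := by
  unfold mf
  rw [div_le_iff₀ hγ] at ht
  have := exp_pos (-γ * t)
  nlinarith

theorem mf_le_mf {γ s t : ℝ} (hs : 0 ≤ s) (hst : s ≤ t) : mf γ s ≤ exp (γ * (t - s)) * mf γ t := by
  unfold mf
  have h1 : exp (-γ * s) = exp (γ * (t - s)) * exp (-γ * t) := by rw [← exp_add]; ring_nf
  rw [h1]
  have : 0 ≤ exp (γ * (t - s)) * exp (-γ * t) := by positivity
  nlinarith

theorem mf_anti {γ : ℝ} (hγ : 0 < γ) : AntitoneOn (mf γ) (Ici (2 / γ)) := by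
  apply antitoneOn_of_deriv_nonpos (convex_Ici _)
  · exact fun t _ => (mf_deriv γ t).continuousAt.continuousWithinAt
  · exact fun t _ => (mf_deriv γ t).differentiableAt.differentiableWithinAt
  · intro t ht
    rw [interior_Ici] at ht
    rw [(mf_deriv γ t).deriv]
    have h2 : 0 < 2 / γ := by positivity
    have := mf_deriv_le hγ (le_of_lt ht)
    have := mf_nonneg (γ := γ) (t := t) (by linarith [mem_Ioi.1 ht])
    nlinarith

theorem mf_close {γ s t r : ℝ} (hγ : 0 < γ) (hs : 2 / γ ≤ s) (ht : 2 / γ ≤ t) (h : |s - t| ≤ r) :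
    mf γ s ≤ exp (γ * r) * mf γ t := by
  have h0 : 0 < 2 / γ := by positivity
  have hr : 0 ≤ r := (abs_nonneg _).trans h
  have hm := mf_nonneg (γ := γ) (t := t) (by linarith)
  rcases le_total s t with h1 | h1
  · refine (mf_le_mf (by linarith) h1).trans ?_
    gcongr
    linarith [(abs_le.1 h).1]
  · refine (mf_anti hγ ht hs h1).trans ?_
    have : 1 ≤ exp (γ * r) := one_le_exp (by positivity)
    nlinarith

theorem mf_tendsto {γ : ℝ} (hγ : 0 < γ) : Tendsto (mf γ) atTop (nhds 0) := by
  have := tendsto_rpow_mul_exp_neg_mul_atTop_nhds_zero 1 γ hγ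
  refine this.congr fun t => ?_
  simp [mf]

theorem tail_one {γ A L t₁ : ℝ} (hA : 0 ≤ A) {f f' : ℝ → ℝ} (hγ : 0 < γ) (ht₁ : 2 / γ ≤ t₁)
    (hf : ∀ t ≥ t₁, HasDerivAt f (f' t) t) (hb : ∀ t ≥ t₁, f' t ≤ A * mf γ t)
    (hL : Tendsto f atTop (nhds L)) : ∀ t ≥ t₁, L - 2 * A / γ * mf γ t ≤ f t := by
  have hanti : AntitoneOn (fun t => f t + 2 * A / γ * mf γ t) (Ici t₁) := by
    have hd : ∀ t ≥ t₁, HasDerivAt (fun t => f t + 2 * A / γ * mf γ t)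
      (f' t + 2 * A / γ * ((1 - γ * t) * exp (-γ * t))) t := fun t ht =>
      (hf t ht).add ((mf_deriv γ t).const_mul _)
    apply antitoneOn_of_deriv_nonpos (convex_Ici _)
    · exact fun t ht => (hd t ht).continuousAt.continuousWithinAt
    · intro t ht
      rw [interior_Ici] at ht
      exact (hd t (le_of_lt ht)).differentiableAt.differentiableWithinAt
    · intro t ht
      rw [interior_Ici] at ht
      rw [(hd t (le_of_lt ht)).deriv]
      have h1 := hb t (le_of_lt ht)
      have h2 := mf_deriv_le hγ (ht₁.trans (le_of_lt ht))
      have h3 := mul_le_mul_of_nonneg_left h2 (show 0 ≤ 2 * A / γ by positivity)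
      have h4 : 2 * A / γ * (-(γ / 2) * mf γ t) = - (A * mf γ t) := by field_simp
      linarith
  intro t ht
  have hlim : Tendsto (fun t => f t + 2 * A / γ * mf γ t) atTop (nhds L) := by
    simpa using hL.add ((mf_tendsto hγ).const_mul (2 * A / γ))
  have : L ≤ f t + 2 * A / γ * mf γ t := by
    refine le_of_tendsto hlim ?_
    filter_upwards [eventually_ge_atTop t] with s hs
    exact hanti ht (ht.trans hs) hs
  linarith

theorem tail_abs {γ A L t₁ : ℝ} (hA : 0 ≤ A) {f f' : ℝ → ℝ} (hγ : 0 < γ) (ht₁ : 2 / γ ≤ t₁)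
    (hf : ∀ t ≥ t₁, HasDerivAt f (f' t) t) (hb : ∀ t ≥ t₁, |f' t| ≤ A * mf γ t)
    (hL : Tendsto f atTop (nhds L)) : ∀ t ≥ t₁, |f t - L| ≤ 2 * A / γ * mf γ t := by
  intro t ht
  have h1 := tail_one hA hγ ht₁ hf (fun t ht => (le_abs_self _).trans (hb t ht)) hL t ht
  have h2 := tail_one hA hγ ht₁ (fun t ht => (hf t ht).neg)
    (fun t ht => (neg_le_abs _).trans (hb t ht)) hL.neg t ht
  simp only [Pi.neg_apply] at h2
  rw [abs_le]; constructor <;> linarith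

theorem rpow_lip (q : ℝ) {a b : ℝ} (ha : 0 < a) : ∃ L > 0, ∀ x ∈ Icc a b, ∀ y ∈ Icc a b,
    |x ^ q - y ^ q| ≤ L * |x - y| := by
  have hc : ContinuousOn (fun x : ℝ => q * x ^ (q - 1)) (Icc a b) := by
    refine continuousOn_const.mul (ContinuousOn.rpow_const continuousOn_id ?_)
    intro x hx; left; exact (ha.trans_le hx.1).ne'
  obtain ⟨C, hC⟩ := isCompact_Icc.exists_bound_of_continuousOn hc
  refine ⟨max C 1, by positivity, fun x hx y hy => ?_⟩
  have := Convex.norm_image_sub_le_of_norm_hasDerivWithin_le (f := fun x : ℝ => x ^ q)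
    (f' := fun x => q * x ^ (q - 1)) (s := Icc a b) (C := max C 1) (x := y) (y := x)
    (fun z hz => (Real.hasDerivAt_rpow_const (Or.inl (ha.trans_le hz.1).ne')).hasDerivWithinAt)
    (fun z hz => (hC z hz).trans (le_max_left _ _)) (convex_Icc a b) hy hx
  simpa using this

/-- Landau-type: if `w → 0` and `w'' → 0` then `w' → 0`. -/
theorem landau {w w' w'' : ℝ → ℝ} {t₀ : ℝ} (h1 : ∀ t > t₀, HasDerivAt w (w' t) t)
    (h2 : ∀ t > t₀, HasDerivAt w' (w'' t) t) (hw : Tendsto w atTop (nhds 0))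
    (hw2 : Tendsto w'' atTop (nhds 0)) : Tendsto w' atTop (nhds 0) := by
  rw [Metric.tendsto_atTop] at *
  intro ε hε
  obtain ⟨N1, hN1⟩ := hw (ε / 4) (by positivity)
  obtain ⟨N2, hN2⟩ := hw2 (ε / 4) (by positivity)
  refine ⟨max (max N1 N2) (t₀ + 1), fun t ht => ?_⟩
  have ha : N1 ≤ t := (le_max_left _ _).trans ((le_max_left _ _).trans ht)
  have hb : N2 ≤ t := (le_max_right _ _).trans ((le_max_left _ _).trans ht)
  have hc : t₀ + 1 ≤ t := (le_max_right _ _).trans ht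
  obtain ⟨s, hs, hs'⟩ := exists_hasDerivAt_eq_slope w w' (show t < t + 1 by linarith)
    (fun x hx => (h1 x (by linarith [hx.1])).continuousAt.continuousWithinAt)
    (fun x hx => h1 x (by linarith [hx.1]))
  obtain ⟨r, hr, hr'⟩ := exists_hasDerivAt_eq_slope w' w'' hs.1
    (fun x hx => (h2 x (by linarith [hx.1])).continuousAt.continuousWithinAt)
    (fun x hx => h2 x (by linarith [hx.1]))
  have e1 := hN1 t ha
  have e2 := hN1 (t + 1) (by linarith)
  have e3 := hN2 r (by linarith [hr.1])
  simp only [dist_zero_right, norm_eq_abs] at *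
  have e4 : w' s = w (t + 1) - w t := by rw [hs']; simp
  have hst : 0 < s - t := by linarith [hs.1]
  have e5 : w' s - w' t = w'' r * (s - t) := by rw [hr']; field_simp
  have e6 : |w'' r * (s - t)| ≤ ε / 4 := by
    rw [abs_mul, abs_of_pos hst]
    have : s - t ≤ 1 := by linarith [hs.2]
    nlinarith [abs_nonneg (w'' r)]
  rw [← e5] at e6
  rw [abs_lt] at *
  rw [abs_le] at e6
  constructor <;> linarith [e6.1, e6.2, e1.1, e1.2, e2.1, e2.2]

theorem g_lip (c K0 p : ℝ) {a b : ℝ} (ha : 0 < a) : ∃ L > 0, ∀ x ∈ Icc a b, ∀ y ∈ Icc a b,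
    |(c ^ 2 * x - K0 * x ^ p) - (c ^ 2 * y - K0 * y ^ p)| ≤ L * |x - y| := by
  obtain ⟨L, hL, H⟩ := rpow_lip p (b := b) ha
  refine ⟨c ^ 2 + |K0| * L + 1, by positivity, fun x hx y hy => ?_⟩
  have h1 := H x hx y hy
  have h2 : (c ^ 2 * x - K0 * x ^ p) - (c ^ 2 * y - K0 * y ^ p)
    = c ^ 2 * (x - y) - K0 * (x ^ p - y ^ p) := by ring
  rw [h2]
  calc |c ^ 2 * (x - y) - K0 * (x ^ p - y ^ p)|
      ≤ |c ^ 2 * (x - y)| + |K0 * (x ^ p - y ^ p)| := abs_sub _ _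
    _ = c ^ 2 * |x - y| + |K0| * |x ^ p - y ^ p| := by
        rw [abs_mul, abs_mul, abs_of_nonneg (sq_nonneg c)]
    _ ≤ c ^ 2 * |x - y| + |K0| * (L * |x - y|) := by gcongr
    _ ≤ _ := by nlinarith [abs_nonneg (x - y)]

namespace FD
variable {c K0 p : ℝ} {ξ ξ' : ℝ → ℝ} {T : ℝ}

theorem range (h : FD c K0 p ξ ξ' T) : ∃ a > 0, ∃ b > a, ∀ t, 2 * a ≤ ξ t ∧ ξ t ≤ b - a := by
  obtain ⟨⟨x, hx⟩, ⟨z, hz⟩⟩ := h.exists_max_min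
  have := h.pos x
  have := h.pos z
  refine ⟨ξ z / 2, by linarith, ξ x + ξ z, by linarith, fun t => ⟨by linarith [hz t], by linarith [hx t]⟩⟩

theorem range' (h : FD c K0 p ξ ξ' T) : ∃ a > 0, ∃ b > a, (∀ t, ξ t ∈ Icc a b) ∧
    ∀ t x, |x - ξ t| ≤ a → x ∈ Icc a b := by
  obtain ⟨a, ha, b, hb, hr⟩ := h.range
  refine ⟨a, ha, b, hb, fun t => ⟨by linarith [(hr t).1], by linarith [(hr t).2]⟩, fun t x hx => ?_⟩
  have := abs_le.1 hx
  exact ⟨by linarith [(hr t).1, this.1], by linarith [(hr t).2, this.2]⟩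

end FD

/-- approximate solution of the Fowler ODE converging to `ξ`. -/
structure AS (c K0 p : ℝ) (ξ : ℝ → ℝ) (γ C t₀ : ℝ) (y y' y'' : ℝ → ℝ) : Prop where
  hγ : 0 < γ
  hC : 0 ≤ C
  d1 : ∀ t > t₀, HasDerivAt y (y' t) t
  d2 : ∀ t > t₀, HasDerivAt y' (y'' t) t
  pos : ∀ t > t₀, 0 < y t
  err : ∀ t > t₀, |y'' t - (c ^ 2 * y t - K0 * y t ^ p)| ≤ C * mf γ t
  conv : Tendsto (fun t => y t - ξ t) atTop (nhds 0)

namespace AS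
variable {c K0 p : ℝ} {ξ ξ' : ℝ → ℝ} {T : ℝ} {γ C t₀ : ℝ} {y y' y'' : ℝ → ℝ}

theorem conv' (h : FD c K0 p ξ ξ' T) (H : AS c K0 p ξ γ C t₀ y y' y'') :
    Tendsto (fun t => y' t - ξ' t) atTop (nhds 0) := by
  obtain ⟨a, ha, b, hb, hr, hr'⟩ := h.range'
  obtain ⟨L, hL, hLip⟩ := g_lip c K0 p (b := b) ha
  refine landau (w := fun t => y t - ξ t)
    (w'' := fun t => y'' t - (c ^ 2 * ξ t - K0 * ξ t ^ p)) (t₀ := t₀)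
    (fun t ht => (H.d1 t ht).sub (h.d1 t)) (fun t ht => (H.d2 t ht).sub (h.d2 t)) H.conv ?_
  have hlim : Tendsto (fun t => C * mf γ t + L * |y t - ξ t|) atTop (nhds 0) := by
    simpa using ((mf_tendsto H.hγ).const_mul C).add (H.conv.abs.const_mul L)
  refine squeeze_zero_norm' ?_ hlim
  have hev : ∀ᶠ t in atTop, |y t - ξ t| < a := by
    have := H.conv.abs
    rw [abs_zero] at this
    exact this.eventually_lt_const ha
  filter_upwards [eventually_gt_atTop t₀, hev] with t ht hta
  have e1 := H.err t ht
  have e2 := hLip _ (hr' t _ hta.le) _ (hr t)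
  rw [norm_eq_abs]
  calc |y'' t - (c ^ 2 * ξ t - K0 * ξ t ^ p)| = |(y'' t - (c ^ 2 * y t - K0 * y t ^ p)) +
        ((c ^ 2 * y t - K0 * y t ^ p) - (c ^ 2 * ξ t - K0 * ξ t ^ p))| := by ring_nf
    _ ≤ _ := (abs_add_le _ _).trans (add_le_add e1 e2)

theorem ham_lim (h : FD c K0 p ξ ξ' T) (H : AS c K0 p ξ γ C t₀ y y' y'') :
    Tendsto (fun t => FD.ham c K0 p (y t) (y' t)) atTop (nhds (FD.ham c K0 p (ξ 0) (ξ' 0))) := by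
  obtain ⟨a, ha, b, hb, hr, hr'⟩ := h.range'
  obtain ⟨M, hM, hM'⟩ := h.bdd'
  obtain ⟨L, hL, hLip⟩ := rpow_lip (p + 1) (b := b) ha
  have hc' := H.conv' h
  rw [tendsto_iff_norm_sub_tendsto_zero]
  have hlim : Tendsto (fun t => |y' t - ξ' t| * (|y' t - ξ' t| + 2 * M)
      + c ^ 2 * (|y t - ξ t| * (|y t - ξ t| + 2 * b)) + |2 / (p + 1) * K0| * (L * |y t - ξ t|))
      atTop (nhds 0) := by
    have h1 := hc'.abs
    have h2 := H.conv.abs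
    rw [abs_zero] at h1 h2
    have := ((h1.mul (h1.add_const (2 * M))).add ((h2.mul (h2.add_const (2 * b))).const_mul (c ^ 2))).add
      ((h2.const_mul L).const_mul |2 / (p + 1) * K0|)
    simpa using this
  refine squeeze_zero' (Eventually.of_forall fun t => norm_nonneg _) ?_ hlim
  have hev : ∀ᶠ t in atTop, |y t - ξ t| < a := by
    have := H.conv.abs
    rw [abs_zero] at this
    exact this.eventually_lt_const ha
  filter_upwards [hev] with t hta
  rw [h.ham_const 0 t, norm_eq_abs]
  have e2 := hLip _ (hr' t _ hta.le) _ (hr t)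
  unfold FD.ham
  have e0 : y' t ^ 2 - c ^ 2 * y t ^ 2 + 2 / (p + 1) * K0 * y t ^ (p + 1) -
      (ξ' t ^ 2 - c ^ 2 * ξ t ^ 2 + 2 / (p + 1) * K0 * ξ t ^ (p + 1))
      = (y' t - ξ' t) * ((y' t - ξ' t) + 2 * ξ' t) - c ^ 2 * ((y t - ξ t) * ((y t - ξ t) + 2 * ξ t))
        + 2 / (p + 1) * K0 * (y t ^ (p + 1) - ξ t ^ (p + 1)) := by ring
  rw [e0]
  refine (abs_add_le _ _).trans (add_le_add ((abs_sub _ _).trans (add_le_add ?_ ?_)) ?_)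
  · rw [abs_mul]
    gcongr
    refine (abs_add_le _ _).trans ?_
    rw [abs_mul, abs_two]
    linarith [hM' t]
  · rw [abs_mul, abs_of_nonneg (sq_nonneg c), abs_mul]
    gcongr
    refine (abs_add_le _ _).trans ?_
    rw [abs_mul, abs_two, abs_of_pos (h.pos t)]
    linarith [(hr t).2]
  · rw [abs_mul]
    gcongr

theorem ham_rate (h : FD c K0 p ξ ξ' T) (H : AS c K0 p ξ γ C t₀ y y' y'') :
    ∃ C₁ ≥ 0, ∃ t₁, ∀ t ≥ t₁,
      |FD.ham c K0 p (y t) (y' t) - FD.ham c K0 p (ξ 0) (ξ' 0)| ≤ C₁ * mf γ t := by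
  obtain ⟨M, hM, hM'⟩ := h.bdd'
  have hC := H.hC
  have hγ := H.hγ
  have hev : ∀ᶠ t in atTop, |y' t - ξ' t| < 1 := by
    have := (H.conv' h).abs
    rw [abs_zero] at this
    exact this.eventually_lt_const one_pos
  obtain ⟨N, hN⟩ := eventually_atTop.1 hev
  refine ⟨2 * (2 * (M + 1) * C) / γ, by positivity, max (max N (2 / γ)) (t₀ + 1), ?_⟩
  refine tail_abs (by positivity) hγ ((le_max_right _ _).trans (le_max_left _ _))
    (fun t ht => FD.ham_deriv h.p_gt (H.pos t ?_) (H.d1 t ?_) (H.d2 t ?_)) ?_ (H.ham_lim h)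
  · linarith [(le_max_right _ _).trans ht]
  · linarith [(le_max_right _ _).trans ht]
  · linarith [(le_max_right _ _).trans ht]
  · intro t ht
    have h1 := hN t ((le_max_left _ _).trans ((le_max_left _ _).trans ht))
    have h2 := H.err t (by linarith [(le_max_right _ _).trans ht])
    have h3 : |y' t| ≤ M + 1 := by
      have := abs_sub_abs_le_abs_sub (y' t) (ξ' t)
      linarith [hM' t]
    rw [abs_mul, abs_mul, abs_two]
    calc 2 * |y' t| * |y'' t - (c ^ 2 * y t - K0 * y t ^ p)| ≤ 2 * (M + 1) * (C * mf γ t) := by gcongr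
      _ = _ := by ring

end AS

/-- potential well at a non-degenerate equilibrium -/
theorem well {c K0 p x₀ : ℝ} (hc : 0 < c) (hp : 1 < p) (hx₀ : 0 < x₀)
    (h0 : c ^ 2 * x₀ - K0 * x₀ ^ p = 0) :
    ∃ κ > 0, ∀ᶠ x in nhds x₀, κ * (x - x₀) ^ 2 ≤ FD.ham c K0 p x 0 - FD.ham c K0 p x₀ 0 := by
  refine ⟨(p - 1) * c ^ 2 / 2, by have : 0 < p - 1 := by linarith
                                  positivity, ?_⟩
  set κ := (p - 1) * c ^ 2 / 2 with hκ
  have d1 : ∀ x > 0, HasDerivAt (fun x => FD.ham c K0 p x 0 - κ * (x - x₀) ^ 2)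
      (-2 * (c ^ 2 * x - K0 * x ^ p) - 2 * κ * (x - x₀)) x := by
    intro x hx
    unfold FD.ham
    have h3 := (hasDerivAt_id x).rpow_const (p := p + 1) (Or.inl hx.ne')
    have := ((((hasDerivAt_id x).pow 2).const_mul (c ^ 2)).const_sub ((0:ℝ) ^ 2)).add
      (h3.const_mul (2 / (p + 1) * K0))
    have := this.sub ((((hasDerivAt_id x).sub_const x₀).pow 2).const_mul κ)
    refine this.congr_deriv ?_
    have : p + 1 ≠ 0 := by linarith
    simp only [add_sub_cancel_right, id]
    field_simp
    push_cast
    ring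
  have d2 : HasDerivAt (fun x => -2 * (c ^ 2 * x - K0 * x ^ p) - 2 * κ * (x - x₀))
      (-2 * (c ^ 2 - K0 * (p * x₀ ^ (p - 1))) - 2 * κ) x₀ := by
    have h3 := (hasDerivAt_id x₀).rpow_const (p := p) (Or.inl hx₀.ne')
    have := ((((hasDerivAt_id x₀).const_mul (c ^ 2)).sub (h3.const_mul K0)).const_mul (-2)).sub
      (((hasDerivAt_id x₀).sub_const x₀).const_mul (2 * κ))
    refine this.congr_deriv ?_
    simp
  have he : deriv (fun x => FD.ham c K0 p x 0 - κ * (x - x₀) ^ 2) =ᶠ[nhds x₀]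
      (fun x => -2 * (c ^ 2 * x - K0 * x ^ p) - 2 * κ * (x - x₀)) := by
    filter_upwards [lt_mem_nhds hx₀] with x hx using (d1 x hx).deriv
  have hv : K0 * x₀ ^ (p - 1) = c ^ 2 := by
    have : x₀ ^ p = x₀ ^ (p - 1) * x₀ := by rw [← rpow_add_one hx₀.ne']; ring_nf
    rw [this] at h0
    have : x₀ * (c ^ 2 - K0 * x₀ ^ (p - 1)) = 0 := by linarith
    rcases mul_eq_zero.1 this with h | h
    · exact absurd h hx₀.ne'
    · linarith
  have hmin : IsLocalMin (fun x => FD.ham c K0 p x 0 - κ * (x - x₀) ^ 2) x₀ := by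
    refine isLocalMin_of_deriv_deriv_pos ?_ ?_ (d1 x₀ hx₀).continuousAt
    · rw [he.deriv_eq, d2.deriv]
      have : -2 * (c ^ 2 - K0 * (p * x₀ ^ (p - 1))) - 2 * κ = (p - 1) * c ^ 2 := by
        rw [hκ]; linear_combination (2 * p) * hv
      rw [this]
      have : 0 < p - 1 := by linarith
      positivity
    · rw [(d1 x₀ hx₀).deriv, h0]; ring
  filter_upwards [hmin] with x hx
  simp only [sub_self] at hx
  linarith

theorem well_strict {c K0 p x₀ x : ℝ} (hc : 0 < c) (hp : 1 < p) (hx₀ : 0 < x₀)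
    (h0 : c ^ 2 * x₀ - K0 * x₀ ^ p = 0) (hx : 0 < x) (hne : x ≠ x₀) :
    FD.ham c K0 p x₀ 0 < FD.ham c K0 p x 0 := by
  obtain ⟨z, hz⟩ : ∃ z, z = x / x₀ := ⟨_, rfl⟩
  have hzp : 0 < z := by rw [hz]; positivity
  have hxz : x = x₀ * z := by rw [hz]; field_simp
  have hz1 : z ≠ 1 := by
    intro h; rw [h, mul_one] at hxz; exact hne hxz
  have hb := one_add_mul_self_lt_rpow_one_add (s := z ^ 2 - 1) (p := (p + 1) / 2)
    (by nlinarith [sq_nonneg z]) (by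
      intro h
      have : (z - 1) * (z + 1) = 0 := by linarith
      rcases mul_eq_zero.1 this with h | h
      · exact hz1 (by linarith)
      · linarith) (by linarith)
  have h1 : (1 + (z ^ 2 - 1)) ^ ((p + 1) / 2) = z ^ (p + 1) := by
    rw [show 1 + (z ^ 2 - 1) = z ^ (2 : ℝ) by norm_num, ← rpow_mul hzp.le]
    congr 1; ring
  rw [h1] at hb
  unfold FD.ham
  have hv : K0 * x₀ ^ p = c ^ 2 * x₀ := by linarith
  rw [hxz, mul_rpow hx₀.le hzp.le, rpow_add_one hx₀.ne']
  have e1 : 2 / (p + 1) * K0 * (x₀ ^ p * x₀) = 2 / (p + 1) * (c ^ 2 * x₀ ^ 2) := by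
    linear_combination (2 / (p + 1) * x₀) * hv
  have e2 : 2 / (p + 1) * K0 * (x₀ ^ p * x₀ * z ^ (p + 1))
      = 2 / (p + 1) * (c ^ 2 * x₀ ^ 2) * z ^ (p + 1) := by
    linear_combination (2 / (p + 1) * x₀ * z ^ (p + 1)) * hv
  rw [e1, e2]
  have hpp : 0 < p + 1 := by linarith
  have hk : 0 < 2 / (p + 1) * (c ^ 2 * x₀ ^ 2) := by positivity
  have := mul_lt_mul_of_pos_left hb hk
  have e3 : 2 / (p + 1) * (c ^ 2 * x₀ ^ 2) * (1 + (p + 1) / 2 * (z ^ 2 - 1))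
    = 2 / (p + 1) * (c ^ 2 * x₀ ^ 2) + c ^ 2 * x₀ ^ 2 * (z ^ 2 - 1) := by field_simp
  rw [e3] at this
  nlinarith

namespace AS
variable {c K0 p : ℝ} {ξ ξ' : ℝ → ℝ} {T : ℝ} {γ C t₀ : ℝ} {y y' y'' : ℝ → ℝ}

theorem gron (h : FD c K0 p ξ ξ' T) (H : AS c K0 p ξ γ C t₀ y y' y'') :
    ∃ t₁, ∀ R ≥ 0, ∃ C₂ ≥ 0, ∀ s ≥ t₁, ∀ r δ, |y s - ξ r| ≤ δ → |y' s - ξ' r| ≤ δ →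
      ∀ τ ∈ Icc 0 R, |y (s + τ) - ξ (r + τ)| ≤ C₂ * (δ + mf γ s) ∧
        |y' (s + τ) - ξ' (r + τ)| ≤ C₂ * (δ + mf γ s) := by
  obtain ⟨a, ha, b, hb, hr, hr'⟩ := h.range'
  obtain ⟨L, hL, hLip⟩ := g_lip c K0 p (b := b) ha
  have hC := H.hC
  have hγ := H.hγ
  have hev : ∀ᶠ t in atTop, |y t - ξ t| < a := by
    have := H.conv.abs
    rw [abs_zero] at this
    exact this.eventually_lt_const ha
  obtain ⟨N, hN⟩ := eventually_atTop.1 hev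
  refine ⟨max (max N (2 / γ)) (t₀ + 1), fun R hR => ⟨exp ((L + 1) * R) * (1 + C), by positivity, ?_⟩⟩
  intro s hs r δ h1 h2 τ hτ
  have hsN : N ≤ s := (le_max_left _ _).trans ((le_max_left _ _).trans hs)
  have hsg : 2 / γ ≤ s := (le_max_right _ _).trans ((le_max_left _ _).trans hs)
  have hst : t₀ + 1 ≤ s := (le_max_right _ _).trans hs
  have hs0 : 0 < 2 / γ := by positivity
  have hm := mf_nonneg (γ := γ) (t := s) (by linarith)
  have hδ : 0 ≤ δ := (abs_nonneg _).trans h1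
  have hd : ∀ x ≥ 0, HasDerivAt (fun x => (y (s + x) - ξ (r + x), y' (s + x) - ξ' (r + x)))
      (y' (s + x) - ξ' (r + x), y'' (s + x) - (c ^ 2 * ξ (r + x) - K0 * ξ (r + x) ^ p)) x := by
    intro x hx
    have e1 := (H.d1 (s + x) (by linarith)).comp_const_add s x
    have e2 := (H.d2 (s + x) (by linarith)).comp_const_add s x
    have e3 := (h.d1 (r + x)).comp_const_add r x
    have e4 := (h.d2 (r + x)).comp_const_add r x
    exact (e1.sub e3).prodMk (e2.sub e4)
  have key := norm_le_gronwallBound_of_norm_deriv_right_le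
    (f := fun x => (y (s + x) - ξ (r + x), y' (s + x) - ξ' (r + x)))
    (f' := fun x => (y' (s + x) - ξ' (r + x), y'' (s + x) - (c ^ 2 * ξ (r + x) - K0 * ξ (r + x) ^ p)))
    (δ := δ) (K := L + 1) (ε := C * mf γ s) (a := 0) (b := R)
    (fun x hx => (hd x hx.1).continuousAt.continuousWithinAt)
    (fun x hx => (hd x hx.1).hasDerivWithinAt) (by
      simp only [add_zero, Prod.norm_def, norm_eq_abs]
      exact max_le h1 h2) (by
      intro x hx
      simp only [Prod.norm_def, norm_eq_abs]
      set W := max |y (s + x) - ξ (r + x)| |y' (s + x) - ξ' (r + x)| with hW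
      have w1 : |y (s + x) - ξ (r + x)| ≤ W := le_max_left _ _
      have w2 : |y' (s + x) - ξ' (r + x)| ≤ W := le_max_right _ _
      have w0 : 0 ≤ W := (abs_nonneg _).trans w1
      have hCm : 0 ≤ C * mf γ s := by positivity
      refine max_le (by nlinarith) ?_
      have e1 := H.err (s + x) (by linarith [hx.1])
      have e2 := hLip _ (hr' (s + x) _ (hN (s + x) (by linarith [hx.1])).le) _ (hr (r + x))
      have e3 : mf γ (s + x) ≤ mf γ s := mf_anti hγ hsg (hsg.trans (by linarith [hx.1])) (by linarith [hx.1])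
      have e4 : C * mf γ (s + x) ≤ C * mf γ s := by gcongr
      have e5 : L * |y (s + x) - ξ (r + x)| ≤ L * W := by gcongr
      have := abs_add_le (y'' (s + x) - (c ^ 2 * y (s + x) - K0 * y (s + x) ^ p))
        ((c ^ 2 * y (s + x) - K0 * y (s + x) ^ p) - (c ^ 2 * ξ (r + x) - K0 * ξ (r + x) ^ p))
      rw [sub_add_sub_cancel] at this
      linarith) τ hτ
  rw [gronwallBound_of_K_ne_0 (by linarith), sub_zero] at key
  have hE : exp ((L + 1) * τ) ≤ exp ((L + 1) * R) := exp_le_exp.2 (by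
    have := hτ.2
    gcongr)
  have hE1 : 1 ≤ exp ((L + 1) * R) := one_le_exp (by positivity)
  have hfin : δ * exp ((L + 1) * τ) + C * mf γ s / (L + 1) * (exp ((L + 1) * τ) - 1)
      ≤ exp ((L + 1) * R) * (1 + C) * (δ + mf γ s) := by
    have e1 : δ * exp ((L + 1) * τ) ≤ δ * exp ((L + 1) * R) := by gcongr
    have e2 : C * mf γ s / (L + 1) ≤ C * mf γ s := div_le_self (by positivity) (by linarith)
    have e3 : C * mf γ s / (L + 1) * (exp ((L + 1) * τ) - 1) ≤ C * mf γ s * exp ((L + 1) * R) := by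
      have : 0 ≤ C * mf γ s / (L + 1) := by positivity
      have h0 : 0 ≤ C * mf γ s := by positivity
      have h3 : exp ((L + 1) * τ) - 1 ≤ exp ((L + 1) * R) := by linarith
      calc _ ≤ C * mf γ s / (L + 1) * exp ((L + 1) * R) := by gcongr
        _ ≤ _ := by gcongr
    have e4 : 0 ≤ exp ((L + 1) * R) * (mf γ s) := by positivity
    have e5 : 0 ≤ exp ((L + 1) * R) * C * δ := by positivity
    linarith
  simp only [Prod.norm_def, norm_eq_abs] at key
  exact ⟨(le_max_left _ _).trans (key.trans hfin), (le_max_right _ _).trans (key.trans hfin)⟩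

end AS

theorem mf_shift {γ t T : ℝ} (hγ : 0 < γ) (hT : 0 ≤ T) (ht : 4 / γ ≤ t) :
    mf γ (t + T) ≤ exp (-(γ * T / 2)) * mf γ t := by
  have h1 : ∀ s, mf γ s = exp (-(γ / 2) * s) * mf (γ / 2) s := by
    intro s; unfold mf
    rw [mul_left_comm, ← exp_add]; ring_nf
  have h2 : 2 / (γ / 2) = 4 / γ := by field_simp; norm_num
  have h3 := mf_anti (γ := γ / 2) (by positivity) (a := t) (b := t + T) (by simpa [h2] using ht)
    (by simp only [mem_Ici, h2]; linarith) (by linarith)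
  rw [h1 (t + T), h1 t, ← mul_assoc, ← exp_add]
  rw [show -(γ * T / 2) + -(γ / 2) * t = -(γ / 2) * (t + T) by ring]
  gcongr

theorem seq_tail {γ T T0 C : ℝ} (hγ : 0 < γ) (hT : 0 < T) (hC : 0 ≤ C) {σ : ℕ → ℝ} {k0 : ℕ}
    (hσ : Tendsto σ atTop (nhds 0))
    (hk : ∀ k ≥ k0, 4 / γ ≤ T0 + k * T)
    (hd : ∀ k ≥ k0, |σ (k + 1) - σ k| ≤ C * mf γ (T0 + k * T)) :
    ∃ C' ≥ 0, ∀ k ≥ k0, |σ k| ≤ C' * mf γ (T0 + k * T) := by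
  set q := 1 - exp (-(γ * T / 2)) with hq
  have hq0 : 0 < q := by
    have : exp (-(γ * T / 2)) < 1 := by
      rw [exp_lt_one_iff]; have : 0 < γ * T := by positivity
      linarith
    linarith
  have hdec : ∀ k ≥ k0, mf γ (T0 + (k + 1 : ℕ) * T) ≤ (1 - q) * mf γ (T0 + k * T) := by
    intro k hk'
    have := mf_shift hγ hT.le (hk k hk')
    rw [hq]; push_cast
    rw [show T0 + (k + 1 : ℝ) * T = T0 + k * T + T by ring]
    linarith
  have hlimT : Tendsto (fun k : ℕ => T0 + k * T) atTop atTop :=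
    tendsto_atTop_add_const_left _ _ (tendsto_natCast_atTop_atTop.atTop_mul_const hT)
  have hlim := (mf_tendsto hγ).comp hlimT
  have one : ∀ σ : ℕ → ℝ, Tendsto σ atTop (nhds 0) →
      (∀ k ≥ k0, |σ (k + 1) - σ k| ≤ C * mf γ (T0 + k * T)) →
      ∀ k ≥ k0, σ k ≤ C / q * mf γ (T0 + k * T) := by
    intro σ hσ hd k hk'
    have hmono : ∀ j, k ≤ j → σ k - C / q * mf γ (T0 + k * T) ≤ σ j - C / q * mf γ (T0 + j * T) := by
      intro j hj
      induction j, hj using Nat.le_induction with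
      | base => exact le_rfl
      | succ j hj ih =>
        refine ih.trans ?_
        have h1 := abs_le.1 (hd j (hk'.trans hj))
        have h2 := hdec j (hk'.trans hj)
        have h3 : C / q * mf γ (T0 + (j + 1 : ℕ) * T) ≤ C / q * ((1 - q) * mf γ (T0 + j * T)) := by
          gcongr
        have h4 : C / q * ((1 - q) * mf γ (T0 + j * T)) =
          C / q * mf γ (T0 + j * T) - C * mf γ (T0 + j * T) := by field_simp
        linarith [h1.1]
    have hl : Tendsto (fun j : ℕ => σ j - C / q * mf γ (T0 + j * T)) atTop (nhds 0) := by
      simpa using hσ.sub (hlim.const_mul (C / q))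
    have := ge_of_tendsto hl (eventually_atTop.2 ⟨k, hmono⟩)
    linarith
  refine ⟨C / q, by positivity, fun k hk' => abs_le.2 ⟨?_, one σ hσ hd k hk'⟩⟩
  have := one (fun k => - σ k) (by simpa using hσ.neg) (fun k hk' => by
    have := hd k hk'
    rwa [neg_sub_neg, abs_sub_comm]) k hk'
  linarith

namespace AS
variable {c K0 p : ℝ} {ξ ξ' : ℝ → ℝ} {T : ℝ} {γ C t₀ : ℝ} {y y' y'' : ℝ → ℝ}

theorem rate_const (h : FD c K0 p ξ ξ' T) (H : AS c K0 p ξ γ C t₀ y y' y'') {x₀ : ℝ}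
    (hξ : ∀ t, ξ t = x₀) (h0 : c ^ 2 * x₀ - K0 * x₀ ^ p = 0) :
    ∃ C', ∃ t₁, ∀ t ≥ t₁, |y t - ξ t| ≤ C' * mf γ t := by
  have hC := H.hC
  have hγ := H.hγ
  have hx₀ : 0 < x₀ := hξ 0 ▸ h.pos 0
  have hξ' : ξ' 0 = 0 := by
    have : HasDerivAt ξ 0 0 := by
      rw [show ξ = fun _ => x₀ from funext hξ]; exact hasDerivAt_const _ _
    exact (h.d1 0).unique this
  have hlim := H.ham_lim h
  rw [hξ 0, hξ'] at hlim
  obtain ⟨κ, hκ, hw⟩ := well h.hc h.p_gt hx₀ h0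
  have hy : Tendsto y atTop (nhds x₀) := by
    have := H.conv.add_const x₀
    simpa [hξ] using this
  obtain ⟨N, hN⟩ := eventually_atTop.1 (hy.eventually hw)
  set e := fun t => FD.ham c K0 p (y t) (y' t) - FD.ham c K0 p x₀ 0 with he
  have hge : ∀ t ≥ N, y' t ^ 2 + κ * (y t - x₀) ^ 2 ≤ e t := by
    intro t ht
    have h1 := hN t ht
    have h2 : FD.ham c K0 p (y t) (y' t) = y' t ^ 2 + FD.ham c K0 p (y t) 0 := by
      unfold FD.ham; ring
    rw [he]; dsimp only; rw [h2]; linarith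
  have helim : Tendsto e atTop (nhds 0) := by simpa using hlim.sub_const (FD.ham c K0 p x₀ 0)
  set t₁ := max (max N (2 / γ)) (t₀ + 1) with ht₁
  refine ⟨2 * C / γ / √κ, t₁, fun t ht => ?_⟩
  have hb : ∀ t ≥ t₁, N ≤ t ∧ 2 / γ ≤ t ∧ t₀ < t := fun t ht =>
    ⟨(le_max_left _ _).trans ((le_max_left _ _).trans ht),
      (le_max_right _ _).trans ((le_max_left _ _).trans ht), by
      linarith [(le_max_right _ _).trans ht]⟩
  have key : √(e t) ≤ 2 * C / γ * mf γ t := by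
    refine le_of_forall_pos_le_add fun δ hδ => ?_
    have hpos : ∀ s ≥ t₁, 0 < e s + δ ^ 2 ∧ y' s ^ 2 ≤ e s + δ ^ 2 := by
      intro s hs
      have h1 := hge s (hb s hs).1
      have : 0 ≤ κ * (y s - x₀) ^ 2 := by positivity
      have : 0 < δ ^ 2 := by positivity
      exact ⟨by nlinarith [sq_nonneg (y' s)], by linarith⟩
    have := tail_abs (γ := γ) (A := C) (L := √(0 + δ ^ 2)) (t₁ := t₁) hC
      (f := fun s => √(e s + δ ^ 2))
      (f' := fun s => (2 * y' s * (y'' s - (c ^ 2 * y s - K0 * y s ^ p))) / (2 * √(e s + δ ^ 2)))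
      hγ (hb t₁ le_rfl).2.1 (fun s hs => by
        refine HasDerivAt.sqrt ?_ (hpos s hs).1.ne'
        exact ((FD.ham_deriv h.p_gt (H.pos s (hb s hs).2.2) (H.d1 s (hb s hs).2.2)
          (H.d2 s (hb s hs).2.2)).sub_const _).add_const _)
      (fun s hs => by
        have h1 := H.err s (hb s hs).2.2
        have h2 : 0 < √(e s + δ ^ 2) := sqrt_pos.2 (hpos s hs).1
        have h3 : |y' s| ≤ √(e s + δ ^ 2) := abs_le_sqrt (hpos s hs).2
        rw [abs_div, abs_mul, abs_mul, abs_two, abs_of_pos (by positivity : 0 < 2 * √(e s + δ ^ 2)),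
          div_le_iff₀ (by positivity)]
        have h4 : 0 ≤ C * mf γ s := (abs_nonneg _).trans h1
        calc 2 * |y' s| * |y'' s - (c ^ 2 * y s - K0 * y s ^ p)|
            ≤ 2 * √(e s + δ ^ 2) * (C * mf γ s) := by gcongr
          _ = _ := by ring)
      ((helim.add_const _).sqrt) t ht
    rw [zero_add, sqrt_sq hδ.le] at this
    have h5 : √(e t) ≤ √(e t + δ ^ 2) := sqrt_le_sqrt (by nlinarith)
    linarith [(abs_le.1 this).2]
  have h6 : √κ * |y t - x₀| ≤ √(e t) := by
    rw [← sqrt_sq_eq_abs, ← sqrt_mul hκ.le]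
    refine sqrt_le_sqrt ?_
    nlinarith [hge t (hb t ht).1, sq_nonneg (y' t)]
  have hk := sqrt_pos.2 hκ
  rw [hξ t, div_mul_eq_mul_div, le_div_iff₀ hk]
  linarith

theorem rate_nonconst (h : FD c K0 p ξ ξ' T) (H : AS c K0 p ξ γ C t₀ y y' y'') {T0 : ℝ}
    (hT0 : ∀ t, ξ t ≤ ξ T0) (h0 : c ^ 2 * ξ T0 - K0 * ξ T0 ^ p < 0) :
    ∃ C', ∃ t₁, ∀ t ≥ t₁, |y t - ξ t| ≤ C' * mf γ t := by
  have hC := H.hC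
  have hγ := H.hγ
  have hT := h.hT
  have hcr := h.crit_max hT0
  obtain ⟨M, hM, hM'⟩ := h.bdd'
  obtain ⟨t₁, hgr⟩ := H.gron h
  obtain ⟨C₁, hC₁, t₂, hham⟩ := H.ham_rate h
  -- lipschitz
  have hlip : ∀ s t, |ξ s - ξ t| ≤ M * |s - t| := by
    intro s t
    have := Convex.norm_image_sub_le_of_norm_hasDerivWithin_le (f := ξ) (f' := ξ') (s := univ)
      (x := t) (y := s) (C := M) (fun x _ => (h.d1 x).hasDerivWithinAt) (fun x _ => hM' x) convex_univ
      (mem_univ _) (mem_univ _)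
    simpa using this
  -- concavity near the maximum
  obtain ⟨μ, hμ, r, hr, hrT, hconc⟩ : ∃ μ > 0, ∃ r > 0, r ≤ T ∧
      ∀ s, |s - T0| ≤ r → c ^ 2 * ξ s - K0 * ξ s ^ p ≤ -μ := by
    have hct : ContinuousAt (fun s => c ^ 2 * ξ s - K0 * ξ s ^ p) T0 :=
      (continuousAt_const.mul h.cont.continuousAt).sub
        (continuousAt_const.mul (h.cont.continuousAt.rpow_const (Or.inl (h.pos T0).ne')))
    have hev := hct.eventually_le_const (u := (c ^ 2 * ξ T0 - K0 * ξ T0 ^ p) / 2) (by linarith)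
    obtain ⟨r, hr, hr'⟩ := Metric.eventually_nhds_iff.1 hev
    refine ⟨-((c ^ 2 * ξ T0 - K0 * ξ T0 ^ p) / 2), by linarith, min (r / 2) T, by positivity,
      min_le_right _ _, fun s hs => ?_⟩
    rw [neg_neg]
    refine hr' ?_
    rw [Real.dist_eq]
    have := hs.trans (min_le_left _ _)
    linarith
  have hslope : ∀ s, |s - T0| ≤ r → (s - T0) * ξ' s ≤ -μ * (s - T0) ^ 2 := by
    intro s hs
    obtain ⟨hs1, hs2⟩ := abs_le.1 hs
    rcases lt_trichotomy s T0 with hlt | rfl | hlt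
    · obtain ⟨z, hz, hz'⟩ := exists_hasDerivAt_eq_slope ξ' (fun t => c ^ 2 * ξ t - K0 * ξ t ^ p) hlt
        h.cont'.continuousOn (fun x _ => h.d2 x)
      have h1 := hconc z (abs_le.2 ⟨by linarith [hz.1], by linarith [hz.2]⟩)
      rw [hz', div_le_iff₀ (by linarith), hcr] at h1
      nlinarith
    · simp
    · obtain ⟨z, hz, hz'⟩ := exists_hasDerivAt_eq_slope ξ' (fun t => c ^ 2 * ξ t - K0 * ξ t ^ p) hlt
        h.cont'.continuousOn (fun x _ => h.d2 x)
      have h1 := hconc z (abs_le.2 ⟨by linarith [hz.1], by linarith [hz.2]⟩)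
      rw [hz', div_le_iff₀ (by linarith), hcr] at h1
      nlinarith
  have hslope' : ∀ s, |s - T0| ≤ r → μ * |s - T0| ≤ |ξ' s| := by
    intro s hs
    have h1 := hslope s hs
    rcases eq_or_ne s T0 with rfl | hne
    · simp
    · have h2 : 0 < |s - T0| := abs_pos.2 (sub_ne_zero.2 hne)
      have h3 : μ * |s - T0| * |s - T0| ≤ |ξ' s| * |s - T0| := by
        have := neg_abs_le ((s - T0) * ξ' s)
        rw [abs_mul] at this
        have h4 : |s - T0| * |s - T0| = (s - T0) ^ 2 := by rw [← sq, sq_abs]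
        nlinarith
      exact le_of_mul_le_mul_right h3 h2
  -- inverse of potential near the maximum
  obtain ⟨α, hα, ρ, hρ, hpot⟩ : ∃ α > 0, ∃ ρ > 0, ∀ x, |x - ξ T0| < ρ →
      α * |x - ξ T0| ≤ |FD.ham c K0 p x 0 - FD.ham c K0 p (ξ T0) 0| := by
    have hd : HasDerivAt (fun x => FD.ham c K0 p x 0) (-2 * (c ^ 2 * ξ T0 - K0 * ξ T0 ^ p)) (ξ T0) := by
      unfold FD.ham
      have hp := h.p_gt
      have h3 := (hasDerivAt_id (ξ T0)).rpow_const (p := p + 1) (Or.inl (h.pos T0).ne')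
      have := ((((hasDerivAt_id (ξ T0)).pow 2).const_mul (c ^ 2)).const_sub ((0:ℝ) ^ 2)).add
        (h3.const_mul (2 / (p + 1) * K0))
      refine this.congr_deriv ?_
      have : p + 1 ≠ 0 := by linarith
      simp only [add_sub_cancel_right, id]
      field_simp
      push_cast
      ring
    set D := -2 * (c ^ 2 * ξ T0 - K0 * ξ T0 ^ p) with hD
    have hD0 : 0 < D := by linarith
    have hlo := hd.isLittleO.def (c := D / 2) (by positivity)
    obtain ⟨ρ, hρ, hρ'⟩ := Metric.eventually_nhds_iff.1 hlo
    refine ⟨D / 2, by positivity, ρ, hρ, fun x hx => ?_⟩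
    have h1 := hρ' (y := x) (by rwa [Real.dist_eq])
    simp only [norm_eq_abs, smul_eq_mul] at h1
    have h2 : |(x - ξ T0) * D| = |x - ξ T0| * D := by rw [abs_mul, abs_of_pos hD0]
    have h3 := abs_sub_abs_le_abs_sub ((x - ξ T0) * D) (FD.ham c K0 p x 0 - FD.ham c K0 p (ξ T0) 0)
    rw [abs_sub_comm ((x - ξ T0) * D) _, h2] at h3
    linarith
  set δ := r / 2 with hδ
  have hδ0 : 0 < δ := by positivity
  set S : ℕ → ℝ := fun k => T0 + k * T with hS
  have hSlim : Tendsto S atTop atTop :=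
    tendsto_atTop_add_const_left _ _ (tendsto_natCast_atTop_atTop.atTop_mul_const hT)
  have hperk : ∀ (k : ℕ) s, ξ (s + k * T) = ξ s := fun k s => h.per.nat_mul k s
  have hperk' : ∀ (k : ℕ) s, ξ' (s + k * T) = ξ' s := fun k s => h.per'.nat_mul k s
  have hslk : ∀ (k : ℕ) s, |s - S k| ≤ r → μ * |s - S k| ≤ |ξ' s| := by
    intro k s hs
    have e : s - S k = (s - k * T) - T0 := by simp only [hS]; ring
    rw [e] at hs ⊢
    have := hslope' (s - k * T) hs
    rwa [← hperk' k (s - k * T), sub_add_cancel] at this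
  -- existence of critical points
  have hev1 : ∀ᶠ t in atTop, |y' t - ξ' t| < μ * δ := by
    have := (H.conv' h).abs
    rw [abs_zero] at this
    exact this.eventually_lt_const (by positivity)
  obtain ⟨N1, hN1⟩ := eventually_atTop.1 hev1
  have hcrit : ∀ k : ℕ, ∃ t, |t - S k| ≤ δ ∧ (max N1 (t₀ + 1) + δ ≤ S k → y' t = 0) := by
    intro k
    by_cases hk : max N1 (t₀ + 1) + δ ≤ S k
    · have hk1 := (add_le_add_left (le_max_left N1 (t₀ + 1)) δ).trans hk
      have hk2 := (add_le_add_left (le_max_right N1 (t₀ + 1)) δ).trans hk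
      have e1 : 0 ≤ y' (S k - δ) := by
        have h1 := hslope (T0 - δ) (by rw [sub_sub_cancel_left, abs_neg, abs_of_pos hδ0]; linarith)
        have h2 := abs_lt.1 (hN1 (S k - δ) (by linarith))
        have h3 : ξ' (S k - δ) = ξ' (T0 - δ) := by
          rw [← hperk' k (T0 - δ)]; congr 1; simp only [hS]; ring
        have h4 : μ * δ ≤ ξ' (T0 - δ) := by
          have : δ * (μ * δ) ≤ δ * ξ' (T0 - δ) := by nlinarith
          exact le_of_mul_le_mul_left this hδ0
        rw [h3] at h2; linarith [h2.1]
      have e2 : y' (S k + δ) ≤ 0 := by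
        have h1 := hslope (T0 + δ) (by rw [add_sub_cancel_left, abs_of_pos hδ0]; linarith)
        have h2 := abs_lt.1 (hN1 (S k + δ) (by linarith))
        have h3 : ξ' (S k + δ) = ξ' (T0 + δ) := by
          rw [← hperk' k (T0 + δ)]; congr 1; simp only [hS]; ring
        have h4 : ξ' (T0 + δ) ≤ -(μ * δ) := by
          have : δ * ξ' (T0 + δ) ≤ δ * (-(μ * δ)) := by nlinarith
          exact le_of_mul_le_mul_left this hδ0
        rw [h3] at h2; linarith [h2.2]
      obtain ⟨t, ht, ht'⟩ := intermediate_value_Icc' (a := S k - δ) (b := S k + δ) (by linarith)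
        (f := y') (fun s hs => (H.d2 s (by linarith [hs.1])).continuousAt.continuousWithinAt) ⟨e2, e1⟩
      exact ⟨t, abs_le.2 ⟨by linarith [ht.1], by linarith [ht.2]⟩, fun _ => ht'⟩
    · exact ⟨S k, by simpa using hδ0.le, fun h => absurd h hk⟩
  choose τ hτ hτ0 using hcrit
  have hτ0' : ∀ᶠ k in atTop, y' (τ k) = 0 := by
    filter_upwards [hSlim.eventually_ge_atTop (max N1 (t₀ + 1) + δ)] with k hk using hτ0 k hk
  have hτlim : Tendsto τ atTop atTop := by
    refine tendsto_atTop_mono (f := fun k => S k + (-δ)) (fun k => ?_) (tendsto_atTop_add_const_right _ _ hSlim)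
    linarith [(abs_le.1 (hτ k)).1]
  have hσ : Tendsto (fun k => τ k - S k) atTop (nhds 0) := by
    have h1 := ((H.conv' h).comp hτlim).abs
    rw [abs_zero] at h1
    have h2 := h1.const_mul (1 / μ)
    rw [mul_zero] at h2
    refine squeeze_zero_norm' ?_ h2
    filter_upwards [hτ0'] with k hk
    have h3 := hslk k (τ k) ((hτ k).trans (by linarith))
    simp only [Function.comp, hk, zero_sub, abs_neg, norm_eq_abs]
    rw [one_div, ← div_eq_inv_mul, le_div_iff₀ hμ]; linarith
  have hylim : Tendsto (fun k => y (τ k) - ξ T0) atTop (nhds 0) := by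
    have h1 := H.conv.comp hτlim
    have h2 : Tendsto (fun k => ξ (τ k) - ξ T0) atTop (nhds 0) := by
      have h3 := hσ.abs.const_mul M
      rw [abs_zero, mul_zero] at h3
      refine squeeze_zero_norm (fun k => ?_) h3
      rw [norm_eq_abs, ← hperk k T0]
      exact hlip _ _
    simpa using h1.add h2
  have hyr : ∀ᶠ k in atTop, |y (τ k) - ξ T0| ≤ C₁ / α * mf γ (τ k) := by
    have h1 := hylim.abs
    rw [abs_zero] at h1
    filter_upwards [hτ0', h1.eventually_lt_const hρ, hτlim.eventually_ge_atTop t₂] with k k1 k2 k3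
    have h2 := hpot _ k2
    have h3 := hham (τ k) k3
    rw [h.ham_const 0 T0, hcr, k1] at h3
    rw [div_mul_eq_mul_div, le_div_iff₀ hα]
    linarith
  obtain ⟨C₂, hC₂, hgr'⟩ := hgr (T + r) (by positivity)
  set A := C₂ * (C₁ / α + 1) with hA
  have hA0 : 0 ≤ A := by positivity
  have hwin : ∀ᶠ k in atTop, ∀ s ∈ Icc 0 (T + r), |y (τ k + s) - ξ (T0 + s)| ≤ A * mf γ (τ k) ∧
      |y' (τ k + s) - ξ' (T0 + s)| ≤ A * mf γ (τ k) := by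
    filter_upwards [hyr, hτ0', hτlim.eventually_ge_atTop t₁, hτlim.eventually_ge_atTop 0] with k k1 k2 k3 k4
    intro s hs
    have hm := mf_nonneg (γ := γ) k4
    have := hgr' (τ k) k3 T0 (C₁ / α * mf γ (τ k)) k1 (by
      rw [k2, hcr, sub_zero, abs_zero]; positivity) s hs
    have e : C₂ * (C₁ / α * mf γ (τ k) + mf γ (τ k)) = A * mf γ (τ k) := by rw [hA]; ring
    rwa [e] at this
  have hclose : ∀ᶠ k in atTop, mf γ (τ k) ≤ exp (γ * δ) * mf γ (S k) := by
    filter_upwards [hτlim.eventually_ge_atTop (2 / γ), hSlim.eventually_ge_atTop (2 / γ)] with k k1 k2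
    exact mf_close hγ k1 k2 (hτ k)
  have hstep : ∀ᶠ k in atTop, |(τ (k + 1) - S (k + 1)) - (τ k - S k)| ≤
      A * exp (γ * δ) / μ * mf γ (S k) := by
    filter_upwards [hwin, hclose, (tendsto_add_atTop_nat 1).eventually hτ0'] with k k1 k2 k3
    have hSk : S (k + 1) = S k + T := by simp only [hS]; push_cast; ring
    have a1 := abs_le.1 (hτ k)
    have a2 := abs_le.1 (hτ (k + 1))
    have hs : |(τ (k + 1) - S (k + 1)) - (τ k - S k)| ≤ r := by
      rw [abs_le]; constructor <;> linarith [a1.1, a1.2, a2.1, a2.2]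
    have hs' := abs_le.1 hs
    have h1 := (k1 (τ (k + 1) - τ k) ⟨by linarith [hs'.1], by linarith [hs'.2]⟩).2
    rw [add_sub_cancel, k3, zero_sub, abs_neg] at h1
    have h2 : ξ' (T0 + (τ (k + 1) - τ k)) = ξ' (T0 + ((τ (k + 1) - S (k + 1)) - (τ k - S k))) := by
      rw [← h.per' (T0 + ((τ (k + 1) - S (k + 1)) - (τ k - S k)))]; congr 1; rw [hSk]; ring
    rw [h2] at h1
    have h3 := hslope' (T0 + ((τ (k + 1) - S (k + 1)) - (τ k - S k))) (by rwa [add_sub_cancel_left])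
    rw [add_sub_cancel_left] at h3
    rw [div_mul_eq_mul_div, le_div_iff₀ hμ]
    have h4 : A * mf γ (τ k) ≤ A * (exp (γ * δ) * mf γ (S k)) := by gcongr
    linarith
  obtain ⟨k0, hk0⟩ := eventually_atTop.1 (hstep.and (hSlim.eventually_ge_atTop (4 / γ)))
  obtain ⟨C₄, hC₄, hσr⟩ := seq_tail (T0 := T0) (T := T) (k0 := k0) hγ hT
    (C := A * exp (γ * δ) / μ) (by positivity) hσ (fun k hk => (hk0 k hk).2) (fun k hk => (hk0 k hk).1)
  -- conclusion
  obtain ⟨k1, hk1⟩ := eventually_atTop.1 (hwin.and (hclose.and ((hSlim.eventually_ge_atTop (2 / γ)).and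
    (eventually_ge_atTop k0))))
  refine ⟨(A * exp (γ * δ) + M * C₄) * exp (γ * (T + δ)), max (S k1 + δ) (2 / γ), fun t ht => ?_⟩
  have ht1 := (le_max_left _ _).trans ht
  have ht2 := (le_max_right _ _).trans ht
  obtain ⟨k, hk, hkl, hkr⟩ : ∃ k, k1 ≤ k ∧ S k + δ ≤ t ∧ t ≤ S k + δ + T := by
    have hx : (k1 : ℝ) ≤ (t - δ - T0) / T := by
      rw [le_div_iff₀ hT]; simp only [hS] at ht1; linarith
    refine ⟨⌊(t - δ - T0) / T⌋₊, Nat.le_floor hx, ?_, ?_⟩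
    · have := Nat.floor_le (a := (t - δ - T0) / T) (le_trans (by positivity) hx)
      rw [le_div_iff₀ hT] at this
      simp only [hS]; linarith
    · have := (Nat.lt_floor_add_one ((t - δ - T0) / T)).le
      rw [div_le_iff₀ hT] at this
      simp only [hS]; linarith
  obtain ⟨b1, b2, b3, b4⟩ := hk1 k hk
  have a1 := abs_le.1 (hτ k)
  have h1 := (b1 (t - τ k) ⟨by linarith [a1.2], by linarith [a1.1]⟩).1
  rw [add_sub_cancel] at h1
  have h2 := hlip (T0 + (t - τ k)) (t - k * T)
  rw [← hperk k (t - k * T), sub_add_cancel] at h2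
  have e2 : T0 + (t - τ k) - (t - k * T) = -(τ k - S k) := by simp only [hS]; ring
  rw [e2, abs_neg] at h2
  have h3 := hσr k b4
  have h4 : mf γ (S k) ≤ exp (γ * (T + δ)) * mf γ t :=
    mf_close hγ b3 ht2 (by rw [abs_le]; constructor <;> linarith)
  have h5 : |y t - ξ t| ≤ A * mf γ (τ k) + M * (C₄ * mf γ (S k)) := by
    have := abs_add_le (y t - ξ (T0 + (t - τ k))) (ξ (T0 + (t - τ k)) - ξ t)
    rw [sub_add_sub_cancel] at this
    have h6 : M * |τ k - S k| ≤ M * (C₄ * mf γ (S k)) := by gcongr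
    linarith
  calc _ ≤ _ := h5
    _ ≤ A * (exp (γ * δ) * mf γ (S k)) + M * (C₄ * mf γ (S k)) := by gcongr
    _ = (A * exp (γ * δ) + M * C₄) * mf γ (S k) := by ring
    _ ≤ (A * exp (γ * δ) + M * C₄) * (exp (γ * (T + δ)) * mf γ t) := by gcongr
    _ = _ := by ring

theorem rate (h : FD c K0 p ξ ξ' T) (H : AS c K0 p ξ γ C t₀ y y' y'') :
    ∃ C', ∃ t₁, ∀ t ≥ t₁, |y t - ξ t| ≤ C' * mf γ t := by
  obtain ⟨T0, hT0⟩ := h.exists_max_min.1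
  have hle : c ^ 2 * ξ T0 - K0 * ξ T0 ^ p ≤ 0 :=
    second_deriv_nonpos (Filter.Eventually.of_forall h.d1) (h.d2 T0) (Filter.Eventually.of_forall hT0)
  rcases hle.lt_or_eq with h0 | h0
  · exact H.rate_nonconst h hT0 h0
  · refine H.rate_const h (x₀ := ξ T0) (fun t => ?_) h0
    by_contra hne
    have h1 := well_strict h.hc h.p_gt (h.pos T0) h0 (h.pos t) hne
    have h2 := h.ham_const t T0
    rw [h.crit_max hT0] at h2
    have h3 : FD.ham c K0 p (ξ t) (ξ' t) = ξ' t ^ 2 + FD.ham c K0 p (ξ t) 0 := by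
      unfold FD.ham; ring
    nlinarith [sq_nonneg (ξ' t)]

end AS

theorem line_deriv {E : Type*} [NormedAddCommGroup E] [NormedSpace ℝ E] {f : E → ℝ} {x : E} (b : E)
    (hf : ContDiffAt ℝ 2 f x) :
    (∀ᶠ τ : ℝ in nhds 0, HasDerivAt (fun τ : ℝ => f (x + τ • b)) (fderiv ℝ f (x + τ • b) b) τ) ∧
    HasDerivAt (fun τ : ℝ => fderiv ℝ f (x + τ • b) b) (iteratedFDeriv ℝ 2 f x ![b, b]) 0 := by
  have hl : ∀ τ : ℝ, HasDerivAt (fun τ : ℝ => x + τ • b) b τ := fun τ => by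
    simpa using ((hasDerivAt_id τ).smul_const b).const_add x
  have hlc : Tendsto (fun τ : ℝ => x + τ • b) (nhds 0) (nhds x) := by
    have := (hl 0).continuousAt.tendsto
    simpa using this
  constructor
  · have h1 : ∀ᶠ z in nhds x, ContDiffAt ℝ 2 f z := hf.eventually (by simp)
    filter_upwards [hlc.eventually h1] with τ hτ
    have h2 := (hτ.differentiableAt (by simp)).hasFDerivAt
    exact h2.comp_hasDerivAt τ (hl τ)
  · have h1 : ContDiffAt ℝ 1 (fderiv ℝ f) x := hf.fderiv_right (by norm_num)
    have h2 : HasFDerivAt (fderiv ℝ f) (fderiv ℝ (fderiv ℝ f) x) (x + (0 : ℝ) • b) := by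
      simpa using (h1.differentiableAt (by simp)).hasFDerivAt
    have h3 := h2.comp_hasDerivAt (0 : ℝ) (hl 0)
    have h4 := h3.clm_apply (hasDerivAt_const (0 : ℝ) b)
    refine h4.congr_deriv ?_
    rw [iteratedFDeriv_two_apply]
    simp

theorem time_deriv {f : ℝ → ℝ} {t : ℝ} (hf : ContDiffAt ℝ 2 f t) :
    (∀ᶠ s in nhds t, HasDerivAt f (deriv f s) s) ∧ HasDerivAt (deriv f) (dtt f t) t := by
  constructor
  · have h1 : ∀ᶠ z in nhds t, ContDiffAt ℝ 2 f z := hf.eventually (by simp)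
    filter_upwards [h1] with s hs using (hs.differentiableAt (by simp)).hasDerivAt
  · have h1 : ContDiffAt ℝ 1 (fderiv ℝ f) t := hf.fderiv_right (by norm_num)
    have h2 : DifferentiableAt ℝ (deriv f) t := by
      have : deriv f = fun s => fderiv ℝ f s 1 := by ext s; rfl
      rw [this]
      exact (h1.differentiableAt (by simp)).clm_apply (differentiableAt_const _)
    exact h2.hasDerivAt

theorem lap_basis {n : ℕ} (b : OrthonormalBasis (Fin n) ℝ (EuclideanSpace ℝ (Fin n)))
    (f : EuclideanSpace ℝ (Fin n) → ℝ) (x : EuclideanSpace ℝ (Fin n)) :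
    lapE f x = ∑ i, iteratedFDeriv ℝ 2 f x ![b i, b i] := by
  have h1 := congrFun (InnerProductSpace.laplacian_eq_iteratedFDeriv_orthonormalBasis f b) x
  have h2 := congrFun (InnerProductSpace.laplacian_eq_iteratedFDeriv_orthonormalBasis f
    (EuclideanSpace.basisFun (Fin n) ℝ)) x
  rw [← h1, h2]
  unfold lapE
  simp

/-- one-dimensional restriction of the spherical coordinate -/
def qf (s a β τ : ℝ) : ℝ := (s + τ * a) * (1 + 2 * τ * β + τ ^ 2) ^ (-(1 / 2) : ℝ)

def qf1 (s a β τ : ℝ) : ℝ := a * (1 + 2 * τ * β + τ ^ 2) ^ (-(1 / 2) : ℝ) -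
  (s + τ * a) * (β + τ) * (1 + 2 * τ * β + τ ^ 2) ^ (-(3 / 2) : ℝ)

theorem qf_deriv (s a β : ℝ) :
    (∀ᶠ τ in nhds 0, HasDerivAt (qf s a β) (qf1 s a β τ) τ) ∧
    HasDerivAt (qf1 s a β) (-2 * a * β - s + 3 * s * β ^ 2) 0 := by
  have hN : ∀ τ, HasDerivAt (fun τ : ℝ => 1 + 2 * τ * β + τ ^ 2) (2 * β + 2 * τ) τ := by
    intro τ
    have := ((((hasDerivAt_id τ).const_mul 2).mul_const β).const_add 1).add ((hasDerivAt_id τ).pow 2)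
    exact this.congr_deriv (by simp)
  have hl : ∀ τ, HasDerivAt (fun τ : ℝ => s + τ * a) a τ := by
    intro τ
    simpa using ((hasDerivAt_id τ).mul_const a).const_add s
  constructor
  · have hpos : ∀ᶠ τ : ℝ in nhds 0, 0 < 1 + 2 * τ * β + τ ^ 2 := by
      have := (hN 0).continuousAt.tendsto
      exact this.eventually_const_lt (by norm_num)
    filter_upwards [hpos] with τ hτ
    have h1 := (hN τ).rpow_const (p := -(1 / 2)) (Or.inl hτ.ne')
    refine ((hl τ).mul h1).congr_deriv ?_
    unfold qf1
    norm_num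
    ring
  · have h1 := (hN 0).rpow_const (p := -(1 / 2)) (Or.inl (by norm_num))
    have h2 := (hN 0).rpow_const (p := -(3 / 2)) (Or.inl (by norm_num))
    have h3 : HasDerivAt (fun τ : ℝ => β + τ) 1 0 := (hasDerivAt_id 0).const_add β
    refine ((h1.const_mul a).sub (((hl 0).mul h3).mul h2)).congr_deriv ?_
    norm_num
    ring

section
variable {n : ℕ}

def Sf (e x : EuclideanSpace ℝ (Fin n)) : ℝ := inner ℝ e x * ‖x‖⁻¹

theorem Sf_line {e θ b : EuclideanSpace ℝ (Fin n)} (hθ : ‖θ‖ = 1) (hb : ‖b‖ = 1) :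
    ∀ᶠ τ : ℝ in nhds 0, Sf e (θ + τ • b) = qf (inner ℝ e θ) (inner ℝ e b) (inner ℝ θ b) τ := by
  refine Eventually.of_forall fun τ => ?_
  unfold Sf qf
  rw [inner_add_right, inner_smul_right]
  congr 1
  have h1 : ‖θ + τ • b‖ ^ 2 = 1 + 2 * τ * inner ℝ θ b + τ ^ 2 := by
    rw [norm_add_sq_real, inner_smul_right, norm_smul, hθ, hb, mul_one, norm_eq_abs, sq_abs]; ring
  rw [← h1, ← rpow_natCast, ← rpow_mul (norm_nonneg _)]
  norm_num
  rw [rpow_neg_one]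

theorem qf_sums (b : OrthonormalBasis (Fin n) ℝ (EuclideanSpace ℝ (Fin n))) {e θ : EuclideanSpace ℝ (Fin n)} (he : ‖e‖ = 1) (hθ : ‖θ‖ = 1) :
    ∑ i, (inner ℝ e (b i)) ^ 2 = (1 : ℝ) ∧ ∑ i, (inner ℝ θ (b i)) ^ 2 = (1 : ℝ) ∧
    ∑ i, (inner ℝ e (b i)) * (inner ℝ θ (b i)) = (inner ℝ e θ : ℝ) := by
  refine ⟨?_, ?_, ?_⟩
  · have := b.sum_inner_mul_inner e e
    rw [real_inner_self_eq_norm_sq, he, one_pow] at this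
    refine Eq.trans ?_ this
    exact Finset.sum_congr rfl fun i _ => by rw [real_inner_comm e (b i)]; ring
  · have := b.sum_inner_mul_inner θ θ
    rw [real_inner_self_eq_norm_sq, hθ, one_pow] at this
    refine Eq.trans ?_ this
    exact Finset.sum_congr rfl fun i _ => by rw [real_inner_comm θ (b i)]; ring
  · rw [← b.sum_inner_mul_inner e θ]
    exact Finset.sum_congr rfl fun i _ => by rw [real_inner_comm θ (b i)]

end

structure CS {n : ℕ} (c p : ℝ) (K : EuclideanSpace ℝ (Fin n) → ℝ) (ξ : ℝ → ℝ)
    (F : ℝ × EuclideanSpace ℝ (Fin n) → ℝ) : Prop where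
  reg : ContDiffOn ℝ 2 F (Ioi 0 ×ˢ {x | x ≠ 0})
  hom : ∀ (t : ℝ) (x : EuclideanSpace ℝ (Fin n)) (r : ℝ), 0 < r → F (t, r • x) = F (t, x)
  pos : ∀ t > 0, ∀ θ : EuclideanSpace ℝ (Fin n), ‖θ‖ = 1 → 0 < F (t, θ)
  eq : ∀ t > 0, ∀ θ : EuclideanSpace ℝ (Fin n), ‖θ‖ = 1 →
    -dtt (fun s => F (s, θ)) t - lapE (fun x => F (t, x)) θ + c ^ 2 * F (t, θ)
      = K (exp (-t) • θ) * F (t, θ) ^ p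
  conv : ∀ ε > 0, ∃ T, ∀ t ≥ T, ∀ θ : EuclideanSpace ℝ (Fin n), ‖θ‖ = 1 → |F (t, θ) - ξ t| < ε

/-- angular barrier -/
def psf (η m s : ℝ) : ℝ := s + η * (1 - m / 2 * s ^ 2)

namespace CS
variable {n : ℕ} {c p : ℝ} {K : EuclideanSpace ℝ (Fin n) → ℝ} {ξ : ℝ → ℝ}
    {F : ℝ × EuclideanSpace ℝ (Fin n) → ℝ}

theorem contAt (h : CS c p K ξ F) {t : ℝ} {x : EuclideanSpace ℝ (Fin n)} (ht : 0 < t) (hx : x ≠ 0) :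
    ContDiffAt ℝ 2 F (t, x) := by
  refine h.reg.contDiffAt ?_
  exact (isOpen_Ioi.prod isOpen_ne).mem_nhds ⟨ht, hx⟩

theorem contAt_t (h : CS c p K ξ F) {t : ℝ} {x : EuclideanSpace ℝ (Fin n)} (ht : 0 < t) (hx : x ≠ 0) :
    ContDiffAt ℝ 2 (fun s => F (s, x)) t :=
  (h.contAt ht hx).comp t (contDiffAt_id.prodMk contDiffAt_const)

theorem contAt_x (h : CS c p K ξ F) {t : ℝ} {x : EuclideanSpace ℝ (Fin n)} (ht : 0 < t) (hx : x ≠ 0) :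
    ContDiffAt ℝ 2 (fun z => F (t, z)) x :=
  (h.contAt ht hx).comp x (contDiffAt_const.prodMk contDiffAt_id)

theorem contact (h : CS c p K ξ F) {t A τ η m : ℝ} {e θ : EuclideanSpace ℝ (Fin n)}
    (R : EuclideanSpace ℝ (Fin n) ≃ₗᵢ[ℝ] EuclideanSpace ℝ (Fin n))
    (ht : 0 < t) (hθ : ‖θ‖ = 1) (he : ‖e‖ = 1) (hm : m = n - 1)
    {f f' f'' g g' g'' : ℝ → ℝ} (hf : ∀ t, HasDerivAt f (f' t) t ∧ HasDerivAt f' (f'' t) t)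
    (hg : ∀ t, HasDerivAt g (g' t) t ∧ HasDerivAt g' (g'' t) t)
    (hmax : IsLocalMax (fun z : ℝ × EuclideanSpace ℝ (Fin n) => F (z.1, z.2) - F (z.1, R z.2)
      - A * (Sf e z.2 * f z.1) - τ * (psf η m (Sf e z.2) * g z.1)) (t, θ)) :
    (dtt (fun s => F (s, θ)) t + lapE (fun x => F (t, x)) θ)
      - (dtt (fun s => F (s, R θ)) t + lapE (fun x => F (t, x)) (R θ))
    ≤ A * (inner ℝ e θ * (f'' t - m * f t)) + τ * (psf η m (inner ℝ e θ) * g'' t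
      + (-m * (inner ℝ e θ + η * (1 - (m + 1) * inner ℝ e θ ^ 2))) * g t) := by
  have hθ0 : θ ≠ 0 := by intro h0; rw [h0, norm_zero] at hθ; exact zero_ne_one hθ
  have hRθ : ‖R θ‖ = 1 := by rw [R.norm_map, hθ]
  have hRθ0 : R θ ≠ 0 := by intro h0; rw [h0, norm_zero] at hRθ; exact zero_ne_one hRθ
  have hS : Sf e θ = inner ℝ e θ := by unfold Sf; rw [hθ]; simp
  set s : ℝ := inner ℝ e θ with hs
  -- time
  have T1 := time_deriv (h.contAt_t ht hθ0)
  have T2 := time_deriv (h.contAt_t ht hRθ0)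
  have htime : dtt (fun s => F (s, θ)) t - dtt (fun s => F (s, R θ)) t - A * (s * f'' t)
      - τ * (psf η m s * g'' t) ≤ 0 := by
    refine second_deriv_nonpos (f := fun r => F (r, θ) - F (r, R θ) - A * (s * f r)
      - τ * (psf η m s * g r)) (f' := fun r => deriv (fun s => F (s, θ)) r
        - deriv (fun s => F (s, R θ)) r - A * (s * f' r) - τ * (psf η m s * g' r)) (a := t) ?_ ?_ ?_
    · filter_upwards [T1.1, T2.1] with r h1 h2
      exact ((h1.sub h2).sub (((hf r).1.const_mul s).const_mul A)).sub
        (((hg r).1.const_mul _).const_mul τ)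
    · exact ((T1.2.sub T2.2).sub (((hf t).2.const_mul s).const_mul A)).sub
        (((hg t).2.const_mul _).const_mul τ)
    · have hc : Tendsto (fun r : ℝ => (r, θ)) (nhds t) (nhds (t, θ)) :=
        (continuous_id.prodMk continuous_const).tendsto t
      have := hc.eventually hmax
      simp only [hS] at this
      exact this
  -- space
  set b := EuclideanSpace.basisFun (Fin n) ℝ with hb
  have hspace : ∀ i, iteratedFDeriv ℝ 2 (fun x => F (t, x)) θ ![b i, b i]
      - iteratedFDeriv ℝ 2 (fun x => F (t, x)) (R θ) ![R (b i), R (b i)]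
      - A * ((-2 * inner ℝ e (b i) * inner ℝ θ (b i) - s + 3 * s * inner ℝ θ (b i) ^ 2) * f t)
      - τ * (((-2 * inner ℝ e (b i) * inner ℝ θ (b i) - s + 3 * s * inner ℝ θ (b i) ^ 2) * (1 - η * m * s)
        - η * m * (inner ℝ e (b i) - s * inner ℝ θ (b i)) ^ 2) * g t) ≤ 0 := by
    intro i
    have hbi : ‖b i‖ = 1 := b.norm_eq_one i
    have X1 := line_deriv (b i) (h.contAt_x ht hθ0)
    have X2 := line_deriv (R (b i)) (h.contAt_x ht hRθ0)
    set a : ℝ := inner ℝ e (b i) with ha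
    set β : ℝ := inner ℝ θ (b i) with hβ
    have Q := qf_deriv s a β
    have q0 : qf s a β 0 = s := by unfold qf; norm_num
    have q10 : qf1 s a β 0 = a - s * β := by unfold qf1; norm_num
    have hq : ∀ᶠ r in nhds (0 : ℝ), HasDerivAt (fun r => psf η m (qf s a β r))
        (qf1 s a β r * (1 - η * m * qf s a β r)) r := by
      filter_upwards [Q.1] with r hr
      unfold psf
      refine (hr.add ((((hr.pow 2).const_mul (m / 2)).const_sub 1).const_mul η)).congr_deriv ?_
      push_cast; ring
    have Q00 : HasDerivAt (qf s a β) (a - s * β) 0 := by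
      have := Q.1.self_of_nhds
      rwa [q10] at this
    have hq2 : HasDerivAt (fun r => qf1 s a β r * (1 - η * m * qf s a β r))
        ((-2 * a * β - s + 3 * s * β ^ 2) * (1 - η * m * s) - η * m * (a - s * β) ^ 2) 0 := by
      refine (Q.2.mul ((Q00.const_mul (η * m)).const_sub 1)).congr_deriv ?_
      rw [q0, q10]; ring
    refine second_deriv_nonpos (f := fun r => F (t, θ + r • b i) - F (t, R θ + r • R (b i))
      - A * (qf s a β r * f t) - τ * (psf η m (qf s a β r) * g t))
      (f' := fun r => fderiv ℝ (fun x => F (t, x)) (θ + r • b i) (b i)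
        - fderiv ℝ (fun x => F (t, x)) (R θ + r • R (b i)) (R (b i))
        - A * (qf1 s a β r * f t) - τ * (qf1 s a β r * (1 - η * m * qf s a β r) * g t)) (a := 0) ?_ ?_ ?_
    · filter_upwards [X1.1, X2.1, Q.1, hq] with r h1 h2 h3 h4
      exact ((h1.sub h2).sub ((h3.mul_const _).const_mul A)).sub ((h4.mul_const _).const_mul τ)
    · exact ((X1.2.sub X2.2).sub ((Q.2.mul_const _).const_mul A)).sub ((hq2.mul_const _).const_mul τ)
    · have hc : Tendsto (fun r : ℝ => (t, θ + r • b i)) (nhds 0) (nhds (t, θ)) := by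
        have : Continuous (fun r : ℝ => (t, θ + r • b i)) := by fun_prop
        simpa using this.tendsto 0
      have h1 := hc.eventually hmax
      filter_upwards [h1, Sf_line (e := e) hθ hbi] with r h1 h2
      simp only [h2, map_add, map_smul] at h1
      simp only [zero_smul, add_zero, q0]
      rw [hS] at h1
      exact h1
  have hsum := Finset.sum_nonpos (s := Finset.univ) fun i _ => hspace i
  obtain ⟨s1, s2, s3⟩ := qf_sums b he hθ
  have L1 := lap_basis b (fun x => F (t, x)) θ
  have L2 := lap_basis (b.map R) (fun x => F (t, x)) (R θ)
  simp only [OrthonormalBasis.map_apply] at L2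
  have hcard : ∑ _i : Fin n, s = n * s := by simp
  have hQ : ∑ i, (-2 * inner ℝ e (b i) * inner ℝ θ (b i) - s + 3 * s * inner ℝ θ (b i) ^ 2) = -m * s := by
    have : ∀ i, (-2 * inner ℝ e (b i) * inner ℝ θ (b i) - s + 3 * s * inner ℝ θ (b i) ^ 2) =
      -2 * (inner ℝ e (b i) * inner ℝ θ (b i)) - s + 3 * s * inner ℝ θ (b i) ^ 2 := fun i => by ring
    simp only [this]
    rw [Finset.sum_add_distrib, Finset.sum_sub_distrib, ← Finset.mul_sum, ← Finset.mul_sum, s2, s3,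
      hcard, hm]
    ring
  have hQ2 : ∑ i, (inner ℝ e (b i) - s * inner ℝ θ (b i)) ^ 2 = 1 - s ^ 2 := by
    have : ∀ i, (inner ℝ e (b i) - s * inner ℝ θ (b i)) ^ 2 =
      inner ℝ e (b i) ^ 2 - 2 * s * (inner ℝ e (b i) * inner ℝ θ (b i))
        + s ^ 2 * inner ℝ θ (b i) ^ 2 := fun i => by ring
    simp only [this]
    rw [Finset.sum_add_distrib, Finset.sum_sub_distrib, ← Finset.mul_sum, ← Finset.mul_sum, s1, s2, s3]
    ring
  rw [Finset.sum_sub_distrib, Finset.sum_sub_distrib, Finset.sum_sub_distrib, ← L1, ← L2,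
    ← Finset.mul_sum, ← Finset.mul_sum, ← Finset.sum_mul, ← Finset.sum_mul, Finset.sum_sub_distrib,
    ← Finset.sum_mul, ← Finset.mul_sum, hQ, hQ2] at hsum
  have e1 : -m * s * (1 - η * m * s) - η * m * (1 - s ^ 2)
    = -m * (s + η * (1 - (m + 1) * s ^ 2)) := by ring
  rw [e1] at hsum
  linarith

end CS

theorem rpow_tangent {p a b : ℝ} (hp : 1 ≤ p) (ha : 0 < a) (hb : 0 < b) :
    a ^ p - b ^ p ≤ p * a ^ (p - 1) * (a - b) := by
  have h1 := one_add_mul_self_le_rpow_one_add (s := b / a - 1) (p := p) (by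
    have : 0 < b / a := by positivity
    linarith) hp
  rw [add_sub_cancel, div_rpow hb.le ha.le, le_div_iff₀ (rpow_pos_of_pos ha _)] at h1
  have h2 : a ^ p = a ^ (p - 1) * a := by rw [← rpow_add_one ha.ne']; ring_nf
  have h3 : (1 + p * (b / a - 1)) * a ^ p = a ^ p + p * a ^ (p - 1) * (b - a) := by
    rw [h2]; field_simp
  linarith

theorem psf_ge {η m s : ℝ} (hη : 0 < η) (hηm : η * m / 2 ≤ 1) (hs0 : 0 ≤ s) (hs1 : s ≤ 1) (hm : 0 ≤ m) :
    η ≤ psf η m s := by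
  unfold psf
  have h1 : s ^ 2 ≤ s := by nlinarith
  have h2 : η * m / 2 * s ^ 2 ≤ 1 * s := mul_le_mul hηm h1 (sq_nonneg _) (by norm_num)
  linarith

theorem psf_lap {η m s δ : ℝ} (hη : 0 < η) (hs0 : 0 ≤ s) (hs1 : s ≤ 1) (hm : 0 ≤ m) (hδ : 0 < δ)
    (hηδ : η * (m ^ 2 / 2 + m + δ * m / 2) ≤ δ) :
    -m * (s + η * (1 - (m + 1) * s ^ 2)) ≤ -(m - δ) * psf η m s := by
  unfold psf
  have h1 : s ^ 2 ≤ s := by nlinarith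
  have h2 : η * (m ^ 2 / 2 + m + δ * m / 2) * s ^ 2 ≤ δ * s :=
    mul_le_mul hηδ h1 (sq_nonneg _) hδ.le
  have h3 : 0 < δ * η := by positivity
  nlinarith

theorem osc_arith {c A s f τ ψ g Q ε C1 E f2 m δ g2 : ℝ}
    (m6 : c ^ 2 * (A * (s * f) + τ * (ψ * g)) - (Q + ε) * (A * (s * f) + τ * (ψ * g)) - C1 * E * (2 * s)
      ≤ A * (s * (f2 - m * f)) + τ * (ψ * g2) + τ * ((-(m - δ) * ψ) * g))
    (m4 : s * (2 * C1 * E) ≤ s * (A * (- f2 + (m + c ^ 2 - Q) * f - ε * f)))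
    (m5 : 0 < τ * (ψ * (- g2 + (m + c ^ 2 - Q) * g - (δ + ε) * g))) : False := by
  linarith

namespace CS
variable {n : ℕ} {c p : ℝ} {K : EuclideanSpace ℝ (Fin n) → ℝ} {ξ : ℝ → ℝ}
    {F : ℝ × EuclideanSpace ℝ (Fin n) → ℝ}

set_option maxHeartbeats 1600000 in
theorem osc_e (h : CS c p K ξ F) {K0 t0 κ C1 A : ℝ} (hp : 1 ≤ p) (hc : 0 < c)
    (hn : 2 * c + 1 = n - 1) (ht0 : 0 < t0) (hκ : 0 < κ)
    {f f' f'' g g' g'' ε : ℝ → ℝ} (hf : ∀ t, HasDerivAt f (f' t) t ∧ HasDerivAt f' (f'' t) t)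
    (hg : ∀ t, HasDerivAt g (g' t) t ∧ HasDerivAt g' (g'' t) t) (hgκ : ∀ t, κ ≤ g t)
    (hgs : ∀ t, κ * g t ≤ - g'' t + FD.pot c K0 p ξ t * g t)
    (hA : 0 ≤ A) (hf0 : ∀ t ≥ t0, 0 ≤ f t) (hε : ∀ t ≥ t0, ε t ≤ κ / 4)
    (hpot : ∀ t ≥ t0, ∀ θ : EuclideanSpace ℝ (Fin n), ‖θ‖ = 1 → 0 < K (exp (-t) • θ) ∧
      p * K (exp (-t) • θ) * F (t, θ) ^ (p - 1) ≤ p * K0 * ξ t ^ (p - 1) + ε t)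
    (hKl : ∀ t ≥ t0, ∀ θ θ' : EuclideanSpace ℝ (Fin n), ‖θ‖ = 1 → ‖θ'‖ = 1 →
      (K (exp (-t) • θ) - K (exp (-t) • θ')) * F (t, θ') ^ p ≤ C1 * exp (-t) * ‖θ - θ'‖)
    (hsup : ∀ t ≥ t0, 2 * C1 * exp (-t) ≤ A * (- f'' t + FD.pot c K0 p ξ t * f t - ε t * f t))
    (hbd : ∀ θ θ' : EuclideanSpace ℝ (Fin n), ‖θ‖ = 1 → ‖θ'‖ = 1 →
      F (t0, θ) - F (t0, θ') ≤ A * f t0 / 2 * ‖θ - θ'‖)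
    {e : EuclideanSpace ℝ (Fin n)} (he : ‖e‖ = 1)
    (R : EuclideanSpace ℝ (Fin n) ≃ₗᵢ[ℝ] EuclideanSpace ℝ (Fin n))
    (hR : ∀ x, R x = x - (2 * inner ℝ e x) • e) :
    ∀ t ≥ t0, ∀ θ : EuclideanSpace ℝ (Fin n), ‖θ‖ = 1 → 0 ≤ inner ℝ e θ →
      F (t, θ) - F (t, R θ) ≤ A * (inner ℝ e θ * f t) := by
  obtain ⟨m, hm⟩ : ∃ m : ℝ, m = n - 1 := ⟨_, rfl⟩
  have hm0 : 0 < m := by linarith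
  obtain ⟨δ, hδ⟩ : ∃ δ, δ = κ / 4 := ⟨_, rfl⟩
  have hδ0 : 0 < δ := by linarith
  obtain ⟨η, hη0, hη1, hη2⟩ : ∃ η > 0, η * m / 2 ≤ 1 ∧ η * (m ^ 2 / 2 + m + δ * m / 2) ≤ δ := by
    refine ⟨δ / (m ^ 2 / 2 + m + δ * m / 2), by positivity, ?_, ?_⟩
    · rw [div_mul_eq_mul_div, div_div, div_le_one (by positivity)]
      nlinarith [sq_nonneg m]
    · rw [div_mul_cancel₀]; positivity
  have hs1 : ∀ θ : EuclideanSpace ℝ (Fin n), ‖θ‖ = 1 → inner ℝ e θ ≤ (1 : ℝ) := by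
    intro θ hθ
    have := real_inner_le_norm e θ
    rwa [he, hθ, mul_one] at this
  have hne : ∀ θ : EuclideanSpace ℝ (Fin n), ‖θ‖ = 1 → θ ≠ 0 := by
    intro θ hθ h0; rw [h0, norm_zero] at hθ; exact zero_ne_one hθ
  have hRn : ∀ θ : EuclideanSpace ℝ (Fin n), ‖θ‖ = 1 → ‖R θ‖ = 1 := fun θ hθ => by rw [R.norm_map, hθ]
  have hRd : ∀ θ : EuclideanSpace ℝ (Fin n), 0 ≤ inner ℝ e θ → ‖θ - R θ‖ = 2 * inner ℝ e θ := by
    intro θ hs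
    rw [hR, sub_sub_cancel, norm_smul, he, mul_one, norm_eq_abs, abs_of_nonneg (by positivity)]
  have hgp : ∀ t, 0 < g t := fun t => hκ.trans_le (hgκ t)
  intro t₁ ht₁ θ₁ hθ₁ hsθ₁
  by_contra hcon
  push Not at hcon
  -- quotient
  set Nm : ℝ × EuclideanSpace ℝ (Fin n) → ℝ := fun z =>
    F (z.1, z.2) - F (z.1, R z.2) - A * (inner ℝ e z.2 * f z.1) with hNm
  set Dn : ℝ × EuclideanSpace ℝ (Fin n) → ℝ := fun z => psf η m (inner ℝ e z.2) * g z.1 with hDn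
  set H : Set (EuclideanSpace ℝ (Fin n)) := sphere 0 1 ∩ {θ | (0 : ℝ) ≤ inner ℝ e θ} with hH
  have hHc : IsCompact H := by
    refine (isCompact_sphere _ _).inter_right ?_
    exact isClosed_le continuous_const (by fun_prop)
  have memH : ∀ θ, θ ∈ H ↔ ‖θ‖ = 1 ∧ (0 : ℝ) ≤ inner ℝ e θ := by
    intro θ; simp [hH]
  have hDp : ∀ t, ∀ θ ∈ H, η * κ ≤ Dn (t, θ) := by
    intro t θ hθ
    rw [memH] at hθ
    have h1 := psf_ge hη0 hη1 hθ.2 (hs1 θ hθ.1) hm0.le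
    exact mul_le_mul h1 (hgκ t) hκ.le (hη0.le.trans h1)
  have hηκ : 0 < η * κ := by positivity
  have hDp0 : ∀ t, ∀ θ ∈ H, 0 < Dn (t, θ) := fun t θ hθ => hηκ.trans_le (hDp t θ hθ)
  have hθ₁H : θ₁ ∈ H := (memH _).2 ⟨hθ₁, hsθ₁⟩
  have hz₁ : 0 < Nm (t₁, θ₁) / Dn (t₁, θ₁) := by
    refine div_pos ?_ (hDp0 _ _ hθ₁H)
    simp only [hNm]; linarith
  set z₁ := Nm (t₁, θ₁) / Dn (t₁, θ₁) with hz₁d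
  obtain ⟨B, hB⟩ := h.conv (z₁ * (η * κ) / 4) (by positivity)
  set B' := max B t₁ with hB'
  have hcf : Continuous f := continuous_iff_continuousAt.2 fun t => (hf t).1.continuousAt
  have hcg : Continuous g := continuous_iff_continuousAt.2 fun t => (hg t).1.continuousAt
  have hcont : ContinuousOn (fun z => Nm z / Dn z) (Icc t0 B' ×ˢ H) := by
    refine ContinuousOn.div ?_ ?_ ?_
    · have hF1 : ContinuousOn (fun z : ℝ × EuclideanSpace ℝ (Fin n) => F (z.1, z.2)) (Icc t0 B' ×ˢ H) := by
        intro z hz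
        exact (h.contAt (ht0.trans_le hz.1.1) (hne _ ((memH _).1 hz.2).1)).continuousAt.continuousWithinAt
      have hF2 : ContinuousOn (fun z : ℝ × EuclideanSpace ℝ (Fin n) => F (z.1, R z.2)) (Icc t0 B' ×ˢ H) := by
        intro z hz
        have h1 := (h.contAt (ht0.trans_le hz.1.1) (hne _ (hRn _ ((memH _).1 hz.2).1))).continuousAt
        have h2 : ContinuousAt (fun z : ℝ × EuclideanSpace ℝ (Fin n) => (z.1, R z.2)) z := by
          have := R.continuous
          fun_prop
        exact (ContinuousAt.comp (g := F) (f := fun z : ℝ × EuclideanSpace ℝ (Fin n) => (z.1, R z.2))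
          (x := z) h1 h2).continuousWithinAt
      refine (hF1.sub hF2).sub ?_
      exact Continuous.continuousOn (by fun_prop)
    · refine Continuous.continuousOn ?_
      simp only [hDn, psf]
      fun_prop
    · exact fun z hz => (hDp0 z.1 z.2 hz.2).ne'
  obtain ⟨⟨t, θ⟩, hz, hmaxz⟩ := (isCompact_Icc.prod hHc).exists_isMaxOn
    ⟨(t₁, θ₁), ⟨⟨ht₁, le_max_right _ _⟩, hθ₁H⟩⟩ hcont
  set τ := Nm (t, θ) / Dn (t, θ) with hτ
  have hz₁τ : z₁ ≤ τ := hmaxz (show (t₁, θ₁) ∈ Icc t0 B' ×ˢ H from ⟨⟨ht₁, le_max_right _ _⟩, hθ₁H⟩)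
  have hτ0 : 0 < τ := hz₁.trans_le hz₁τ
  have hglob : ∀ r ≥ t0, ∀ x ∈ H, Nm (r, x) ≤ τ * Dn (r, x) := by
    intro r hr x hx
    rw [← div_le_iff₀ (hDp0 r x hx)]
    rcases le_or_gt r B' with hrB | hrB
    · exact hmaxz (show (r, x) ∈ Icc t0 B' ×ˢ H from ⟨⟨hr, hrB⟩, hx⟩)
    · have hx' := (memH x).1 hx
      have hrB2 : B ≤ r := (le_max_left _ _).trans hrB.le
      have b1 := abs_lt.1 (hB r hrB2 x hx'.1)
      have b2 := abs_lt.1 (hB r hrB2 (R x) (hRn x hx'.1))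
      have b3 : Nm (r, x) ≤ z₁ * (η * κ) := by
        simp only [hNm]
        have : 0 ≤ A * (inner ℝ e x * f r) := mul_nonneg hA (mul_nonneg hx'.2 (hf0 r hr))
        have : 0 < z₁ * (η * κ) := by positivity
        linarith [b1.2, b2.1]
      rw [div_le_iff₀ (hDp0 r x hx)]
      refine b3.trans (mul_le_mul hz₁τ (hDp r x hx) hηκ.le hτ0.le)
  have hθH : θ ∈ H := hz.2
  have hθ' := (memH θ).1 hθH
  have htt0 : t0 ≤ t := hz.1.1
  have hNτ : Nm (t, θ) = τ * Dn (t, θ) := by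
    rw [hτ, div_mul_cancel₀]; exact (hDp0 t θ hθH).ne'
  have hNpos : 0 < Nm (t, θ) := by rw [hNτ]; exact mul_pos hτ0 (hDp0 t θ hθH)
  have hspos : (0 : ℝ) < inner ℝ e θ := by
    rcases hθ'.2.lt_or_eq with h1 | h1
    · exact h1
    · exfalso
      simp only [hNm, hR θ, ← h1] at hNpos
      simp at hNpos
  have htpos : t0 < t := by
    rcases htt0.lt_or_eq with h1 | h1
    · exact h1
    · exfalso
      have h2 := hbd θ (R θ) hθ'.1 (hRn θ hθ'.1)
      rw [hRd θ hθ'.2] at h2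
      simp only [hNm, ← h1] at hNpos
      linarith
  have htp : 0 < t := ht0.trans htpos
  -- local max
  have hloc : IsLocalMax (fun z : ℝ × EuclideanSpace ℝ (Fin n) => F (z.1, z.2) - F (z.1, R z.2)
      - A * (Sf e z.2 * f z.1) - τ * (psf η m (Sf e z.2) * g z.1)) (t, θ) := by
    have e1 : ∀ᶠ z : ℝ × EuclideanSpace ℝ (Fin n) in nhds (t, θ), t0 < z.1 :=
      continuousAt_fst.eventually (lt_mem_nhds htpos)
    have e2 : ∀ᶠ z : ℝ × EuclideanSpace ℝ (Fin n) in nhds (t, θ), (0 : ℝ) < inner ℝ e z.2 := by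
      have : Continuous (fun z : ℝ × EuclideanSpace ℝ (Fin n) => (inner ℝ e z.2 : ℝ)) := by fun_prop
      exact this.continuousAt.eventually (lt_mem_nhds hspos)
    have hS : Sf e θ = inner ℝ e θ := by unfold Sf; rw [hθ'.1]; simp
    filter_upwards [e1, e2] with z z1 z2
    have hz0 : z.2 ≠ 0 := by intro h0; rw [h0, inner_zero_right] at z2; exact lt_irrefl _ z2
    have hzn : 0 < ‖z.2‖⁻¹ := inv_pos.2 (norm_pos_iff.2 hz0)
    have hSz : Sf e z.2 = inner ℝ e (‖z.2‖⁻¹ • z.2) := by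
      rw [inner_smul_right]; unfold Sf; ring
    have hzH : ‖z.2‖⁻¹ • z.2 ∈ H := by
      rw [memH]
      refine ⟨norm_smul_inv_norm (𝕜 := ℝ) hz0, ?_⟩
      rw [inner_smul_right]; positivity
    have k1 := hglob z.1 z1.le _ hzH
    simp only [hNm, hDn, map_smul] at k1
    rw [h.hom _ _ _ hzn, h.hom _ _ _ hzn, ← hSz] at k1
    have k2 := hNτ
    simp only [hNm, hDn] at k2
    simp only [hS]
    linarith
  have key := h.contact R htp hθ'.1 he hm hf hg hloc
  have E1 := h.eq t htp θ hθ'.1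
  have E2 := h.eq t htp (R θ) (hRn θ hθ'.1)
  have p1 := h.pos t htp θ hθ'.1
  have p2 := h.pos t htp (R θ) (hRn θ hθ'.1)
  obtain ⟨k1, k2⟩ := hpot t htt0 θ hθ'.1
  have k3 := hKl t htt0 θ (R θ) hθ'.1 (hRn θ hθ'.1)
  rw [hRd θ hθ'.2] at k3
  have k4 := hsup t htt0
  have k5 := rpow_tangent hp p1 p2
  have k6 := psf_lap hη0 hθ'.2 (hs1 θ hθ'.1) hm0.le hδ0 hη2
  have k7 := hε t htt0
  have k8 := hgs t
  have k9 := psf_ge hη0 hη1 hθ'.2 (hs1 θ hθ'.1) hm0.le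
  have hpotv : FD.pot c K0 p ξ t = m + c ^ 2 - p * K0 * ξ t ^ (p - 1) := by
    unfold FD.pot; rw [hn, hm]
  simp only [hNm, hDn] at hNτ hNpos
  set s : ℝ := inner ℝ e θ with hs
  set ψ := psf η m s with hψ
  set v1 := F (t, θ) with hv1
  set v2 := F (t, R θ) with hv2
  set Q := p * K0 * ξ t ^ (p - 1) with hQ
  set K1 := K (exp (-t) • θ) with hK1
  set K2 := K (exp (-t) • R θ) with hK2
  have hψ0 : 0 < ψ := hη0.trans_le k9
  have hw0 : 0 ≤ v1 - v2 := by
    have : 0 ≤ A * (s * f t) := mul_nonneg hA (mul_nonneg hspos.le (hf0 t htt0))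
    linarith
  have m1 : K1 * (v1 ^ p - v2 ^ p) ≤ (Q + ε t) * (v1 - v2) := by
    calc K1 * (v1 ^ p - v2 ^ p) ≤ K1 * (p * v1 ^ (p - 1) * (v1 - v2)) :=
          mul_le_mul_of_nonneg_left k5 k1.le
      _ = (p * K1 * v1 ^ (p - 1)) * (v1 - v2) := by ring
      _ ≤ _ := mul_le_mul_of_nonneg_right k2 hw0
  have m2 : v1 - v2 = A * (s * f t) + τ * (ψ * g t) := by linarith
  have m3 : τ * ((-m * (s + η * (1 - (m + 1) * s ^ 2))) * g t) ≤ τ * ((-(m - δ) * ψ) * g t) := by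
    have := hgp t
    gcongr
  have m4 : s * (2 * C1 * exp (-t)) ≤
      s * (A * (- f'' t + FD.pot c K0 p ξ t * f t - ε t * f t)) :=
    mul_le_mul_of_nonneg_left k4 hspos.le
  have m5 : 0 < τ * (ψ * (- g'' t + FD.pot c K0 p ξ t * g t - (δ + ε t) * g t)) := by
    refine mul_pos hτ0 (mul_pos hψ0 ?_)
    have : (δ + ε t) * g t ≤ (κ / 2) * g t := by
      have := hgp t
      gcongr; linarith
    have := mul_pos hκ (hgp t)
    linarith
  rw [hpotv] at m4 m5
  -- main inequality
  have m6 : c ^ 2 * (v1 - v2) - (Q + ε t) * (v1 - v2) - C1 * exp (-t) * (2 * s)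
      ≤ A * (s * (f'' t - m * f t)) + τ * (ψ * g'' t) + τ * ((-(m - δ) * ψ) * g t) := by
    have : K1 * v1 ^ p - K2 * v2 ^ p = K1 * (v1 ^ p - v2 ^ p) + (K1 - K2) * v2 ^ p := by ring
    linarith
  rw [m2] at m6
  exact osc_arith m6 m4 m5

end CS

namespace CS
variable {n : ℕ} {c p : ℝ} {K : EuclideanSpace ℝ (Fin n) → ℝ} {ξ : ℝ → ℝ}
    {F : ℝ × EuclideanSpace ℝ (Fin n) → ℝ}

theorem osc_all (h : CS c p K ξ F) {K0 t0 κ C1 A : ℝ} (hp : 1 ≤ p) (hc : 0 < c)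
    (hn : 2 * c + 1 = n - 1) (ht0 : 0 < t0) (hκ : 0 < κ)
    {f f' f'' g g' g'' ε : ℝ → ℝ} (hf : ∀ t, HasDerivAt f (f' t) t ∧ HasDerivAt f' (f'' t) t)
    (hg : ∀ t, HasDerivAt g (g' t) t ∧ HasDerivAt g' (g'' t) t) (hgκ : ∀ t, κ ≤ g t)
    (hgs : ∀ t, κ * g t ≤ - g'' t + FD.pot c K0 p ξ t * g t)
    (hA : 0 ≤ A) (hf0 : ∀ t ≥ t0, 0 ≤ f t) (hε : ∀ t ≥ t0, ε t ≤ κ / 4)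
    (hpot : ∀ t ≥ t0, ∀ θ : EuclideanSpace ℝ (Fin n), ‖θ‖ = 1 → 0 < K (exp (-t) • θ) ∧
      p * K (exp (-t) • θ) * F (t, θ) ^ (p - 1) ≤ p * K0 * ξ t ^ (p - 1) + ε t)
    (hKl : ∀ t ≥ t0, ∀ θ θ' : EuclideanSpace ℝ (Fin n), ‖θ‖ = 1 → ‖θ'‖ = 1 →
      (K (exp (-t) • θ) - K (exp (-t) • θ')) * F (t, θ') ^ p ≤ C1 * exp (-t) * ‖θ - θ'‖)
    (hsup : ∀ t ≥ t0, 2 * C1 * exp (-t) ≤ A * (- f'' t + FD.pot c K0 p ξ t * f t - ε t * f t))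
    (hbd : ∀ θ θ' : EuclideanSpace ℝ (Fin n), ‖θ‖ = 1 → ‖θ'‖ = 1 →
      F (t0, θ) - F (t0, θ') ≤ A * f t0 / 2 * ‖θ - θ'‖) :
    ∀ t ≥ t0, ∀ θ θ' : EuclideanSpace ℝ (Fin n), ‖θ‖ = 1 → ‖θ'‖ = 1 →
      F (t, θ) - F (t, θ') ≤ A * f t := by
  intro t ht θ θ' hθ hθ'
  have hAf : 0 ≤ A * f t := mul_nonneg hA (hf0 t ht)
  by_cases hne : θ = θ'
  · rw [hne, sub_self]; exact hAf
  have hd : 0 < ‖θ - θ'‖ := norm_pos_iff.2 (sub_ne_zero.2 hne)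
  set d := ‖θ - θ'‖ with hdd
  set e : EuclideanSpace ℝ (Fin n) := d⁻¹ • (θ - θ') with hedef
  have he : ‖e‖ = 1 := by
    rw [hedef, norm_smul, norm_inv, norm_eq_abs, abs_of_pos hd, ← hdd, inv_mul_cancel₀ hd.ne']
  have hin : (inner ℝ (θ - θ') θ : ℝ) = d ^ 2 / 2 := by
    have h1 := norm_sub_sq_real θ θ'
    rw [← hdd, hθ, hθ'] at h1
    rw [inner_sub_left, real_inner_self_eq_norm_sq, hθ, real_inner_comm]
    linarith
  have hie : (inner ℝ e θ : ℝ) = d / 2 := by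
    rw [hedef, real_inner_smul_left, hin]; field_simp
  let R : EuclideanSpace ℝ (Fin n) ≃ₗᵢ[ℝ] EuclideanSpace ℝ (Fin n) := (Submodule.span ℝ {e})ᗮ.reflection
  have hR : ∀ x, R x = x - (2 * inner ℝ e x) • e := by
    intro x
    simp only [R]
    rw [Submodule.reflection_orthogonal_apply, Submodule.reflection_singleton_apply, he]
    simp only [RCLike.ofReal_real_eq_id, id, one_pow, div_one]
    rw [neg_sub, two_smul, two_mul, add_smul]
  have hRθ : R θ = θ' := by
    rw [hR, hie, hedef, smul_smul]
    rw [show 2 * (d / 2) * d⁻¹ = 1 by field_simp, one_smul, sub_sub_cancel]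
  have := h.osc_e hp hc hn ht0 hκ hf hg hgκ hgs hA hf0 hε hpot hKl hsup hbd he R hR t ht θ hθ
    (by rw [hie]; positivity)
  rw [hRθ, hie] at this
  have hd2 : d ≤ 2 := by
    have := norm_sub_le θ θ'
    rw [hθ, hθ'] at this
    linarith
  refine this.trans ?_
  have : d / 2 * (A * f t) ≤ 1 * (A * f t) := by gcongr; linarith
  linarith

theorem lip_sphere (h : CS c p K ξ F) {t : ℝ} (ht : 0 < t) : ∃ L ≥ 0,
    ∀ θ θ' : EuclideanSpace ℝ (Fin n), ‖θ‖ = 1 → ‖θ'‖ = 1 → F (t, θ) - F (t, θ') ≤ L * ‖θ - θ'‖ := by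
  have h1 : LocallyLipschitzOn (sphere (0 : EuclideanSpace ℝ (Fin n)) 1) (fun x => F (t, x)) := by
    intro x hx
    have hx0 : x ≠ 0 := by
      rintro rfl; simp at hx
    obtain ⟨L, s, hs, hL⟩ := ((h.contAt_x ht hx0).of_le (m := 1) (by norm_num)).exists_lipschitzOnWith
    exact ⟨L, s, mem_nhdsWithin_of_mem_nhds hs, hL⟩
  obtain ⟨L, hL⟩ := h1.exists_lipschitzOnWith_of_compact (isCompact_sphere _ _)
  refine ⟨L, L.2, fun θ θ' hθ hθ' => ?_⟩
  have := hL.dist_le_mul θ (by simpa using hθ) θ' (by simpa using hθ')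
  rw [dist_eq_norm, dist_eq_norm] at this
  exact (le_abs_self _).trans this

theorem data (h : CS c p K ξ F) {ξ' : ℝ → ℝ} {T : ℝ} (hF : FD c (K 0) p ξ ξ' T)
    (hK : ContDiffOn ℝ 1 K (ball 0 1)) (hKp : ∀ x ∈ ball (0 : EuclideanSpace ℝ (Fin n)) 1, 0 < K x) :
    ∃ a > 0, ∃ b > a, ∃ C1 > 0, ∃ C2 > 0, ∃ T0 ≥ 1, (∀ t, ξ t ∈ Icc a b) ∧
    ∀ t ≥ T0, ∀ θ : EuclideanSpace ℝ (Fin n), ‖θ‖ = 1 →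
      F (t, θ) ∈ Icc a b ∧ 0 < K (exp (-t) • θ) ∧ |K (exp (-t) • θ) - K 0| ≤ C1 * exp (-t) ∧
      (p * K (exp (-t) • θ) * F (t, θ) ^ (p - 1) ≤ p * K 0 * ξ t ^ (p - 1)
        + C2 * (exp (-t) + |F (t, θ) - ξ t|)) ∧
      ∀ θ' : EuclideanSpace ℝ (Fin n), ‖θ'‖ = 1 →
        |K (exp (-t) • θ) - K (exp (-t) • θ')| ≤ C1 * exp (-t) * ‖θ - θ'‖ := by
  obtain ⟨a, ha, b, hb, hr, hr'⟩ := hF.range'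
  have hp1 := hF.p_gt
  have hK0 := hF.hK
  obtain ⟨L, s, hs, hL⟩ := (hK.contDiffAt (ball_mem_nhds 0 one_pos)).exists_lipschitzOnWith
  obtain ⟨r, hr0, hrs⟩ := Metric.mem_nhds_iff.1 hs
  obtain ⟨Lq, hLq, hq⟩ := rpow_lip (p - 1) (b := b) ha
  obtain ⟨B, hB⟩ := h.conv a ha
  have e1 : ∀ᶠ t : ℝ in atTop, exp (-t) < r := (tendsto_exp_neg_atTop_nhds_zero).eventually_lt_const hr0
  obtain ⟨T1, hT1⟩ := eventually_atTop.1 e1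
  have hbp : 0 < b ^ (p - 1) := rpow_pos_of_pos (ha.trans hb) _
  refine ⟨a, ha, b, hb, L + 1, by positivity, p * (L + 1) * b ^ (p - 1) + p * K 0 * Lq, by positivity,
    max 1 (max B T1), le_max_left _ _, hr, fun t ht θ hθ => ?_⟩
  have ht1 : 1 ≤ t := (le_max_left _ _).trans ht
  have htB : B ≤ t := (le_max_left _ _).trans ((le_max_right _ _).trans ht)
  have htT : T1 ≤ t := (le_max_right _ _).trans ((le_max_right _ _).trans ht)
  have hE := exp_pos (-t)
  have hnorm : ∀ x : EuclideanSpace ℝ (Fin n), ‖x‖ = 1 → ‖exp (-t) • x‖ = exp (-t) := by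
    intro x hx; rw [norm_smul, hx, mul_one, norm_eq_abs, abs_of_pos hE]
  have hmem : ∀ x : EuclideanSpace ℝ (Fin n), ‖x‖ = 1 → exp (-t) • x ∈ s := by
    intro x hx
    exact hrs (by rw [mem_ball_zero_iff, hnorm x hx]; exact hT1 t htT)
  have hFm := hr' t _ (hB t htB θ hθ).le
  have k1 : |K (exp (-t) • θ) - K 0| ≤ (L + 1) * exp (-t) := by
    have := hL.dist_le_mul _ (hmem θ hθ) 0 (hrs (mem_ball_self hr0))
    rw [dist_eq_norm, dist_eq_norm, sub_zero, hnorm θ hθ] at this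
    refine this.trans ?_
    gcongr; linarith
  refine ⟨hFm, ?_, k1, ?_, ?_⟩
  · refine hKp _ ?_
    rw [mem_ball_zero_iff, hnorm θ hθ]
    rw [exp_lt_one_iff]; linarith
  · have k2 := hq _ hFm _ (hr t)
    have hF0 : 0 < F (t, θ) := ha.trans_le hFm.1
    have k3 : F (t, θ) ^ (p - 1) ≤ b ^ (p - 1) := rpow_le_rpow hF0.le hFm.2 (by linarith)
    have k4 : (K (exp (-t) • θ) - K 0) * F (t, θ) ^ (p - 1) ≤ (L + 1) * exp (-t) * b ^ (p - 1) :=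
      mul_le_mul ((le_abs_self _).trans k1) k3 (rpow_nonneg hF0.le _) (by positivity)
    have k5 : p * K 0 * (F (t, θ) ^ (p - 1) - ξ t ^ (p - 1)) ≤ p * K 0 * (Lq * |F (t, θ) - ξ t|) := by
      have := (le_abs_self _).trans k2
      gcongr
    have k6 : p * ((K (exp (-t) • θ) - K 0) * F (t, θ) ^ (p - 1)) ≤ p * ((L + 1) * exp (-t) * b ^ (p - 1)) := by
      gcongr
    have x1 : 0 ≤ p * (L + 1) * b ^ (p - 1) * |F (t, θ) - ξ t| := by positivity
    have x2 : 0 ≤ p * K 0 * Lq * exp (-t) := by positivity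
    linarith
  · intro θ' hθ'
    have := hL.dist_le_mul _ (hmem θ hθ) _ (hmem θ' hθ')
    rw [dist_eq_norm, dist_eq_norm, ← smul_sub, norm_smul, norm_of_nonneg hE.le] at this
    refine this.trans ?_
    have : 0 ≤ exp (-t) * ‖θ - θ'‖ := by positivity
    linarith

end CS

namespace CS
variable {n : ℕ} {c p : ℝ} {K : EuclideanSpace ℝ (Fin n) → ℝ} {ξ : ℝ → ℝ}
    {F : ℝ × EuclideanSpace ℝ (Fin n) → ℝ}

/-- Common part of the two passes. -/
theorem pass (h : CS c p K ξ F) {ξ' : ℝ → ℝ} {T : ℝ} (hF : FD c (K 0) p ξ ξ' T)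
    (hn : 2 * c + 1 = n - 1)
    (hK : ContDiffOn ℝ 1 K (ball 0 1)) (hKp : ∀ x ∈ ball (0 : EuclideanSpace ℝ (Fin n)) 1, 0 < K x)
    {f f' f'' D : ℝ → ℝ} (hf : ∀ t, HasDerivAt f (f' t) t ∧ HasDerivAt f' (f'' t) t)
    {μ : ℝ} (hμ : 0 < μ)
    (hD0 : Tendsto D atTop (nhds 0))
    (hD : ∀ᶠ t in atTop, ∀ θ : EuclideanSpace ℝ (Fin n), ‖θ‖ = 1 → |F (t, θ) - ξ t| ≤ D t)
    (hf0 : ∀ᶠ t in atTop, 0 < f t)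
    (hs : ∀ C2 > 0, ∀ᶠ t in atTop, μ * exp (-t) ≤ - f'' t + FD.pot c (K 0) p ξ t * f t
      - C2 * (exp (-t) + D t) * f t) :
    ∃ A ≥ 0, ∃ t₁, ∀ t ≥ t₁, ∀ θ θ' : EuclideanSpace ℝ (Fin n), ‖θ‖ = 1 → ‖θ'‖ = 1 →
      |F (t, θ) - F (t, θ')| ≤ A * f t := by
  obtain ⟨κ, hκ, g, g', g'', hg, hgκ, hgs⟩ := hF.bar_one
  obtain ⟨a, ha, b, hb, C1, hC1, C2, hC2, T0, hT0, hr, H⟩ := h.data hF hK hKp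
  have hp1 := hF.p_gt
  have hbp : 0 < b ^ p := rpow_pos_of_pos (ha.trans hb) _
  have he : Tendsto (fun t => C2 * (exp (-t) + D t)) atTop (nhds 0) := by
    simpa using (tendsto_exp_neg_atTop_nhds_zero.add hD0).const_mul C2
  have he2 : ∀ᶠ t in atTop, C2 * (exp (-t) + D t) ≤ κ / 4 := by
    filter_upwards [he.eventually_lt_const (show (0 : ℝ) < κ / 4 by positivity)] with t ht using ht.le
  obtain ⟨t0, ht0⟩ := eventually_atTop.1
    ((eventually_ge_atTop T0).and (hD.and (hf0.and ((hs C2 hC2).and he2))))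
  have ht00 : 0 < t0 := by linarith [(ht0 t0 le_rfl).1]
  have hft0 : 0 < f t0 := (ht0 t0 le_rfl).2.2.1
  obtain ⟨L, hL, hLip⟩ := h.lip_sphere ht00
  have hA : 0 ≤ 2 * (C1 * b ^ p) / μ + 2 * L / f t0 := by positivity
  have main := h.osc_all (K0 := K 0) (t0 := t0) (κ := κ) (C1 := C1 * b ^ p)
    (A := 2 * (C1 * b ^ p) / μ + 2 * L / f t0) (ε := fun t => C2 * (exp (-t) + D t)) hp1.le hF.hc hn ht00 hκ hf hg hgκ hgs
    hA (fun t ht => (ht0 t ht).2.2.1.le) (fun t ht => (ht0 t ht).2.2.2.2) ?_ ?_ ?_ ?_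
  · refine ⟨_, hA, t0, fun t ht θ θ' hθ hθ' => abs_le.2 ⟨?_, main t ht θ θ' hθ hθ'⟩⟩
    linarith [main t ht θ' θ hθ' hθ]
  · intro t ht θ hθ
    obtain ⟨-, h2, -, h4, -⟩ := H t (ht0 t ht).1 θ hθ
    refine ⟨h2, h4.trans ?_⟩
    have := (ht0 t ht).2.1 θ hθ
    gcongr
  · intro t ht θ θ' hθ hθ'
    obtain ⟨-, -, -, -, h5⟩ := H t (ht0 t ht).1 θ hθ
    obtain ⟨h6, -⟩ := H t (ht0 t ht).1 θ' hθ'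
    have h7 := (le_abs_self _).trans (h5 θ' hθ')
    have hF0 : 0 < F (t, θ') := ha.trans_le h6.1
    have h8 : F (t, θ') ^ p ≤ b ^ p := rpow_le_rpow hF0.le h6.2 (by linarith)
    have h9 := mul_le_mul h7 h8 (rpow_nonneg hF0.le _) (by positivity)
    linarith
  · intro t ht
    have h1 := (ht0 t ht).2.2.2.1
    have h2 := exp_pos (-t)
    calc 2 * (C1 * b ^ p) * exp (-t) = 2 * (C1 * b ^ p) / μ * (μ * exp (-t)) := by field_simp
      _ ≤ (2 * (C1 * b ^ p) / μ + 2 * L / f t0) * (μ * exp (-t)) := by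
          gcongr
          have : 0 ≤ 2 * L / f t0 := by positivity
          linarith
      _ ≤ _ := by gcongr
  · intro θ θ' hθ hθ'
    refine (hLip θ θ' hθ hθ').trans ?_
    gcongr
    rw [add_mul, div_mul_cancel₀ _ hft0.ne']
    have : 0 ≤ 2 * (C1 * b ^ p) / μ * f t0 := by positivity
    linarith

theorem pass1 (h : CS c p K ξ F) {ξ' : ℝ → ℝ} {T : ℝ} (hF : FD c (K 0) p ξ ξ' T)
    (hn : 2 * c + 1 = n - 1)
    (hK : ContDiffOn ℝ 1 K (ball 0 1)) (hKp : ∀ x ∈ ball (0 : EuclideanSpace ℝ (Fin n)) 1, 0 < K x)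
    {D : ℝ → ℝ} (hD0 : Tendsto D atTop (nhds 0))
    (hD : ∀ᶠ t in atTop, ∀ θ : EuclideanSpace ℝ (Fin n), ‖θ‖ = 1 → |F (t, θ) - ξ t| ≤ D t) :
    ∃ A ≥ 0, ∃ t₁, ∀ t ≥ t₁, ∀ θ θ' : EuclideanSpace ℝ (Fin n), ‖θ‖ = 1 → ‖θ'‖ = 1 →
      |F (t, θ) - F (t, θ')| ≤ A * mf (1 / 2) t := by
  obtain ⟨κ, hκ, C, hC, f, f', f'', hf, hfb, hfs⟩ := hF.bar_half
  have hfp : ∀ t, 0 < f t := fun t => lt_of_lt_of_le (by positivity) (hfb t).1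
  obtain ⟨A, hA, t₁, H⟩ := h.pass hF hn hK hKp hf (μ := κ / 2 * κ) (by positivity) hD0 hD
    (Eventually.of_forall hfp) (by
      intro C2 hC2
      have he : Tendsto (fun t => C2 * (exp (-t) + D t)) atTop (nhds 0) := by
        simpa using (tendsto_exp_neg_atTop_nhds_zero.add hD0).const_mul C2
      filter_upwards [he.eventually_lt_const (show (0 : ℝ) < κ / 2 by positivity), eventually_ge_atTop 0] with t ht ht0
      have h1 : C2 * (exp (-t) + D t) * f t ≤ κ / 2 * f t := by
        have := hfp t
        gcongr
      have h2 : κ * exp (-t) ≤ κ * exp (-t / 2) := by gcongr; linarith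
      have h3 : κ / 2 * (κ * exp (-t)) ≤ κ / 2 * f t := by
        gcongr; exact h2.trans (hfb t).1
      linarith [hfs t])
  refine ⟨A * C, by positivity, max t₁ 1, fun t ht θ θ' hθ hθ' =>
    (H t ((le_max_left _ _).trans ht) θ θ' hθ hθ').trans ?_⟩
  have ht1 : 1 ≤ t := (le_max_right _ _).trans ht
  rw [mul_assoc]
  gcongr
  refine (hfb t).2.trans ?_
  unfold mf
  gcongr
  rw [show -t / 2 = -(1 / 2) * t by ring]
  exact le_mul_of_one_le_left (exp_pos _).le ht1

theorem pass2 (h : CS c p K ξ F) {ξ' : ℝ → ℝ} {T : ℝ} (hF : FD c (K 0) p ξ ξ' T)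
    (hn : 2 * c + 1 = n - 1)
    (hK : ContDiffOn ℝ 1 K (ball 0 1)) (hKp : ∀ x ∈ ball (0 : EuclideanSpace ℝ (Fin n)) 1, 0 < K x)
    {C3 : ℝ}
    (hD : ∀ᶠ t in atTop, ∀ θ : EuclideanSpace ℝ (Fin n), ‖θ‖ = 1 → |F (t, θ) - ξ t| ≤ C3 * mf (1 / 2) t) :
    ∃ A ≥ 0, ∃ t₁, ∀ t ≥ t₁, ∀ θ θ' : EuclideanSpace ℝ (Fin n), ‖θ‖ = 1 → ‖θ'‖ = 1 →
      |F (t, θ) - F (t, θ')| ≤ A * mf 1 t := by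
  obtain ⟨κ, hκ, C, hC, t₁', ht₁', f, f', f'', hf, hfb, hfs⟩ := hF.bar_log
  have hD0 : Tendsto (fun t => C3 * mf (1 / 2) t) atTop (nhds 0) := by
    simpa using (mf_tendsto (γ := 1 / 2) (by norm_num)).const_mul C3
  obtain ⟨A, hA, t₁, H⟩ := h.pass hF hn hK hKp hf (μ := κ / 2) (by positivity) hD0 hD
    (by filter_upwards [eventually_ge_atTop t₁'] with t ht using (hfb t ht).1) (by
      intro C2 hC2
      have q1 : Tendsto (fun t : ℝ => t * exp (-t)) atTop (nhds 0) := by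
        refine (mf_tendsto (γ := 1) one_pos).congr fun t => ?_
        simp [mf]
      have q2 : Tendsto (fun t : ℝ => t * mf (1 / 2) t) atTop (nhds 0) := by
        refine (tendsto_rpow_mul_exp_neg_mul_atTop_nhds_zero 2 (1 / 2) (by norm_num)).congr fun t => ?_
        simp [mf]; ring
      have he : Tendsto (fun t => C2 * C * (t * exp (-t) + C3 * (t * mf (1 / 2) t))) atTop (nhds 0) := by
        simpa using (q1.add (q2.const_mul C3)).const_mul (C2 * C)
      have he3 : Tendsto (fun t => C2 * C * (t * exp (-t) + |C3| * (t * mf (1 / 2) t))) atTop (nhds 0) := by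
        simpa using (q1.add (q2.const_mul |C3|)).const_mul (C2 * C)
      filter_upwards [he3.eventually_lt_const (show (0 : ℝ) < κ / 2 by positivity), eventually_ge_atTop t₁'] with t ht ht0
      have hE := exp_pos (-t)
      have hm : 0 ≤ mf (1 / 2) t := mf_nonneg (by linarith)
      have h1 : C2 * (exp (-t) + C3 * mf (1 / 2) t) * f t
          ≤ C2 * (exp (-t) + |C3| * mf (1 / 2) t) * (C * (t * exp (-t))) := by
        have := (hfb t ht0).1.le
        have := (hfb t ht0).2
        gcongr
        exact le_abs_self _
      have h2 : C2 * C * (t * exp (-t) + |C3| * (t * mf (1 / 2) t)) * exp (-t) ≤ κ / 2 * exp (-t) := by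
        gcongr
      linarith [hfs t])
  refine ⟨A * C, by positivity, max t₁ t₁', fun t ht θ θ' hθ hθ' =>
    (H t ((le_max_left _ _).trans ht) θ θ' hθ hθ').trans ?_⟩
  have ht1 : t₁' ≤ t := (le_max_right _ _).trans ht
  rw [mul_assoc]
  gcongr
  refine (hfb t ht1).2.trans (le_of_eq ?_)
  simp [mf]

end CS

section
open MeasureTheory
variable {n : ℕ}

/-- closed annulus -/
def Ann (n : ℕ) : Set (EuclideanSpace ℝ (Fin n)) := closedBall 0 2 \ ball 0 (1 / 2)

theorem Ann_compact : IsCompact (Ann n) := by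
  unfold Ann
  exact (isCompact_closedBall _ _).diff isOpen_ball

theorem Ann_ne {x : EuclideanSpace ℝ (Fin n)} (hx : x ∈ Ann n) : x ≠ 0 := by
  rintro rfl
  exact hx.2 (mem_ball_self (by norm_num))

theorem wt_cont {w P : EuclideanSpace ℝ (Fin n) → ℝ} (hw : Continuous w) (hs : tsupport w ⊆ Ann n)
    (hP : ContinuousOn P {x | x ≠ 0}) : Continuous (fun x => w x * P x) := by
  rw [continuous_iff_continuousAt]
  intro x
  by_cases hx : x ∈ tsupport w
  · have : ContinuousAt P x := hP.continuousAt (isOpen_ne.mem_nhds (Ann_ne (hs hx)))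
    exact hw.continuousAt.mul this
  · have h1 := notMem_tsupport_iff_eventuallyEq.1 hx
    have h2 : (fun x => w x * P x) =ᶠ[nhds x] fun _ => 0 := by
      filter_upwards [h1] with z hz
      rw [hz]; simp
    exact (continuousAt_const (y := (0 : ℝ))).congr h2.symm

theorem wt_comp {w : EuclideanSpace ℝ (Fin n) → ℝ} (hs : tsupport w ⊆ Ann n) : HasCompactSupport w :=
  Ann_compact.of_isClosed_subset (isClosed_tsupport _) hs

theorem wt_int {w P : EuclideanSpace ℝ (Fin n) → ℝ} (hw : Continuous w) (hs : tsupport w ⊆ Ann n)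
    (hP : ContinuousOn P {x | x ≠ 0}) : Integrable (fun x => w x * P x) :=
  (wt_cont hw hs hP).integrable_of_hasCompactSupport ((wt_comp hs).mul_right)

theorem hom_deriv {u : EuclideanSpace ℝ (Fin n) → ℝ} (hu : ∀ x (r : ℝ), 0 < r → u (r • x) = u x)
    (hreg : ContDiffOn ℝ 2 u {x | x ≠ 0}) {x : EuclideanSpace ℝ (Fin n)} (hx : x ≠ 0) :
    fderiv ℝ u x x = 0 := by
  have h1 : HasFDerivAt u (fderiv ℝ u x) x :=
    ((hreg.contDiffAt (isOpen_ne.mem_nhds hx)).differentiableAt (by simp)).hasFDerivAt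
  have h2 : HasDerivAt (fun r : ℝ => r • x) x 1 := by
    simpa using (hasDerivAt_id (1 : ℝ)).smul_const x
  have h3 : HasDerivAt (fun r : ℝ => u (r • x)) (fderiv ℝ u x x) 1 := by
    have h1' : HasFDerivAt u (fderiv ℝ u x) ((1 : ℝ) • x) := by rwa [one_smul]
    exact h1'.comp_hasDerivAt (1 : ℝ) h2
  have h4 : HasDerivAt (fun r : ℝ => u (r • x)) 0 1 := by
    refine (hasDerivAt_const (1 : ℝ) (u x)).congr_of_eventuallyEq ?_
    filter_upwards [lt_mem_nhds (show (0 : ℝ) < 1 by norm_num)] with r hr using hu x r hr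
  exact h3.unique h4

theorem hom_lap {u : EuclideanSpace ℝ (Fin n) → ℝ} (hu : ∀ x (r : ℝ), 0 < r → u (r • x) = u x)
    {x : EuclideanSpace ℝ (Fin n)} {r : ℝ} (hr : 0 < r) :
    r ^ 2 * lapE u (r • x) = lapE u x := by
  have hu1 : (fun x => u (r • x)) = u := funext fun x => hu x r hr
  have h1 : fderiv ℝ u = fun x => r • fderiv ℝ u (r • x) := by
    funext x
    conv_lhs => rw [← hu1]
    rw [fderiv_comp_smul]
  have h2 : fderiv ℝ (fderiv ℝ u) x = r • r • fderiv ℝ (fderiv ℝ u) (r • x) := by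
    conv_lhs => rw [h1]
    have := fderiv_comp_smul (𝕜 := ℝ) (f := fderiv ℝ u) (x := x) r
    have h3 := congrFun (fderiv_const_smul_field (𝕜 := ℝ) (f := fun x => fderiv ℝ u (r • x)) r) x
    exact h3.trans (by rw [Pi.smul_apply, this])
  unfold lapE
  rw [Finset.mul_sum]
  refine Finset.sum_congr rfl fun i _ => ?_
  rw [iteratedFDeriv_two_apply, iteratedFDeriv_two_apply, h2]
  simp
  ring

/-- integration by parts against a radial weight -/
theorem lap_int {u : EuclideanSpace ℝ (Fin n) → ℝ} (hu : ∀ x (r : ℝ), 0 < r → u (r • x) = u x)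
    (hreg : ContDiffOn ℝ 2 u {x | x ≠ 0}) {G G' : ℝ → ℝ} (hG : ∀ s, HasDerivAt G (G' s) s)
    (hG' : Continuous G')
    (hs : tsupport (fun x : EuclideanSpace ℝ (Fin n) => G (‖x‖ ^ 2)) ⊆ Ann n) :
    ContinuousOn (lapE u) {x | x ≠ 0} ∧ ∫ x, G (‖x‖ ^ 2) * lapE u x = 0 := by
  set ψ : EuclideanSpace ℝ (Fin n) → ℝ := fun x => G (‖x‖ ^ 2) with hψ
  have hGc : Continuous G := continuous_iff_continuousAt.2 fun t => (hG t).continuousAt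
  have hψc : Continuous ψ := by fun_prop
  have hψd : ∀ x, HasFDerivAt ψ (G' (‖x‖ ^ 2) • (2 • innerSL ℝ x)) x := by
    intro x
    exact (hG (‖x‖ ^ 2)).comp_hasFDerivAt x (hasStrictFDerivAt_norm_sq x).hasFDerivAt
  have hcd : ∀ x : EuclideanSpace ℝ (Fin n), x ≠ 0 → ContDiffAt ℝ 2 u x := fun x hx =>
    hreg.contDiffAt (isOpen_ne.mem_nhds hx)
  have hcd1 : ∀ x : EuclideanSpace ℝ (Fin n), x ≠ 0 → ContDiffAt ℝ 1 (fderiv ℝ u) x := fun x hx =>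
    (hcd x hx).fderiv_right (by norm_num)
  have hcd0 : ∀ x : EuclideanSpace ℝ (Fin n), x ≠ 0 → ContDiffAt ℝ 0 (fderiv ℝ (fderiv ℝ u)) x := fun x hx =>
    (hcd1 x hx).fderiv_right (by norm_num)
  have hsec : ∀ b, ContinuousOn (fun x => fderiv ℝ (fderiv ℝ u) x b b) {x | x ≠ 0} := by
    intro b x hx
    have := (hcd0 x hx).continuousAt
    exact ((this.clm_apply continuousAt_const).clm_apply continuousAt_const).continuousWithinAt
  have hfir : ∀ b, ContinuousOn (fun x => fderiv ℝ u x b) {x | x ≠ 0} := by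
    intro b x hx
    have := (hcd1 x hx).continuousAt
    exact (this.clm_apply continuousAt_const).continuousWithinAt
  have hlap : ∀ x, lapE u x = ∑ i : Fin n, fderiv ℝ (fderiv ℝ u) x (EuclideanSpace.single i 1)
      (EuclideanSpace.single i 1) := by
    intro x
    unfold lapE
    refine Finset.sum_congr rfl fun i _ => ?_
    rw [iteratedFDeriv_two_apply]; rfl
  have hψ' : ∀ b x, fderiv ℝ ψ x b = 2 * G' (‖x‖ ^ 2) * inner ℝ x b := by
    intro b x
    rw [(hψd x).fderiv]
    simp [innerSL_apply_apply]
    ring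
  have hw' : ∀ b, Continuous (fun x => fderiv ℝ ψ x b) := by
    intro b
    simp only [hψ']
    fun_prop
  have hs' : ∀ b, tsupport (fun x => fderiv ℝ ψ x b) ⊆ Ann n := by
    intro b
    exact (tsupport_fderiv_apply_subset ℝ b).trans hs
  have hibp : ∀ b, ∫ x, ψ x * fderiv ℝ (fderiv ℝ u) x b b = - ∫ x, fderiv ℝ ψ x b * fderiv ℝ u x b := by
    intro b
    have hf2 : ∀ x, ψ x * fderiv ℝ (fun x => fderiv ℝ u x b) x b = ψ x * fderiv ℝ (fderiv ℝ u) x b b := by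
      intro x
      by_cases hx : x ∈ tsupport ψ
      · have hx0 := Ann_ne (hs hx)
        have := ((hcd1 x hx0).differentiableAt (by simp)).hasFDerivAt.clm_apply (hasFDerivAt_const b x)
        rw [this.fderiv]
        simp
      · rw [image_eq_zero_of_notMem_tsupport hx]; simp
    rw [← integral_mul_fderiv_eq_neg_fderiv_mul_of_integrable]
    · exact integral_congr_ae (Eventually.of_forall fun x => (hf2 x).symm)
    · exact wt_int (hw' b) (hs' b) (hfir b)
    · simp only [hf2]
      exact wt_int hψc hs (hsec b)
    · exact wt_int hψc hs (hfir b)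
    · exact fun x _ => (hψd x).differentiableAt
    · intro x hx
      exact ((hcd1 x (Ann_ne (hs hx))).differentiableAt (by simp)).clm_apply (differentiableAt_const _)
  constructor
  · simp only [funext hlap]
    exact continuousOn_finsetSum _ fun i _ => hsec _
  · simp only [hlap, Finset.mul_sum]
    rw [integral_finsetSum _ fun i _ => wt_int hψc hs (hsec _)]
    simp only [hibp]
    rw [Finset.sum_neg_distrib, ← integral_finsetSum _ fun i _ => wt_int (hw' _) (hs' _) (hfir _)]
    rw [neg_eq_zero]
    refine integral_eq_zero_of_ae (Eventually.of_forall fun x => ?_)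
    simp only [Pi.zero_apply]
    have e1 : ∑ i : Fin n, fderiv ℝ ψ x (EuclideanSpace.single i 1) * fderiv ℝ u x (EuclideanSpace.single i 1)
        = 2 * G' (‖x‖ ^ 2) * fderiv ℝ u x x := by
      have e2 : x = ∑ i : Fin n, (x i) • (EuclideanSpace.single i (1 : ℝ)) := by
        have := (EuclideanSpace.basisFun (Fin n) ℝ).sum_repr x
        simpa using this.symm
      have e3 : fderiv ℝ u x x = ∑ i : Fin n, (x i) * fderiv ℝ u x (EuclideanSpace.single i (1 : ℝ)) := by
        conv_lhs => rw [show fderiv ℝ u x x = fderiv ℝ u x (∑ i : Fin n, (x i) • (EuclideanSpace.single i (1 : ℝ))) by rw [← e2]]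
        rw [map_sum]
        simp
      rw [e3, Finset.mul_sum]
      refine Finset.sum_congr rfl fun i _ => ?_
      rw [hψ']
      simp [EuclideanSpace.inner_single_right]
      ring
    rw [e1]
    by_cases hx : x = 0
    · rw [hx]; simp
    · rw [hom_deriv hu hreg hx, mul_zero]

end

section
open MeasureTheory
variable {n : ℕ}

def UU (n : ℕ) : Set (ℝ × EuclideanSpace ℝ (Fin n)) := Ioi 0 ×ˢ {x | x ≠ 0}

theorem UU_open : IsOpen (UU n) := isOpen_Ioi.prod isOpen_ne

theorem tder_reg {m : WithTop ℕ∞} {G : ℝ × EuclideanSpace ℝ (Fin n) → ℝ} (hG : ContDiffOn ℝ (m + 1) G (UU n)) :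
    ContDiffOn ℝ m (fun z => deriv (fun s => G (s, z.2)) z.1) (UU n) ∧
    ∀ t > 0, ∀ x : EuclideanSpace ℝ (Fin n), x ≠ 0 →
      HasDerivAt (fun s => G (s, x)) (deriv (fun s => G (s, x)) t) t := by
  have hd : ∀ z ∈ UU n, HasDerivAt (fun s => G (s, z.2)) (fderiv ℝ G z (1, 0)) z.1 := by
    intro z hz
    have h1 := ((hG.contDiffAt (UU_open.mem_nhds hz)).differentiableAt (by simp)).hasFDerivAt
    have h2 : HasDerivAt (fun s : ℝ => (s, z.2)) ((1 : ℝ), (0 : EuclideanSpace ℝ (Fin n))) z.1 :=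
      (hasDerivAt_id z.1).prodMk (hasDerivAt_const _ _)
    exact HasFDerivAt.comp_hasDerivAt (f := fun s : ℝ => (s, z.2)) z.1 h1 h2
  constructor
  · have h1 : ContDiffOn ℝ m (fun z => fderiv ℝ G z (1, 0)) (UU n) :=
      (hG.fderiv_of_isOpen UU_open le_rfl).clm_apply contDiffOn_const
    exact h1.congr fun z hz => (hd z hz).deriv
  · intro t ht x hx
    exact (hd (t, x) ⟨ht, hx⟩).differentiableAt.hasDerivAt

theorem int_deriv {w : EuclideanSpace ℝ (Fin n) → ℝ} (hw : Continuous w) (hs : tsupport w ⊆ Ann n)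
    {G G1 : ℝ × EuclideanSpace ℝ (Fin n) → ℝ} (hG : ContinuousOn G (UU n)) (hG1 : ContinuousOn G1 (UU n))
    (hd : ∀ t > 0, ∀ x : EuclideanSpace ℝ (Fin n), x ≠ 0 → HasDerivAt (fun s => G (s, x)) (G1 (t, x)) t)
    {t : ℝ} (ht : 0 < t) :
    HasDerivAt (fun s => ∫ x, w x * G (s, x)) (∫ x, w x * G1 (t, x)) t := by
  have hsl : ∀ {H : ℝ × EuclideanSpace ℝ (Fin n) → ℝ}, ContinuousOn H (UU n) → ∀ s > 0,
      ContinuousOn (fun x => H (s, x)) {x | x ≠ 0} := by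
    intro H hH s hs
    exact hH.comp (by fun_prop) fun x hx => ⟨hs, hx⟩
  have hcomp : IsCompact (Icc (t / 2) (t + 1) ×ˢ Ann n) := isCompact_Icc.prod Ann_compact
  have hsub : Icc (t / 2) (t + 1) ×ˢ Ann n ⊆ UU n := by
    rintro ⟨s, x⟩ ⟨h1, h2⟩
    exact ⟨by have := h1.1; simp only [mem_Ioi]; linarith, Ann_ne h2⟩
  obtain ⟨M, hM⟩ := hcomp.exists_bound_of_continuousOn (hG1.mono hsub)
  refine (hasDerivAt_integral_of_dominated_loc_of_deriv_le (F := fun s x => w x * G (s, x))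
    (F' := fun s x => w x * G1 (s, x)) (bound := fun x => |w x| * M) (s := Ioo (t / 2) (t + 1))
    (Ioo_mem_nhds (by linarith) (by linarith)) ?_ (wt_int hw hs (hsl hG t ht))
    (wt_int hw hs (hsl hG1 t ht)).aestronglyMeasurable ?_ ?_ ?_).2
  · filter_upwards [lt_mem_nhds ht] with s h0
    exact (wt_int hw hs (hsl hG s h0)).aestronglyMeasurable
  · refine Eventually.of_forall fun x s hs' => ?_
    rw [norm_mul, norm_eq_abs]
    by_cases hx : x ∈ tsupport w
    · exact mul_le_mul_of_nonneg_left (hM (s, x) ⟨⟨hs'.1.le, hs'.2.le⟩, hs hx⟩) (abs_nonneg _)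
    · rw [image_eq_zero_of_notMem_tsupport hx]; simp
  · refine Integrable.mul_const ?_ M
    exact (hw.integrable_of_hasCompactSupport (wt_comp hs)).abs
  · refine Eventually.of_forall fun x s hs' => ?_
    by_cases hx : x ∈ tsupport w
    · exact (hd s (by linarith [hs'.1]) x (Ann_ne (hs hx))).const_mul _
    · rw [image_eq_zero_of_notMem_tsupport hx]; simpa using hasDerivAt_const s (0 : ℝ)

theorem avg_close {w P : EuclideanSpace ℝ (Fin n) → ℝ} (hw : Continuous w) (hs : tsupport w ⊆ Ann n)
    (hw0 : ∀ x, 0 ≤ w x) (hw1 : ∫ x, w x = 1) (hP : ContinuousOn P {x | x ≠ 0}) {k M : ℝ}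
    (hk : ∀ x, x ≠ 0 → |P x - k| ≤ M) : |(∫ x, w x * P x) - k| ≤ M := by
  have hwi : Integrable w := hw.integrable_of_hasCompactSupport (wt_comp hs)
  have h1 : (∫ x, w x * P x) - k = ∫ x, (w x * P x - w x * k) := by
    rw [integral_sub (wt_int hw hs hP) (hwi.mul_const k), integral_mul_const, hw1, one_mul]
  have h2 : ∫ x, w x * M = M := by rw [integral_mul_const, hw1, one_mul]
  rw [h1, ← norm_eq_abs]
  refine (norm_integral_le_of_norm_le (μ := volume) (f := fun x => w x * P x - w x * k) (hwi.mul_const M) (Eventually.of_forall fun x => ?_)).trans_eq h2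
  by_cases hx : x ∈ tsupport w
  · rw [← mul_sub, norm_mul, norm_of_nonneg (hw0 x)]
    exact mul_le_mul_of_nonneg_left (hk x (Ann_ne (hs hx))) (hw0 x)
  · rw [image_eq_zero_of_notMem_tsupport hx]; simp

theorem exists_weight (hn : 0 < n) : ∃ B G' : ℝ → ℝ, Continuous B ∧
    (∀ s, HasDerivAt (fun s => s * B s) (G' s) s) ∧ Continuous G' ∧ (∀ s, 0 ≤ B s) ∧
    tsupport (fun x : EuclideanSpace ℝ (Fin n) => B (‖x‖ ^ 2)) ⊆ Ann n ∧
    tsupport (fun x : EuclideanSpace ℝ (Fin n) => ‖x‖ ^ 2 * B (‖x‖ ^ 2)) ⊆ Ann n ∧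
    ∫ x : EuclideanSpace ℝ (Fin n), B (‖x‖ ^ 2) = 1 := by
  let b : ContDiffBump (1 : ℝ) := ⟨1 / 4, 1 / 2, by norm_num, by norm_num⟩
  have hbc : Continuous b := b.continuous
  have hAcl : IsClosed (Ann n) := Ann_compact.isClosed
  have hsupp : ∀ x : EuclideanSpace ℝ (Fin n), b (‖x‖ ^ 2) ≠ 0 → x ∈ Ann n := by
    intro x hx
    have h1 : ‖x‖ ^ 2 ∈ support b := hx
    rw [b.support_eq, mem_ball, dist_eq, abs_lt] at h1
    have h2 : b.rOut = 1 / 2 := rfl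
    rw [h2] at h1
    refine ⟨?_, ?_⟩
    · rw [mem_closedBall_zero_iff]; nlinarith [norm_nonneg x]
    · rw [mem_ball_zero_iff]; intro h3; nlinarith [norm_nonneg x]
  have hs1 : tsupport (fun x : EuclideanSpace ℝ (Fin n) => b (‖x‖ ^ 2)) ⊆ Ann n :=
    closure_minimal hsupp hAcl
  have hc0 : Continuous (fun x : EuclideanSpace ℝ (Fin n) => b (‖x‖ ^ 2)) := by fun_prop
  have hZ : 0 < ∫ x : EuclideanSpace ℝ (Fin n), b (‖x‖ ^ 2) := by
    refine hc0.integral_pos_of_hasCompactSupport_nonneg_nonzero (wt_comp hs1) (fun x => b.nonneg)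
      (x := EuclideanSpace.single (⟨0, hn⟩ : Fin n) (1 : ℝ)) ?_
    rw [PiLp.norm_single]
    simp only [norm_one, one_pow]
    rw [b.one_of_mem_closedBall (mem_closedBall_self b.rIn_pos.le)]
    norm_num
  set Z := ∫ x : EuclideanSpace ℝ (Fin n), b (‖x‖ ^ 2) with hZd
  have hbd : ContDiff ℝ 1 (fun s => s * (Z⁻¹ * b s)) :=
    contDiff_id.mul (contDiff_const.mul b.contDiff)
  refine ⟨fun s => Z⁻¹ * b s, deriv (fun s => s * (Z⁻¹ * b s)), by fun_prop,
    fun s => (hbd.differentiable (by simp) s).hasDerivAt, hbd.continuous_deriv le_rfl, fun s => ?_, ?_, ?_, ?_⟩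
  · have := b.nonneg (x := s); positivity
  · refine closure_minimal (fun x hx => hsupp x fun h0 => hx ?_) hAcl
    simp [h0]
  · refine closure_minimal (fun x hx => hsupp x fun h0 => hx ?_) hAcl
    simp [h0]
  · rw [integral_const_mul, ← hZd, inv_mul_cancel₀ hZ.ne']

end

section
open MeasureTheory
namespace CS
variable {n : ℕ} {c p : ℝ} {K : EuclideanSpace ℝ (Fin n) → ℝ} {ξ : ℝ → ℝ}
    {F : ℝ × EuclideanSpace ℝ (Fin n) → ℝ}

theorem hom_unit (h : CS c p K ξ F) {x : EuclideanSpace ℝ (Fin n)} (hx : x ≠ 0) (t : ℝ) :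
    F (t, x) = F (t, ‖x‖⁻¹ • x) :=
  (h.hom t x _ (inv_pos.2 (norm_pos_iff.2 hx))).symm

theorem eq_all (h : CS c p K ξ F) {x : EuclideanSpace ℝ (Fin n)} (hx : x ≠ 0) {t : ℝ} (ht : 0 < t) :
    c ^ 2 * F (t, x) - dtt (fun s => F (s, x)) t - ‖x‖ ^ 2 * lapE (fun z => F (t, z)) x
      = K (exp (-t) • (‖x‖⁻¹ • x)) * F (t, x) ^ p := by
  have hx0 : 0 < ‖x‖ := norm_pos_iff.2 hx
  have hθ : ‖‖x‖⁻¹ • x‖ = 1 := by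
    rw [norm_smul, norm_inv, norm_norm, inv_mul_cancel₀ hx0.ne']
  have h1 := h.eq t ht _ hθ
  have h2 : (fun s => F (s, x)) = fun s => F (s, ‖x‖⁻¹ • x) := funext fun s => h.hom_unit hx s
  have h3 := hom_lap (u := fun z => F (t, z)) (h.hom t) (x := x) (inv_pos.2 hx0)
  have h4 : ‖x‖ ^ 2 * lapE (fun z => F (t, z)) x = lapE (fun z => F (t, z)) (‖x‖⁻¹ • x) := by
    rw [← h3, inv_pow, mul_inv_cancel_left₀ (by positivity)]
  rw [h2, h4, h.hom_unit hx t, ← h1]; ring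

theorem avg (h : CS c p K ξ F) {ξ' : ℝ → ℝ} {T : ℝ} (hF : FD c (K 0) p ξ ξ' T) (hn : 0 < n)
    (hK : ContDiffOn ℝ 1 K (ball 0 1)) (hKp : ∀ x ∈ ball (0 : EuclideanSpace ℝ (Fin n)) 1, 0 < K x)
    {γ A t₂ : ℝ} (hγ : 0 < γ) (hγ1 : γ ≤ 1) (hA : 0 ≤ A)
    (hosc : ∀ t ≥ t₂, ∀ θ θ' : EuclideanSpace ℝ (Fin n), ‖θ‖ = 1 → ‖θ'‖ = 1 →
      |F (t, θ) - F (t, θ')| ≤ A * mf γ t) :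
    ∃ C, ∃ t₁, ∀ t ≥ t₁, ∀ θ : EuclideanSpace ℝ (Fin n), ‖θ‖ = 1 →
      |F (t, θ) - ξ t| ≤ C * mf γ t := by
  obtain ⟨B, G', hB, hG, hG', hB0, hs1, hs2, hw1⟩ := exists_weight hn
  obtain ⟨a, ha, b, hb, C1, hC1, C2, hC2, T0, hT0, hr, H⟩ := h.data hF hK hKp
  obtain ⟨L, hL, hLip⟩ := rpow_lip p (b := b) ha
  have hp1 := hF.p_gt
  have hK0 := hF.hK
  set w : EuclideanSpace ℝ (Fin n) → ℝ := fun x => B (‖x‖ ^ 2) with hw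
  have hwc : Continuous w := by fun_prop
  have hw0 : ∀ x, 0 ≤ w x := fun x => hB0 _
  have hreg : ContDiffOn ℝ (1 + 1) F (UU n) := by
    have e : (1 + 1 : WithTop ℕ∞) = 2 := one_add_one_eq_two
    rw [e]
    exact h.reg
  obtain ⟨hr1, hd1⟩ := tder_reg hreg
  set F1 : ℝ × EuclideanSpace ℝ (Fin n) → ℝ := fun z => deriv (fun s => F (s, z.2)) z.1 with hF1
  have hr1' : ContDiffOn ℝ (0 + 1) F1 (UU n) := by rwa [zero_add]
  obtain ⟨hr2, hd2⟩ := tder_reg hr1'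
  set F2 : ℝ × EuclideanSpace ℝ (Fin n) → ℝ := fun z => deriv (fun s => F1 (s, z.2)) z.1 with hF2
  have hsl : ∀ {H : ℝ × EuclideanSpace ℝ (Fin n) → ℝ}, ContinuousOn H (UU n) → ∀ s > 0,
      ContinuousOn (fun x => H (s, x)) {x | x ≠ 0} := by
    intro H hH s hs
    exact hH.comp (by fun_prop) fun x hx => ⟨hs, hx⟩
  have hFc := hreg.continuousOn
  set y : ℝ → ℝ := fun t => ∫ x, w x * F (t, x) with hy
  set y' : ℝ → ℝ := fun t => ∫ x, w x * F1 (t, x) with hy'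
  set y'' : ℝ → ℝ := fun t => ∫ x, w x * F2 (t, x) with hy''
  have D1 : ∀ t > 0, HasDerivAt y (y' t) t := fun t ht =>
    int_deriv hwc hs1 hFc hr1.continuousOn hd1 ht
  have D2 : ∀ t > 0, HasDerivAt y' (y'' t) t := fun t ht =>
    int_deriv hwc hs1 hr1.continuousOn hr2.continuousOn hd2 ht
  have hun : ∀ x : EuclideanSpace ℝ (Fin n), x ≠ 0 → ‖‖x‖⁻¹ • x‖ = 1 := by
    intro x hx
    rw [norm_smul, norm_inv, norm_norm, inv_mul_cancel₀ (norm_ne_zero_iff.2 hx)]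
  -- closeness of the average
  have hyk : ∀ t > 0, ∀ k M, (∀ θ : EuclideanSpace ℝ (Fin n), ‖θ‖ = 1 → |F (t, θ) - k| ≤ M) →
      |y t - k| ≤ M := by
    intro t ht k M hM
    refine avg_close hwc hs1 hw0 hw1 (hsl hFc t ht) fun x hx => ?_
    rw [h.hom_unit hx]; exact hM _ (hun x hx)
  set t₃ := max T0 t₂ with ht₃
  have h3a : T0 ≤ t₃ := le_max_left _ _
  have h3b : t₂ ≤ t₃ := le_max_right _ _
  have hyF : ∀ t ≥ t₃, ∀ θ : EuclideanSpace ℝ (Fin n), ‖θ‖ = 1 → |F (t, θ) - y t| ≤ A * mf γ t := by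
    intro t ht θ hθ
    rw [abs_sub_comm]
    exact hyk t (by linarith) _ _ fun θ' hθ' => hosc t (by linarith) _ _ hθ' hθ
  have hyI : ∀ t ≥ t₃, y t ∈ Icc a b := by
    intro t ht
    have := hyk t (by linarith) ((a + b) / 2) ((b - a) / 2) fun θ hθ => by
      have := (H t (by linarith) θ hθ).1
      rw [abs_le]; constructor <;> linarith [this.1, this.2]
    rw [abs_le] at this
    constructor <;> linarith [this.1, this.2]
  have hbp : 0 < b ^ p := rpow_pos_of_pos (ha.trans hb) _
  have hmain : ∀ t ≥ t₃, |y'' t - (c ^ 2 * y t - K 0 * y t ^ p)| ≤ (C1 * b ^ p + K 0 * (L * A)) * mf γ t := by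
    intro t ht
    have ht1 : 1 ≤ t := by linarith
    have ht0 : 0 < t := by linarith
    have hux : ContDiffOn ℝ 2 (fun x => F (t, x)) {x | x ≠ 0} :=
      fun x hx => (h.contAt_x ht0 hx).contDiffWithinAt
    obtain ⟨hlc, hl0⟩ := lap_int (u := fun x => F (t, x)) (h.hom t) hux hG hG' hs2
    have hPc : ContinuousOn (fun x => ‖x‖ ^ 2 * lapE (fun z => F (t, z)) x) {x : EuclideanSpace ℝ (Fin n) | x ≠ 0} :=
      (by fun_prop : Continuous fun x : EuclideanSpace ℝ (Fin n) => ‖x‖ ^ 2).continuousOn.mul hlc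
    have hl1 : ∫ x, w x * (‖x‖ ^ 2 * lapE (fun z => F (t, z)) x) = 0 := by
      rw [← hl0]; congr 1; funext x; simp only [hw]; ring
    have hi1 := wt_int hwc hs1 (hsl hFc t ht0)
    have hi2 := wt_int hwc hs1 (hsl hr2.continuousOn t ht0)
    have hi3 := wt_int hwc hs1 hPc
    set P : EuclideanSpace ℝ (Fin n) → ℝ := fun x => c ^ 2 * F (t, x) - F2 (t, x)
      - ‖x‖ ^ 2 * lapE (fun z => F (t, z)) x with hP
    have hPP : ContinuousOn P {x | x ≠ 0} :=
      ((continuousOn_const.mul (hsl hFc t ht0)).sub (hsl hr2.continuousOn t ht0)).sub hPc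
    have hintP : ∫ x, w x * P x = c ^ 2 * y t - y'' t := by
      have e1 : (fun x => w x * P x) = fun x => (c ^ 2 * (w x * F (t, x)) - w x * F2 (t, x))
          - w x * (‖x‖ ^ 2 * lapE (fun z => F (t, z)) x) := by
        funext x; simp only [hP]; ring
      have hi4 : Integrable (fun x => c ^ 2 * (w x * F (t, x)) - w x * F2 (t, x)) :=
        (hi1.const_mul _).sub hi2
      rw [e1, integral_sub hi4 hi3, integral_sub (hi1.const_mul _) hi2, hl1,
        integral_const_mul, sub_zero]
    have hem : exp (-t) ≤ mf γ t := by
      unfold mf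
      calc exp (-t) ≤ exp (-γ * t) := exp_le_exp.2 (by nlinarith)
        _ ≤ t * exp (-γ * t) := le_mul_of_one_le_left (exp_pos _).le ht1
    have := avg_close (k := K 0 * y t ^ p) (M := (C1 * b ^ p + K 0 * (L * A)) * mf γ t) hwc hs1 hw0 hw1 hPP ?_
    · rw [hintP] at this
      rw [← abs_neg]
      convert this using 2; ring
    · intro x hx
      have e2 : P x = K (exp (-t) • (‖x‖⁻¹ • x)) * F (t, x) ^ p := h.eq_all hx ht0
      rw [e2, h.hom_unit hx]
      obtain ⟨hI, -, hk, -⟩ := H t (by linarith) _ (hun x hx)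
      have hf := hyF t ht _ (hun x hx)
      set q := F (t, ‖x‖⁻¹ • x)
      set k := K (exp (-t) • (‖x‖⁻¹ • x))
      have h1 := hLip q hI (y t) (hyI t ht)
      have hq0 : 0 < q := by linarith [hI.1]
      have h2 : q ^ p ≤ b ^ p := rpow_le_rpow hq0.le hI.2 (by linarith)
      have h2' : 0 < q ^ p := rpow_pos_of_pos hq0 _
      have e3 : k * q ^ p - K 0 * y t ^ p = (k - K 0) * q ^ p + K 0 * (q ^ p - y t ^ p) := by ring
      rw [e3]
      calc _ ≤ |(k - K 0) * q ^ p| + |K 0 * (q ^ p - y t ^ p)| := abs_add_le _ _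
        _ = |k - K 0| * q ^ p + K 0 * |q ^ p - y t ^ p| := by
          rw [abs_mul, abs_mul, abs_of_pos h2', abs_of_pos hK0]
        _ ≤ (C1 * mf γ t) * b ^ p + K 0 * (L * (A * mf γ t)) := by
          have h5 : |k - K 0| ≤ C1 * mf γ t := hk.trans (by gcongr)
          have h6 : |q ^ p - y t ^ p| ≤ L * (A * mf γ t) := h1.trans (by gcongr)
          have : 0 ≤ |k - K 0| := abs_nonneg _
          gcongr
          exact this.trans h5
        _ = _ := by ring
  have hAS : AS c (K 0) p ξ γ (C1 * b ^ p + K 0 * (L * A)) t₃ y y' y'' :=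
    { hγ := hγ
      hC := by positivity
      d1 := fun t ht => D1 t (by linarith)
      d2 := fun t ht => D2 t (by linarith)
      pos := fun t ht => ha.trans_le (hyI t ht.le).1
      err := fun t ht => hmain t ht.le
      conv := by
        rw [Metric.tendsto_atTop]
        intro ε hε
        obtain ⟨T1, hT1⟩ := h.conv (ε / 2) (by positivity)
        refine ⟨max T1 1, fun t ht => ?_⟩
        have ht1 := (le_max_left _ _).trans ht
        have ht2 := (le_max_right _ _).trans ht
        have := hyk t (by linarith) (ξ t) (ε / 2) fun θ hθ => (hT1 t ht1 θ hθ).le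
        rw [Real.dist_eq, sub_zero]; linarith }
  obtain ⟨C', t₁, hC'⟩ := AS.rate hF hAS
  refine ⟨A + C', max t₁ t₃, fun t ht θ hθ => ?_⟩
  have h1 := hC' t ((le_max_left _ _).trans ht)
  have h2 := hyF t ((le_max_right _ _).trans ht) θ hθ
  have h3 := abs_sub_le (F (t, θ)) (y t) (ξ t)
  linarith

end CS
end

theorem final_rate {n : ℕ} {c p : ℝ} {K : EuclideanSpace ℝ (Fin n) → ℝ} {ξ ξ' : ℝ → ℝ} {T : ℝ}
    {F : ℝ × EuclideanSpace ℝ (Fin n) → ℝ} (h : CS c p K ξ F) (hF : FD c (K 0) p ξ ξ' T)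
    (hn0 : 0 < n) (hn : 2 * c + 1 = n - 1)
    (hK : ContDiffOn ℝ 1 K (ball 0 1)) (hKp : ∀ x ∈ ball (0 : EuclideanSpace ℝ (Fin n)) 1, 0 < K x) :
    ∃ C > 0, ∀ t > 1, ∀ θ : EuclideanSpace ℝ (Fin n), ‖θ‖ = 1 → |F (t, θ) - ξ t| ≤ C * mf 1 t := by
  set D : ℝ → ℝ := fun t => ⨆ θ : sphere (0 : EuclideanSpace ℝ (Fin n)) 1, |F (t, θ) - ξ t| with hDd
  have hD0 : Tendsto D atTop (nhds 0) := by
    rw [Metric.tendsto_atTop]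
    intro ε hε
    obtain ⟨T1, hT1⟩ := h.conv (ε / 2) (by positivity)
    refine ⟨T1, fun t ht => ?_⟩
    have h1 : D t ≤ ε / 2 := Real.iSup_le
      (fun θ => (hT1 t ht θ (mem_sphere_zero_iff_norm.1 θ.2)).le) (by positivity)
    have h0 : 0 ≤ D t := Real.iSup_nonneg fun θ => abs_nonneg _
    rw [Real.dist_eq, sub_zero, abs_of_nonneg h0]; linarith
  have hD : ∀ᶠ t in atTop, ∀ θ : EuclideanSpace ℝ (Fin n), ‖θ‖ = 1 → |F (t, θ) - ξ t| ≤ D t := by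
    obtain ⟨T1, hT1⟩ := h.conv 1 one_pos
    filter_upwards [eventually_ge_atTop T1] with t ht θ hθ
    refine le_ciSup (f := fun θ : sphere (0 : EuclideanSpace ℝ (Fin n)) 1 => |F (t, θ) - ξ t|)
      ⟨1, ?_⟩ ⟨θ, mem_sphere_zero_iff_norm.2 hθ⟩
    rintro _ ⟨θ', rfl⟩
    exact (hT1 t ht θ' (mem_sphere_zero_iff_norm.1 θ'.2)).le
  obtain ⟨A1, hA1, s1, H1⟩ := h.pass1 hF hn hK hKp hD0 hD
  obtain ⟨C3, s2, H2⟩ := h.avg hF hn0 hK hKp (by norm_num) (by norm_num) hA1 H1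
  obtain ⟨A2, hA2, s3, H3⟩ := h.pass2 hF hn hK hKp (C3 := C3)
    (by filter_upwards [eventually_ge_atTop s2] with t ht using H2 t ht)
  obtain ⟨C4, s4, H4⟩ := h.avg hF hn0 hK hKp one_pos le_rfl hA2 H3
  have hcomp : IsCompact (Icc 1 s4 ×ˢ sphere (0 : EuclideanSpace ℝ (Fin n)) 1) :=
    isCompact_Icc.prod (isCompact_sphere _ _)
  have hcont : ContinuousOn (fun z : ℝ × EuclideanSpace ℝ (Fin n) => F z - ξ z.1)
      (Icc 1 s4 ×ˢ sphere (0 : EuclideanSpace ℝ (Fin n)) 1) := by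
    refine ContinuousOn.sub (h.reg.continuousOn.mono ?_) (hF.cont.comp continuous_fst).continuousOn
    rintro ⟨t, x⟩ ⟨h1, h2⟩
    refine ⟨by have := h1.1; simp only [mem_Ioi]; linarith, ?_⟩
    rintro rfl
    simp at h2
  obtain ⟨M, hM⟩ := hcomp.exists_bound_of_continuousOn hcont
  refine ⟨|C4| + |M| * exp s4 + 1, by positivity, fun t ht θ hθ => ?_⟩
  have hm : 0 ≤ mf 1 t := mf_nonneg (by linarith)
  rcases le_total s4 t with h5 | h5
  · refine (H4 t h5 θ hθ).trans (mul_le_mul_of_nonneg_right ?_ hm)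
    have : 0 ≤ |M| * exp s4 := by positivity
    linarith [le_abs_self C4]
  · have h6 := hM (t, θ) ⟨⟨ht.le, h5⟩, mem_sphere_zero_iff_norm.2 hθ⟩
    rw [norm_eq_abs] at h6
    have h7 : 1 ≤ exp s4 * mf 1 t := by
      unfold mf
      have : 1 ≤ exp s4 * exp (-1 * t) := by
        rw [← exp_add]; exact one_le_exp (by linarith)
      nlinarith
    calc |F (t, θ) - ξ t| ≤ |M| := h6.trans (le_abs_self M)
      _ ≤ |M| * (exp s4 * mf 1 t) := le_mul_of_one_le_right (abs_nonneg _) h7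
      _ ≤ _ := by
        have : 0 ≤ |C4| := abs_nonneg _
        nlinarith

theorem build_FD {n : ℕ} (hn : 3 ≤ n) {K0 : ℝ} (hK0 : 0 < K0) {ξ : ℝ → ℝ} {T : ℝ}
    (hξ : FowlerXi n K0 ξ T) :
    FD (((n : ℝ) - 2) / 2) K0 (((n : ℝ) + 2) / ((n : ℝ) - 2)) ξ (deriv ξ) T := by
  obtain ⟨h1, h2, h3, h4, h5⟩ := hξ
  have hn' : (3 : ℝ) ≤ n := by exact_mod_cast hn
  have hn2 : (n : ℝ) - 2 ≠ 0 := by linarith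
  refine ⟨by linarith, hK0, by field_simp; ring, h2, h3, h4, fun t => ?_, fun t => ?_⟩
  · exact (h1.differentiable (by simp) t).hasDerivAt
  · have h7 : Differentiable ℝ (deriv ξ) := (h1.iterate_deriv' 1 1).differentiable (by simp)
    have h8 := (h7 t).hasDerivAt
    have h9 := h5 t
    unfold dtt at h9
    have h10 : deriv (deriv ξ) t = (((n : ℝ) - 2) / 2) ^ 2 * ξ t
        - K0 * ξ t ^ (((n : ℝ) + 2) / ((n : ℝ) - 2)) := by
      rw [← h9]; ring
    rwa [h10] at h8

theorem build_CS {n : ℕ} {K : EuclideanSpace ℝ (Fin n) → ℝ}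
    {v : ℝ → EuclideanSpace ℝ (Fin n) → ℝ} (hv : SolCyl n K v 0)
    (hvreg : ContDiffOn ℝ 2 (cylRep v)
      ((Ioi (0 : ℝ)) ×ˢ {x : EuclideanSpace ℝ (Fin n) | x ≠ 0}))
    {ξ : ℝ → ℝ} (hconv : UnifConv v ξ) :
    CS (((n : ℝ) - 2) / 2) (((n : ℝ) + 2) / ((n : ℝ) - 2)) K ξ (cylRep v) := by
  have hrep : ∀ t, ∀ θ : EuclideanSpace ℝ (Fin n), ‖θ‖ = 1 → cylRep v (t, θ) = v t θ := by
    intro t θ hθ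
    simp [cylRep, hθ]
  refine ⟨hvreg, fun t x r hr => ?_, fun t ht θ hθ => ?_, fun t ht θ hθ => ?_, fun ε hε => ?_⟩
  · simp only [cylRep]
    rw [norm_smul, norm_of_nonneg hr.le, smul_smul, mul_inv, mul_right_comm, inv_mul_cancel₀ hr.ne',
      one_mul]
  · rw [hrep t θ hθ]; exact hv.1 t θ ht hθ
  · have h1 := hv.2 t θ ht hθ
    have h2 : (fun s => cylRep v (s, θ)) = fun s => v s θ := funext fun s => hrep s θ hθ
    have h3 : lapE (fun x => cylRep v (t, x)) θ = sphLap (v t) θ := rfl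
    rw [h2, h3, hrep t θ hθ, ← h1]; ring
  · obtain ⟨T, hT⟩ := hconv ε hε
    refine ⟨T, fun t ht θ hθ => ?_⟩
    rw [hrep t θ hθ]; exact hT t ht θ hθ

/-- (Theorem 1.3 (i), `β = 1`.) -/
theorem statement_3 (n : ℕ) (hn : 3 ≤ n)
    (K : EuclideanSpace ℝ (Fin n) → ℝ)
    (hK : ContDiffOn ℝ 1 K (ball (0 : EuclideanSpace ℝ (Fin n)) 1))
    (hKpos : ∀ x ∈ ball (0 : EuclideanSpace ℝ (Fin n)) 1, 0 < K x)
    (hKflat : ∃ C > (0 : ℝ), ∃ r > (0 : ℝ), ∀ x : EuclideanSpace ℝ (Fin n),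
      ‖x‖ < r → |K x - K 0| ≤ C * ‖x‖)
    (v : ℝ → EuclideanSpace ℝ (Fin n) → ℝ)
    (hv : SolCyl n K v 0)
    (hvreg : ContDiffOn ℝ 2 (cylRep v)
      ((Ioi (0 : ℝ)) ×ˢ {x : EuclideanSpace ℝ (Fin n) | x ≠ 0}))
    (ξ : ℝ → ℝ) (T : ℝ) (hξ : FowlerXi n (K 0) ξ T)
    (hconv : UnifConv v ξ) :
    ∃ C > (0 : ℝ), ∀ t > (1 : ℝ), ∀ θ : EuclideanSpace ℝ (Fin n), ‖θ‖ = 1 →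
      |v t θ - ξ t| ≤ C * t * Real.exp (-t) := by
  have hFD := build_FD hn (hKpos 0 (mem_ball_self one_pos)) hξ
  have hCS := build_CS hv hvreg hconv
  obtain ⟨C, hC, H⟩ := final_rate hCS hFD (by omega) (by ring) hK hKpos
  refine ⟨C, hC, fun t ht θ hθ => ?_⟩
  have h1 := H t ht θ hθ
  have h2 : cylRep v (t, θ) = v t θ := by simp [cylRep, hθ]
  rw [h2] at h1
  refine h1.trans_eq ?_
  unfold mf
  rw [neg_one_mul]; ring
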